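/- Let Ω be homogeneous of degree zero on ℝⁿ \ {0} with mean value zero on S^{n-1}, and suppose Ω satisfies the L¹-Dini condition. Let μ be an absolutely continuous signed measure on ℝⁿ with |μ|(ℝⁿ) < ∞. Then there is a constant C, depending only on Ω and the dimension n, such that for every λ > 0, λ · m({x ∈ ℝⁿ : |T_Ω μ(x)| > λ}) ≤ C |μ|(ℝⁿ). -/

import Mathlib

open MeasureTheory Filter Set

noncomputable section

/-- The unit sphere `S^{n-1}` in `ℝⁿ`. -/
abbrev unitSphere (n : ℕ) := Metric.sphere (0 : EuclideanSpace ℝ (Fin n)) 1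

/-- The surface (area) measure `σ` on the unit sphere `S^{n-1}`. -/
def sphereMeasure (n : ℕ) : Measure (unitSphere n) :=
  (volume : Measure (EuclideanSpace ℝ (Fin n))).toSphere

/-- `Ω` is homogeneous of degree zero on `ℝⁿ \ {0}`. -/
def HomogeneousZero {n : ℕ} (Ω : EuclideanSpace ℝ (Fin n) → ℝ) : Prop :=
  ∀ c : ℝ, 0 < c → ∀ x : EuclideanSpace ℝ (Fin n), x ≠ 0 → Ω (c • x) = Ω x

/-- The `L¹` integral modulus of continuity of `Ω`, defined via rotations:
`ω₁(δ) = sup_{‖ρ‖ ≤ δ} ∫_{S^{n-1}} |Ω(ρθ) - Ω(θ)| dσ(θ)`, where `ρ` ranges over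
rotations of `ℝⁿ` (linear isometries of determinant `1`) and
`‖ρ‖ = sup{ |ρx' - x'| : x' ∈ S^{n-1} }`. -/
def omegaRot (n : ℕ) (Ω : EuclideanSpace ℝ (Fin n) → ℝ) (δ : ℝ) : ℝ :=
  sSup {I : ℝ | ∃ ρ : EuclideanSpace ℝ (Fin n) ≃ₗᵢ[ℝ] EuclideanSpace ℝ (Fin n),
    LinearMap.det (ρ.toLinearEquiv : EuclideanSpace ℝ (Fin n) →ₗ[ℝ] EuclideanSpace ℝ (Fin n)) = 1 ∧
    (∀ x : EuclideanSpace ℝ (Fin n), ‖x‖ = 1 → ‖ρ x - x‖ ≤ δ) ∧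
    I = ∫ θ : unitSphere n, |Ω (ρ (θ : EuclideanSpace ℝ (Fin n))) - Ω (θ : EuclideanSpace ℝ (Fin n))| ∂(sphereMeasure n)}

/-- The `L¹` integral modulus of continuity of `Ω`, defined via translations:
`ω̃₁(δ) = sup_{|h| ≤ δ} ∫_{S^{n-1}} |Ω(θ + h) - Ω(θ)| dσ(θ)`, where `Ω` is evaluated
off the sphere via its degree-zero homogeneous extension. -/
def omegaTrans (n : ℕ) (Ω : EuclideanSpace ℝ (Fin n) → ℝ) (δ : ℝ) : ℝ :=
  sSup {I : ℝ | ∃ h : EuclideanSpace ℝ (Fin n), ‖h‖ ≤ δ ∧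
    I = ∫ θ : unitSphere n, |Ω ((θ : EuclideanSpace ℝ (Fin n)) + h) - Ω (θ : EuclideanSpace ℝ (Fin n))| ∂(sphereMeasure n)}

/-- `Ω` satisfies the `L¹`-Dini condition. -/
def L1Dini (n : ℕ) (Ω : EuclideanSpace ℝ (Fin n) → ℝ) : Prop :=
  Integrable (fun θ : unitSphere n => Ω (θ : EuclideanSpace ℝ (Fin n))) (sphereMeasure n) ∧
  ∫⁻ δ in Ioo (0 : ℝ) 1, ENNReal.ofReal (omegaRot n Ω δ / δ) < ⊤

/-- The truncated singular integral `∫_{|x-y| > ε} Ω(x-y)|x-y|^{-n} dμ(y)` of a signed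
measure `μ`, where integration against `μ` is via its Jordan decomposition. -/
def truncT (n : ℕ) (Ω : EuclideanSpace ℝ (Fin n) → ℝ)
    (μ : SignedMeasure (EuclideanSpace ℝ (Fin n))) (x : EuclideanSpace ℝ (Fin n)) (ε : ℝ) : ℝ :=
  (∫ y in {y | ε < ‖x - y‖}, Ω (x - y) / ‖x - y‖ ^ n ∂μ.toJordanDecomposition.posPart) -
  (∫ y in {y | ε < ‖x - y‖}, Ω (x - y) / ‖x - y‖ ^ n ∂μ.toJordanDecomposition.negPart)

/-- The principal-value singular integral `T_Ω μ(x) = p.v. ∫ Ω(x-y)|x-y|^{-n} dμ(y)`. -/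
def TOmega (n : ℕ) (Ω : EuclideanSpace ℝ (Fin n) → ℝ)
    (μ : SignedMeasure (EuclideanSpace ℝ (Fin n))) (x : EuclideanSpace ℝ (Fin n)) : ℝ :=
  limUnder (nhdsWithin (0 : ℝ) (Ioi 0)) (truncT n Ω μ x)

section DiniKernel

open scoped ENNReal
open Module

variable {E : Type*} [NormedAddCommGroup E] [InnerProductSpace ℝ E] [FiniteDimensional ℝ E]
  [MeasurableSpace E] [BorelSpace E]

/-- The half-open spherical shell `{x | a < ‖x‖ ≤ b}`. -/
def shell (a b : ℝ) : Set E := {x | a < ‖x‖ ∧ ‖x‖ ≤ b}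

/-- The `L¹` modulus of continuity, under translations, of `K` on the shell `1 < ‖x‖ ≤ 2`. -/
def translationModulus (K : E → ℝ) (t : ℝ) : ℝ≥0∞ :=
  ⨆ h : E, ⨆ _ : ‖h‖ ≤ t, ∫⁻ x in shell 1 2, ‖K (x + h) - K x‖ₑ

/-- Singular kernels, homogeneous of degree `-dim E`, with mean zero and an `L¹`-Dini modulus
of continuity. -/
structure IsDiniKernel (K : E → ℝ) (B : ℝ) : Prop where
  measurable : Measurable K
  homogeneous : ∀ t : ℝ, 0 < t → ∀ x, K (t • x) = (t ^ finrank ℝ E)⁻¹ * K x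
  nonneg : 0 ≤ B
  lintegral_shell_le : ∀ a b : ℝ, 0 < a → a ≤ b →
    ∫⁻ x in shell a b, ‖K x‖ₑ ≤ ENNReal.ofReal (B * Real.log (b / a))
  integral_shell : ∀ a b : ℝ, 0 < a → ∫ x in shell a b, K x = 0
  dini : ∑' j : ℕ, translationModulus K (4⁻¹ * 2⁻¹ ^ j) ≠ ⊤

omit [InnerProductSpace ℝ E] [FiniteDimensional ℝ E] in
@[measurability]
theorem measurableSet_shell (a b : ℝ) : MeasurableSet (shell a b : Set E) :=
  (measurableSet_lt measurable_const measurable_norm).inter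
    (measurableSet_le measurable_norm measurable_const)

theorem lintegral_comp_smul' (G : E → ℝ≥0∞) {R : ℝ} (hR : 0 < R) :
    ∫⁻ x, G x = ENNReal.ofReal (R ^ finrank ℝ E) * ∫⁻ x, G (R • x) := by
  have h1 : ∫⁻ x, G (R • x) = ∫⁻ x, G x ∂(Measure.map (fun x : E => R • x) volume) :=
    ((Homeomorph.smulOfNeZero R hR.ne').measurableEmbedding.lintegral_map (μ := volume) G).symm
  rw [h1, Measure.map_addHaar_smul _ hR.ne', lintegral_smul_measure, abs_of_pos (by positivity),
    smul_eq_mul, ← mul_assoc, ← ENNReal.ofReal_mul (by positivity),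
    mul_inv_cancel₀ (by positivity), ENNReal.ofReal_one, one_mul]

omit [FiniteDimensional ℝ E] [MeasurableSpace E] [BorelSpace E] in
theorem smul_mem_shell {R a b : ℝ} (hR : 0 < R) {x : E} :
    R • x ∈ (shell (R * a) (R * b) : Set E) ↔ x ∈ (shell a b : Set E) := by
  simp only [shell, mem_ofPred_eq, norm_smul, Real.norm_of_nonneg hR.le, mul_lt_mul_iff_right₀ hR,
    mul_le_mul_iff_right₀ hR]

theorem setLIntegral_shell_smul (G : E → ℝ≥0∞) {R : ℝ} (hR : 0 < R) (a b : ℝ) :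
    ∫⁻ x in shell (R * a) (R * b), G x =
      ENNReal.ofReal (R ^ finrank ℝ E) * ∫⁻ x in shell a b, G (R • x) := by
  rw [← lintegral_indicator (measurableSet_shell _ _), lintegral_comp_smul' _ hR,
    ← lintegral_indicator (measurableSet_shell _ _)]
  congr 2 with x
  by_cases hx : x ∈ (shell a b : Set E)
  · rw [indicator_of_mem hx, indicator_of_mem ((smul_mem_shell hR).2 hx)]
  · rw [indicator_of_notMem hx, indicator_of_notMem (mt (smul_mem_shell hR).1 hx)]

omit [InnerProductSpace ℝ E] [FiniteDimensional ℝ E] [MeasurableSpace E] [BorelSpace E] in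
theorem setOf_lt_norm_subset_iUnion_shell {R : ℝ} (hR : 0 < R) :
    {x : E | R < ‖x‖} ⊆ ⋃ j : ℕ, shell (2 ^ j * R) (2 ^ j * R * 2) := by
  intro x hx
  have hx' : R < ‖x‖ := hx
  have h1 : 1 < ‖x‖ / R := by rwa [one_lt_div hR]
  obtain ⟨n, hn1, hn2⟩ := exists_mem_Ioc_zpow (x := ‖x‖ / R) (y := 2) (by positivity) (by norm_num)
  have hn : 0 < n + 1 := by
    by_contra! h
    exact absurd (h1.trans_le (hn2.trans (zpow_le_one_of_nonpos₀ (by norm_num) h))) (lt_irrefl _)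
  obtain ⟨j, rfl⟩ := Int.eq_ofNat_of_zero_le (show 0 ≤ n by lia)
  rw [lt_div_iff₀ hR] at hn1
  rw [div_le_iff₀ hR, zpow_add₀ (by norm_num)] at hn2
  refine mem_iUnion.2 ⟨j, by simpa using hn1, ?_⟩
  simpa [mul_right_comm] using hn2

omit [InnerProductSpace ℝ E] [FiniteDimensional ℝ E] [MeasurableSpace E] [BorelSpace E] in
theorem setOf_norm_le_one_subset_iUnion_shell :
    {x : E | ‖x‖ ≤ 1} \ {0} ⊆ ⋃ j : ℕ, shell (2⁻¹ ^ j / 2) (2⁻¹ ^ j) := by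
  rintro x ⟨hx, hx0⟩
  have hx' : ‖x‖ ≤ 1 := hx
  have hpos : 0 < ‖x‖ := norm_pos_iff.2 hx0
  obtain ⟨n, hn1, hn2⟩ := exists_mem_Ioc_zpow hpos (y := 2) (by norm_num)
  have hn : n + 1 ≤ 0 := by
    by_contra! h
    exact absurd ((one_le_zpow₀ (a := (2 : ℝ)) (by norm_num) (show 0 ≤ n by lia)).trans_lt hn1)
      hx'.not_gt
  obtain ⟨j, hj⟩ := Int.eq_ofNat_of_zero_le (show 0 ≤ -(n + 1) by lia)
  have h1 : n + 1 = -(j : ℤ) := by lia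
  have h2 : n = -(j : ℤ) - 1 := by lia
  rw [h1] at hn2
  rw [h2, zpow_sub₀ (by norm_num)] at hn1
  exact mem_iUnion.2 ⟨j, by simpa using hn1, by simpa using hn2⟩

variable {K : E → ℝ} {B : ℝ}

theorem enorm_le_translationModulus {t : ℝ} {h : E} (h1 : ‖h‖ ≤ t) :
    ∫⁻ x in shell 1 2, ‖K (x + h) - K x‖ₑ ≤ translationModulus K t :=
  le_iSup₂ (f := fun (h : E) (_ : ‖h‖ ≤ t) => ∫⁻ x in shell 1 2, ‖K (x + h) - K x‖ₑ) h h1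

namespace IsDiniKernel

variable (hK : IsDiniKernel K B)
include hK

theorem lintegral_shell_translate_le {R t : ℝ} (hR : 0 < R) {h : E} (h1 : ‖h‖ ≤ R * t) :
    ∫⁻ x in shell R (R * 2), ‖K (x + h) - K x‖ₑ ≤ translationModulus K t := by
  have h2 : ‖R⁻¹ • h‖ ≤ t := by
    rw [norm_smul, norm_inv, Real.norm_of_nonneg hR.le, inv_mul_le_iff₀ hR]
    exact h1
  have := setLIntegral_shell_smul (fun x => ‖K (x + h) - K x‖ₑ) hR 1 2
  rw [mul_one] at this
  rw [this, ← lintegral_const_mul' _ _ (by simp)]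
  refine le_trans (le_of_eq ?_) (enorm_le_translationModulus h2)
  refine lintegral_congr fun x => ?_
  have h3 : R • x + h = R • (x + R⁻¹ • h) := by
    rw [smul_add, smul_inv_smul₀ hR.ne']
  rw [h3, hK.homogeneous R hR, hK.homogeneous R hR, ← mul_sub, enorm_mul,
    Real.enorm_of_nonneg (by positivity), ← mul_assoc, ← ENNReal.ofReal_mul (by positivity),
    mul_inv_cancel₀ (by positivity), ENNReal.ofReal_one, one_mul]

theorem hormander {s : ℝ} (hs : 0 < s) {h : E} (h1 : ‖h‖ ≤ s) :
    ∫⁻ x in {x | 4 * s < ‖x‖}, ‖K (x + h) - K x‖ₑ ≤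
      ∑' j : ℕ, translationModulus K (4⁻¹ * 2⁻¹ ^ j) := by
  refine (lintegral_mono_set (setOf_lt_norm_subset_iUnion_shell (by positivity))).trans ?_
  refine (lintegral_iUnion_le _ _).trans (ENNReal.tsum_le_tsum fun j => ?_)
  refine hK.lintegral_shell_translate_le (by positivity) (h1.trans (le_of_eq ?_))
  rw [inv_pow]
  field_simp

theorem lintegral_shell_two_le {R : ℝ} (hR : 0 < R) :
    ∫⁻ x in shell R (R * 2), ‖K x‖ₑ ≤ ENNReal.ofReal B := by
  refine (hK.lintegral_shell_le R (R * 2) hR (by linarith)).trans (ENNReal.ofReal_le_ofReal ?_)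
  rw [mul_div_cancel_left₀ _ hR.ne']
  have := Real.log_two_lt_d9
  exact mul_le_of_le_one_right hK.nonneg (by linarith)

theorem lintegral_mul_inv_norm_le {s : ℝ} (hs : 0 < s) :
    ∫⁻ x in {x | 4 * s < ‖x‖}, ‖K x‖ₑ * ENNReal.ofReal (s / ‖x‖) ≤ ENNReal.ofReal B := by
  refine (lintegral_mono_set (setOf_lt_norm_subset_iUnion_shell (by positivity))).trans ?_
  refine (lintegral_iUnion_le _ _).trans ?_
  calc ∑' j : ℕ, ∫⁻ x in shell (2 ^ j * (4 * s)) (2 ^ j * (4 * s) * 2),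
        ‖K x‖ₑ * ENNReal.ofReal (s / ‖x‖)
      ≤ ∑' j : ℕ, ENNReal.ofReal B * 2⁻¹ ^ (j + 1) := by
        refine ENNReal.tsum_le_tsum fun j => ?_
        calc _ ≤ ∫⁻ x in shell (2 ^ j * (4 * s)) (2 ^ j * (4 * s) * 2), ‖K x‖ₑ * 2⁻¹ ^ (j + 1) := by
              refine setLIntegral_mono' (measurableSet_shell _ _) fun x hx => ?_
              gcongr
              have hx1 : 2 ^ j * (4 * s) < ‖x‖ := hx.1
              have : s / ‖x‖ ≤ (2⁻¹ : ℝ) ^ (j + 1) := by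
                rw [div_le_iff₀ ((by positivity : (0 : ℝ) < 2 ^ j * (4 * s)).trans hx1), inv_pow,
                  ← div_eq_inv_mul, le_div_iff₀ (by positivity), pow_succ]
                nlinarith [pow_pos (zero_lt_two' ℝ) j]
              refine (ENNReal.ofReal_le_ofReal this).trans (le_of_eq ?_)
              rw [ENNReal.ofReal_pow (by norm_num), ENNReal.ofReal_inv_of_pos (by norm_num)]
              norm_num
          _ ≤ _ := by
              rw [lintegral_mul_const' _ _ (by simp)]
              gcongr
              exact hK.lintegral_shell_two_le (by positivity)
    _ = ENNReal.ofReal B := by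
        rw [ENNReal.tsum_mul_left, ENNReal.tsum_geometric_add_one]
        simp [ENNReal.inv_mul_cancel]

theorem lintegral_mul_norm_le :
    ∫⁻ x in {x | ‖x‖ ≤ 1}, ‖K x‖ₑ * ‖x‖ₑ ≤ ENNReal.ofReal B * 2 := by
  have h0 : ∫⁻ x in {x | ‖x‖ ≤ 1}, ‖K x‖ₑ * ‖x‖ₑ = ∫⁻ x in {x | ‖x‖ ≤ 1} \ {0}, ‖K x‖ₑ * ‖x‖ₑ := by
    have hm : MeasurableSet {x : E | ‖x‖ ≤ 1} := measurableSet_le measurable_norm measurable_const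
    rw [← lintegral_indicator hm, ← lintegral_indicator (hm.diff (measurableSet_singleton 0))]
    congr 1 with x
    by_cases hx : x = 0
    · simp [hx, indicator]
    · simp [indicator, hx]
  rw [h0]
  refine (lintegral_mono_set setOf_norm_le_one_subset_iUnion_shell).trans ?_
  refine (lintegral_iUnion_le _ _).trans ?_
  calc ∑' j : ℕ, ∫⁻ x in shell (2⁻¹ ^ j / 2) (2⁻¹ ^ j), ‖K x‖ₑ * ‖x‖ₑ
      ≤ ∑' j : ℕ, ENNReal.ofReal B * 2⁻¹ ^ j := by
        refine ENNReal.tsum_le_tsum fun j => ?_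
        calc _ ≤ ∫⁻ x in shell (2⁻¹ ^ j / 2) (2⁻¹ ^ j), ‖K x‖ₑ * 2⁻¹ ^ j := by
              refine setLIntegral_mono' (measurableSet_shell _ _) fun x hx => ?_
              gcongr
              rw [← ofReal_norm]
              refine (ENNReal.ofReal_le_ofReal hx.2).trans (le_of_eq ?_)
              rw [ENNReal.ofReal_pow (by norm_num), ENNReal.ofReal_inv_of_pos (by norm_num)]
              norm_num
          _ ≤ _ := by
              rw [lintegral_mul_const' _ _ (by simp)]
              gcongr
              have := hK.lintegral_shell_two_le (R := 2⁻¹ ^ j / 2) (by positivity)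
              rwa [div_mul_cancel₀ _ (by norm_num)] at this
    _ = ENNReal.ofReal B * 2 := by
        rw [ENNReal.tsum_mul_left, ENNReal.tsum_geometric]
        simp

/-- The kernel has uniformly bounded mass on balls of a fixed radius, away from the origin. -/
theorem lintegral_closedBall_le {a m : ℝ} (ha : 0 < a) (hm : 0 < m) (y : E) :
    ∫⁻ x in {x | a < ‖x‖ ∧ ‖x - y‖ ≤ m}, ‖K x‖ₑ ≤
      ENNReal.ofReal (B * Real.log (3 * m / a + 1)) + ENNReal.ofReal (B * Real.log 6) := by
  rcases le_total ‖y‖ (2 * m) with h | h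
  · refine le_add_right ?_
    have hs : {x | a < ‖x‖ ∧ ‖x - y‖ ≤ m} ⊆ shell a (3 * m + a) := by
      rintro x ⟨h1, h2⟩
      have := norm_le_norm_add_norm_sub' x y
      exact ⟨h1, by linarith⟩
    refine (lintegral_mono_set hs).trans ?_
    have := hK.lintegral_shell_le a (3 * m + a) ha (by linarith)
    rwa [add_div, div_self ha.ne'] at this
  · refine le_add_left ?_
    have hy : 0 < ‖y‖ := by linarith
    have hs : {x | a < ‖x‖ ∧ ‖x - y‖ ≤ m} ⊆ shell (‖y‖ / 3) (‖y‖ * 2) := by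
      rintro x ⟨h1, h2⟩
      have h3 := norm_le_norm_add_norm_sub' x y
      have h4 := norm_le_norm_add_norm_sub x y
      exact ⟨by linarith, by linarith⟩
    refine (lintegral_mono_set hs).trans ?_
    have := hK.lintegral_shell_le (‖y‖ / 3) (‖y‖ * 2) (by positivity) (by linarith)
    rwa [show ‖y‖ * 2 / (‖y‖ / 3) = 6 by field_simp; norm_num] at this

end IsDiniKernel

end DiniKernel

section Plancherel

open scoped ENNReal FourierTransform Topology Convolution SchwartzMap ContDiff

variable {E : Type*} [NormedAddCommGroup E] [InnerProductSpace ℝ E] [FiniteDimensional ℝ E]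
  [MeasurableSpace E] [BorelSpace E]

/-- On `L¹ ∩ L²`, the `L²` Fourier transform is given by the Fourier integral. -/
lemma fourier_toLp_ae_eq {g : E → ℂ} (hg : Integrable g) (hg2 : MemLp g 2) :
    (𝓕 (hg2.toLp g) : Lp ℂ 2 (volume : Measure E)) =ᵐ[volume] 𝓕 g := by
  apply ae_eq_of_integral_contDiff_smul_eq
  · exact (Lp.memLp _).locallyIntegrable (by norm_num)
  · exact (VectorFourier.fourierIntegral_continuous Real.continuous_fourierChar
      continuous_inner hg).locallyIntegrable
  · intro φ φs φc
    have hφ₁ : HasCompactSupport (Complex.ofRealCLM ∘ φ) := φc.comp_left rfl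
    have hφ₂ : ContDiff ℝ ∞ (Complex.ofRealCLM ∘ φ) := by fun_prop
    set Φ : 𝓢(E, ℂ) := hφ₁.toSchwartzMap hφ₂
    have h1 := DFunLike.congr_fun (Lp.fourier_toTemperedDistribution_eq (hg2.toLp g)) Φ
    rw [TemperedDistribution.fourier_apply, Lp.toTemperedDistribution_apply,
      Lp.toTemperedDistribution_apply] at h1
    have h2 : ∫ x, (Φ x) • 𝓕 g x = ∫ x, (𝓕 Φ) x • g x := by
      have h := VectorFourier.integral_fourierIntegral_smul_eq_flip (μ := volume) (ν := volume)
        (L := innerₗ E) (f := Φ) (g := g) Real.continuous_fourierChar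
        continuous_inner Φ.integrable hg
      rw [flip_innerₗ] at h
      rw [SchwartzMap.fourier_coe]
      exact h.symm
    calc ∫ x, φ x • (𝓕 (hg2.toLp g) : Lp ℂ 2 (volume : Measure E)) x
        = ∫ x, Φ x • (𝓕 (hg2.toLp g) : Lp ℂ 2 (volume : Measure E)) x := by simp [Φ]
      _ = ∫ x, (𝓕 Φ) x • (hg2.toLp g) x := h1.symm
      _ = ∫ x, (𝓕 Φ) x • g x := by
          refine integral_congr_ae ?_
          filter_upwards [hg2.coeFn_toLp] with x hx
          rw [hx]
      _ = ∫ x, Φ x • 𝓕 g x := h2.symm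
      _ = _ := by simp [Φ]

lemma memLp_two_of_integrable_of_bound {g : E → ℂ} {M : ℝ} (hg : Integrable g)
    (hM : ∀ᵐ x, ‖g x‖ ≤ M) : MemLp g 2 := by
  rw [memLp_two_iff_integrable_sq_norm hg.1]
  simp_rw [sq]
  exact hg.norm.bdd_mul hg.1.norm (by simpa using hM)

lemma norm_convolution_le_of_bound {k g : E → ℂ} {M : ℝ} (hM : ∀ᵐ x, ‖g x‖ ≤ M)
    (hk : Integrable k) (x : E) :
    ‖(k ⋆[ContinuousLinearMap.mul ℂ ℂ] g) x‖ ≤ (∫ y, ‖k y‖) * M := by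
  rw [convolution_def, ← integral_mul_const]
  refine norm_integral_le_of_norm_le (hk.norm.mul_const M) ?_
  filter_upwards [(quasiMeasurePreserving_sub_left volume x).ae hM] with y hy
  simp only [ContinuousLinearMap.mul_apply', norm_mul]
  gcongr

/-- Convolution with kernels whose Fourier transforms are uniformly bounded and converge pointwise
converges in `L²`. -/
lemma exists_tendsto_convolution_L2 [Nontrivial E] {k : ℕ → E → ℂ} (hk : ∀ N, Integrable (k N))
    {A : ℝ} (hA : ∀ N ξ, ‖𝓕 (k N) ξ‖ ≤ A)
    (hlim : ∀ ξ ≠ 0, ∃ L, Tendsto (fun N => 𝓕 (k N) ξ) atTop (𝓝 L))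
    {g : E → ℂ} {M : ℝ} (hg : Integrable g) (hM : ∀ᵐ x, ‖g x‖ ≤ M) :
    ∃ F : E → ℂ, MemLp F 2 ∧ eLpNorm F 2 volume ≤ ENNReal.ofReal A * eLpNorm g 2 volume ∧
      Tendsto (fun N => eLpNorm (k N ⋆[ContinuousLinearMap.mul ℂ ℂ] g - F) 2 volume)
        atTop (𝓝 0) := by
  have hg2 := memLp_two_of_integrable_of_bound hg hM
  have hc1 N : Integrable (k N ⋆[ContinuousLinearMap.mul ℂ ℂ] g) := (hk N).integrable_convolution _ hg
  have hc2 N := memLp_two_of_integrable_of_bound (hc1 N)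
    (ae_of_all _ (norm_convolution_le_of_bound hM (hk N)))
  have hF N : (𝓕 ((hc2 N).toLp _) : Lp ℂ 2 (volume : Measure E)) =ᵐ[volume] fun ξ => 𝓕 (k N) ξ * 𝓕 g ξ := by
    refine (fourier_toLp_ae_eq (hc1 N) (hc2 N)).trans (ae_of_all _ fun ξ => ?_)
    exact Real.fourier_mul_convolution_eq (hk N) hg ξ
  set G' : Lp ℂ 2 (volume : Measure E) := 𝓕 (hg2.toLp g) with hG'
  set G : E → ℂ := ⇑G' with hG
  have hGm : MemLp G 2 := Lp.memLp _
  have hGn : eLpNorm G 2 volume = eLpNorm g 2 volume := by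
    rw [hG, ← Lp.enorm_def, ← Lp.enorm_toLp (hf := hg2)]
    rw [← ofReal_norm, ← ofReal_norm, hG', Lp.norm_fourier_eq]
  have hF' N : (𝓕 ((hc2 N).toLp _) : Lp ℂ 2 (volume : Measure E)) =ᵐ[volume] fun ξ => 𝓕 (k N) ξ * G ξ := by
    filter_upwards [hF N, fourier_toLp_ae_eq hg hg2] with ξ h1 h2
    rw [h1, hG, hG', h2]
  choose! m hm using hlim
  have hne : ∀ᵐ ξ : E, ξ ≠ 0 := by simp [ae_iff]
  have hmA : ∀ᵐ ξ, ‖m ξ * G ξ‖ ≤ A * ‖G ξ‖ := by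
    filter_upwards [hne] with ξ hξ
    rw [norm_mul]
    gcongr
    exact le_of_tendsto (hm ξ hξ).norm (Eventually.of_forall fun N => hA N ξ)
  have hkm N : AEStronglyMeasurable (fun ξ => 𝓕 (k N) ξ * G ξ) :=
    (Lp.memLp _).1.congr (hF' N)
  have hmm : AEStronglyMeasurable (fun ξ => m ξ * G ξ) := by
    refine aestronglyMeasurable_of_tendsto_ae atTop hkm ?_
    filter_upwards [hne] with ξ hξ using (hm ξ hξ).mul_const _
  have hm2 : MemLp (fun ξ => m ξ * G ξ) 2 := hGm.of_le_mul hmm hmA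
  set F : Lp ℂ 2 (volume : Measure E) := 𝓕⁻ (hm2.toLp _ : Lp ℂ 2 (volume : Measure E)) with hFd
  refine ⟨F, Lp.memLp F, ?_, ?_⟩
  · calc eLpNorm F 2 volume = eLpNorm (fun ξ => m ξ * G ξ) 2 volume := by
          rw [← Lp.enorm_def, ← Lp.enorm_toLp (hf := hm2), ← ofReal_norm, ← ofReal_norm,
            ← Lp.norm_fourier_eq, hFd, FourierTransform.fourier_fourierInv_eq]
      _ ≤ ENNReal.ofReal A * eLpNorm G 2 volume := eLpNorm_le_mul_eLpNorm_of_ae_le_mul hmA 2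
      _ = _ := by rw [hGn]
  · have e1 N : eLpNorm (k N ⋆[ContinuousLinearMap.mul ℂ ℂ] g - ⇑F) 2 volume
        = eLpNorm (fun ξ => 𝓕 (k N) ξ * G ξ - m ξ * G ξ) 2 volume := by
      calc _ = ‖(hc2 N).toLp _ - F‖ₑ := by
            rw [Lp.enorm_def]
            refine eLpNorm_congr_ae ?_
            filter_upwards [Lp.coeFn_sub ((hc2 N).toLp _) F, (hc2 N).coeFn_toLp] with x h1 h2
            rw [h1, Pi.sub_apply, Pi.sub_apply, h2]
        _ = ‖𝓕 ((hc2 N).toLp _ : Lp ℂ 2 (volume : Measure E)) - hm2.toLp _‖ₑ := by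
            rw [← ofReal_norm, ← ofReal_norm, ← Lp.norm_fourier_eq, sub_eq_add_neg,
              FourierTransform.fourier_add, FourierTransform.fourier_neg, ← sub_eq_add_neg,
              hFd, FourierTransform.fourier_fourierInv_eq]
        _ = _ := by
            rw [Lp.enorm_def]
            refine eLpNorm_congr_ae ?_
            filter_upwards [Lp.coeFn_sub (𝓕 ((hc2 N).toLp _ : Lp ℂ 2 (volume : Measure E))) (hm2.toLp _), hF' N,
              hm2.coeFn_toLp] with x h1 h2 h3
            rw [h1, Pi.sub_apply, h2, h3]
    simp_rw [e1, eLpNorm_eq_lintegral_rpow_enorm_toReal two_ne_zero ENNReal.ofNat_ne_top]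
    have key : Tendsto (fun N => ∫⁻ ξ, ‖𝓕 (k N) ξ * G ξ - m ξ * G ξ‖ₑ ^ (2 : ℝ≥0∞).toReal)
        atTop (𝓝 (∫⁻ _ : E, 0)) := by
      refine tendsto_lintegral_of_dominated_convergence'
        (fun ξ => ‖2 * A * ‖G ξ‖‖ₑ ^ (2 : ℝ≥0∞).toReal)
        (fun N => ((hkm N).sub hmm).enorm.pow_const _) (fun N => ?_) ?_ ?_
      · filter_upwards [hmA] with ξ h1
        gcongr
        rw [enorm_le_iff_norm_le]
        refine le_trans ?_ (le_abs_self _)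
        refine (norm_sub_le _ _).trans ?_
        have : ‖𝓕 (k N) ξ * G ξ‖ ≤ A * ‖G ξ‖ := by
          rw [norm_mul]; gcongr; exact hA N ξ
        linarith
      · exact (lintegral_rpow_enorm_lt_top_of_eLpNorm_lt_top two_ne_zero ENNReal.ofNat_ne_top
          (hGm.norm.const_mul (2 * A)).2).ne
      · filter_upwards [hne] with ξ hξ
        have h1 : Tendsto (fun N => 𝓕 (k N) ξ * G ξ - m ξ * G ξ) atTop (𝓝 0) := by
          simpa using ((hm ξ hξ).mul_const (G ξ)).sub_const (m ξ * G ξ)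
        have h2 := (ENNReal.continuous_rpow_const (y := (2 : ℝ≥0∞).toReal)).tendsto _ |>.comp h1.enorm
        simpa [Function.comp_def] using h2
    have h2 := (ENNReal.continuous_rpow_const (y := 1 / (2 : ℝ≥0∞).toReal)).tendsto _ |>.comp key
    simpa [Function.comp_def] using h2

end Plancherel

section Multiplier

lemma norm_sum_range_le_tsum_int {F : ℤ → ℂ} {b : ℤ → ℝ} (hb : Summable b)
    (h : ∀ i, ‖F i‖ ≤ b i) (N : ℕ) :
    ‖∑ i ∈ Finset.range N, (F i + F (-((i : ℤ) + 1)))‖ ≤ ∑' i, b i := by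
  have hs : Summable fun i : ℤ => ‖F i‖ := Summable.of_nonneg_of_le (fun _ => norm_nonneg _) h hb
  refine (norm_sum_le _ _).trans ((Finset.sum_le_sum fun i _ => norm_add_le _ _).trans ?_)
  refine (sum_le_hasSum (Finset.range N) (fun i _ => by positivity)
    hs.hasSum.nat_add_neg_add_one).trans ?_
  exact hs.tsum_le_tsum h hb

open scoped ENNReal FourierTransform Topology
open Module

variable {E : Type*} [NormedAddCommGroup E] [InnerProductSpace ℝ E] [FiniteDimensional ℝ E]
  [MeasurableSpace E] [BorelSpace E] {K : E → ℝ} {B : ℝ}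

lemma IsDiniKernel.integrableOn_shell (hK : IsDiniKernel K B) {a : ℝ} (ha : 0 < a) (b : ℝ) :
    IntegrableOn K (shell a b) := by
  refine ⟨hK.measurable.aestronglyMeasurable, ?_⟩
  rcases le_total a b with hab | hab
  · exact (hK.lintegral_shell_le a b ha hab).trans_lt ENNReal.ofReal_lt_top
  · have : (shell a b : Set E) = ∅ := by
      ext x; simp only [shell, Set.mem_ofPred_eq, mem_empty_iff_false, iff_false]
      rintro ⟨h1, h2⟩; linarith
    rw [this]
    simp [HasFiniteIntegral]

/-- The Fourier transform of the kernel restricted to an annulus. -/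
def shellFourier (K : E → ℝ) (ξ : E) (a b : ℝ) : ℂ :=
  𝓕 (fun x : E => (((shell a b).indicator K x : ℝ) : ℂ)) ξ

lemma shellFourier_eq (K : E → ℝ) (ξ : E) (a b : ℝ) :
    shellFourier K ξ a b = ∫ x in shell a b, Real.fourierChar (-inner ℝ x ξ) • (K x : ℂ) := by
  rw [shellFourier, Real.fourier_eq, ← integral_indicator (measurableSet_shell a b)]
  congr with x
  by_cases hx : x ∈ shell a b <;> simp [hx]

lemma IsDiniKernel.integrableOn_fourierChar (hK : IsDiniKernel K B) {a : ℝ} (ha : 0 < a) (b : ℝ)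
    (ξ : E) : IntegrableOn (fun x => Real.fourierChar (-inner ℝ x ξ) • (K x : ℂ)) (shell a b) := by
  have := (hK.integrableOn_shell ha b).ofReal (𝕜 := ℂ)
  exact (Real.fourierIntegral_convergent_iff ξ).2 this

lemma IsDiniKernel.shellFourier_add (hK : IsDiniKernel K B) (ξ : E) {a b c : ℝ} (ha : 0 < a)
    (hab : a ≤ b) (hbc : b ≤ c) :
    shellFourier K ξ a c = shellFourier K ξ a b + shellFourier K ξ b c := by
  simp only [shellFourier_eq]
  rw [← setIntegral_union _ (measurableSet_shell b c) (hK.integrableOn_fourierChar ha b ξ)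
    (hK.integrableOn_fourierChar (ha.trans_le hab) c ξ)]
  · congr 2
    ext x
    simp only [shell, Set.mem_ofPred_eq, mem_union]
    constructor
    · rintro ⟨h1, h2⟩
      rcases le_or_gt ‖x‖ b with h | h
      · exact .inl ⟨h1, h⟩
      · exact .inr ⟨h, h2⟩
    · rintro (⟨h1, h2⟩ | ⟨h1, h2⟩)
      · exact ⟨h1, h2.trans hbc⟩
      · exact ⟨hab.trans_lt h1, h2⟩
  · rw [Set.disjoint_left]
    rintro x ⟨_, h1⟩ ⟨h2, _⟩
    linarith

lemma IsDiniKernel.norm_shellFourier_le_mul (hK : IsDiniKernel K B) (ξ : E) {R : ℝ} (hR : 0 < R) :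
    ‖shellFourier K ξ R (R * 2)‖ ≤ 4 * Real.pi * R * ‖ξ‖ * B := by
  have hI := hK.integrableOn_shell hR (R * 2)
  have hIc : IntegrableOn (fun x => (K x : ℂ)) (shell R (R * 2)) := hI.ofReal
  have h0 : ∫ x in shell R (R * 2), (K x : ℂ) = 0 := by
    rw [integral_complex_ofReal, hK.integral_shell R _ hR]; simp
  have hKB : ∫ x in shell R (R * 2), ‖K x‖ ≤ B := by
    rw [integral_norm_eq_lintegral_enorm hI.1]
    exact ENNReal.toReal_le_of_le_ofReal hK.nonneg (hK.lintegral_shell_two_le hR)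
  rw [shellFourier_eq, ← sub_zero (∫ x in shell R (R * 2), _ • _), ← h0,
    ← integral_sub (hK.integrableOn_fourierChar hR _ ξ) hIc]
  calc _ ≤ ∫ x in shell R (R * 2), 4 * Real.pi * R * ‖ξ‖ * ‖K x‖ := by
        refine norm_integral_le_of_norm_le (hI.norm.const_mul _) ?_
        refine ae_restrict_of_forall_mem (measurableSet_shell _ _) fun x hx => ?_
        have : Real.fourierChar (-inner ℝ x ξ) • (K x : ℂ) - (K x : ℂ)
            = ((Real.fourierChar (-inner ℝ x ξ) : ℂ) - 1) * K x := by
          rw [Circle.smul_def, smul_eq_mul]; ring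
        rw [this, norm_mul, Complex.norm_real]
        gcongr
        rw [Real.fourierChar_apply]
        have h2 := Real.norm_exp_I_mul_ofReal_sub_one_le (x := 2 * Real.pi * -inner ℝ x ξ)
        rw [mul_comm] at h2
        refine h2.trans ?_
        rw [norm_mul, Real.norm_of_nonneg (by positivity), norm_neg]
        have h3 := norm_inner_le_norm (𝕜 := ℝ) x ξ
        have h4 : ‖x‖ * ‖ξ‖ ≤ (R * 2) * ‖ξ‖ := by gcongr; exact hx.2
        have := Real.pi_pos
        calc _ ≤ 2 * Real.pi * ((R * 2) * ‖ξ‖) := by gcongr; exact h3.trans h4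
          _ = _ := by ring
    _ = 4 * Real.pi * R * ‖ξ‖ * ∫ x in shell R (R * 2), ‖K x‖ := integral_const_mul _ _
    _ ≤ _ := by gcongr

/-- The `L¹` modulus of continuity of the kernel cut off to an annulus. -/
lemma IsDiniKernel.lintegral_indicator_translate_le (hK : IsDiniKernel K B) {R t : ℝ} {h : E}
    (hR : 0 < R) (ht : t ≤ 4⁻¹) (hh : ‖h‖ ≤ R * t) :
    ∫⁻ x, ‖(shell R (R * 2)).indicator K (x + h) - (shell R (R * 2)).indicator K x‖ₑ ≤
      translationModulus K t + ENNReal.ofReal (4 * B * t) := by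
  set S : Set E := shell R (R * 2)
  set T : Set E := shell R (R * (1 + t)) ∪ shell (R * (2 - t)) (R * 2)
  have hS : MeasurableSet S := measurableSet_shell _ _
  have hT : MeasurableSet T := (measurableSet_shell _ _).union (measurableSet_shell _ _)
  have ht0 : 0 ≤ t := by
    by_contra! hc
    nlinarith [norm_nonneg h, mul_neg_of_pos_of_neg hR hc]
  have hB := hK.nonneg
  have hTle : ∫⁻ x in T, ‖K x‖ₑ ≤ ENNReal.ofReal (2 * B * t) := by
    refine (lintegral_union_le _ _ _).trans ?_
    rw [show 2 * B * t = B * t + B * t by ring, ENNReal.ofReal_add (by positivity) (by positivity)]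
    gcongr
    · refine (hK.lintegral_shell_le _ _ hR (by nlinarith)).trans ?_
      gcongr
      refine (Real.log_le_sub_one_of_pos (by positivity)).trans ?_
      field_simp; linarith
    · have : 0 < R * (2 - t) := by apply mul_pos hR; linarith
      refine (hK.lintegral_shell_le _ _ this (by nlinarith)).trans ?_
      gcongr
      refine (Real.log_le_sub_one_of_pos (by positivity)).trans ?_
      have h2 : 0 < 2 - t := by linarith
      rw [mul_div_mul_left _ _ hR.ne', div_sub_one h2.ne', div_le_iff₀ h2]
      nlinarith
  have hpt : ∀ x, ‖S.indicator K (x + h) - S.indicator K x‖ₑ ≤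
      S.indicator (fun x => ‖K (x + h) - K x‖ₑ) x + (T.indicator (fun x => ‖K x‖ₑ) x +
        T.indicator (fun x => ‖K x‖ₑ) (x + h)) := by
    have hmem : ∀ x y : E, x ∈ S → y ∉ S → ‖x - y‖ ≤ R * t → x ∈ T := by
      intro x y hx hy hxy
      have h1 := norm_le_norm_add_norm_sub' x y
      have h2 := norm_le_norm_add_norm_sub x y
      by_cases hy1 : R < ‖y‖
      · right
        have : R * 2 < ‖y‖ := by
          by_contra! hc
          exact hy ⟨hy1, hc⟩
        exact ⟨by nlinarith, hx.2⟩
      · left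
        exact ⟨hx.1, by nlinarith⟩
    intro x
    by_cases h1 : x ∈ S <;> by_cases h2 : x + h ∈ S
    · simp only [indicator_of_mem, h1, h2]
      exact le_self_add
    · have := hmem x (x + h) h1 h2 (by simpa using hh)
      simp only [indicator_of_mem, h1, h2, this, indicator_of_notMem, not_false_eq_true,
        zero_sub, enorm_neg]
      exact le_add_left le_self_add
    · have := hmem (x + h) x h2 h1 (by simpa using hh)
      simp only [indicator_of_mem, h1, h2, this, indicator_of_notMem, not_false_eq_true,
        sub_zero]
      exact le_add_left le_add_self
    · simp [h1, h2]
  have hKm := hK.measurable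
  have hm1 : Measurable (S.indicator fun x => ‖K (x + h) - K x‖ₑ) :=
    (((hKm.comp (measurable_id.add_const h)).sub hKm).enorm).indicator hS
  have hm2 : Measurable (T.indicator fun x => ‖K x‖ₑ) := hKm.enorm.indicator hT
  calc _ ≤ _ := lintegral_mono hpt
    _ = (∫⁻ x in S, ‖K (x + h) - K x‖ₑ) + ((∫⁻ x in T, ‖K x‖ₑ) + ∫⁻ x in T, ‖K x‖ₑ) := by
        rw [lintegral_add_left hm1, lintegral_add_left hm2, lintegral_indicator hS,
          lintegral_add_right_eq_self (fun x => T.indicator (fun x => ‖K x‖ₑ) x) h,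
          lintegral_indicator hT]
    _ ≤ _ := by
        gcongr
        · exact hK.lintegral_shell_translate_le hR hh
        · rw [show 4 * B * t = 2 * B * t + 2 * B * t by ring,
            ENNReal.ofReal_add (by positivity) (by positivity)]
          gcongr

lemma IsDiniKernel.translationModulus_ne_top (hK : IsDiniKernel K B) (j : ℕ) :
    translationModulus K (4⁻¹ * 2⁻¹ ^ j) ≠ ⊤ :=
  ENNReal.ne_top_of_tsum_ne_top hK.dini j

lemma IsDiniKernel.norm_shellFourier_le_modulus (hK : IsDiniKernel K B) {ξ : E} (hξ : ξ ≠ 0)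
    {R : ℝ} (hR : 0 < R) (j : ℕ) (hj : (2 * ‖ξ‖)⁻¹ ≤ R * (4⁻¹ * 2⁻¹ ^ j)) :
    ‖shellFourier K ξ R (R * 2)‖ ≤
      (translationModulus K (4⁻¹ * 2⁻¹ ^ j)).toReal + B * 2⁻¹ ^ j := by
  have hB := hK.nonneg
  set f : E → ℝ := (shell R (R * 2)).indicator K
  have hf : Integrable f := (integrable_indicator_iff (measurableSet_shell _ _)).2
    (hK.integrableOn_shell hR _)
  have hfc : Integrable (fun x => (f x : ℂ)) := hf.ofReal
  have hξ' : 0 < ‖ξ‖ := norm_pos_iff.2 hξ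
  set h : E := (2 * ‖ξ‖ ^ 2)⁻¹ • ξ with hh
  have hn : ‖h‖ = (2 * ‖ξ‖)⁻¹ := by
    rw [hh, norm_smul, Real.norm_of_nonneg (by positivity)]
    field_simp
  have hi : inner ℝ h ξ = 1 / 2 := by
    rw [hh, real_inner_smul_left, real_inner_self_eq_norm_sq]
    field_simp
  have hhalf : Real.fourierChar (1 / 2) = (-1 : ℂ) := by
    rw [Real.fourierChar_apply]
    rw [← Complex.exp_pi_mul_I]
    congr 2
    push_cast; ring
  have h1 : shellFourier K ξ R (R * 2) = ∫ x, Real.fourierChar (-inner ℝ x ξ) • (f x : ℂ) := by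
    rw [shellFourier, Real.fourier_eq]
  have h2 : ∫ x, Real.fourierChar (-inner ℝ x ξ) • (f (x + h) : ℂ)
      = - shellFourier K ξ R (R * 2) := by
    rw [h1, ← integral_neg, ← integral_add_right_eq_self
      (fun x => -(Real.fourierChar (-inner ℝ x ξ) • (f x : ℂ))) h]
    congr with x
    have : -inner ℝ x ξ = -inner ℝ (x + h) ξ + 1 / 2 := by
      rw [inner_add_left, hi]; ring
    rw [this, AddChar.map_add_eq_mul, Circle.smul_def, Circle.smul_def, Circle.coe_mul, hhalf]
    simp
  have hfh : Integrable (fun x => (f (x + h) : ℂ)) := hfc.comp_add_right h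
  have h3 : 2 * ‖shellFourier K ξ R (R * 2)‖ ≤ ∫ x, ‖f (x + h) - f x‖ := by
    have : (2 : ℂ) * shellFourier K ξ R (R * 2) =
        -∫ x, Real.fourierChar (-inner ℝ x ξ) • ((f (x + h) - f x : ℝ) : ℂ) := by
      push_cast
      simp_rw [smul_sub]
      rw [integral_sub, h2, ← h1]
      · ring
      · exact (Real.fourierIntegral_convergent_iff ξ).2 hfh
      · exact (Real.fourierIntegral_convergent_iff ξ).2 hfc
    calc 2 * ‖shellFourier K ξ R (R * 2)‖ = ‖(2 : ℂ) * shellFourier K ξ R (R * 2)‖ := by simp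
      _ ≤ _ := by
          rw [this, norm_neg]
          refine (norm_integral_le_integral_norm _).trans_eq ?_
          congr with x
          rw [Circle.norm_smul, Complex.norm_real]
  have h4 : ∫ x, ‖f (x + h) - f x‖ ≤
      (translationModulus K (4⁻¹ * 2⁻¹ ^ j)).toReal + B * 2⁻¹ ^ j := by
    rw [integral_norm_eq_lintegral_enorm (f := fun x => f (x + h) - f x)
      ((hf.comp_add_right h).sub hf).1]
    have := hK.lintegral_indicator_translate_le (h := h) (t := 4⁻¹ * 2⁻¹ ^ j) hR
      (mul_le_of_le_one_right (by norm_num) (pow_le_one₀ (by norm_num) (by norm_num)))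
      (hn.trans_le hj)
    refine (ENNReal.toReal_mono (ENNReal.add_ne_top.2
      ⟨hK.translationModulus_ne_top j, ENNReal.ofReal_ne_top⟩) this).trans_eq ?_
    rw [ENNReal.toReal_add (hK.translationModulus_ne_top j) ENNReal.ofReal_ne_top,
      ENNReal.toReal_ofReal (by positivity)]
    ring
  linarith [norm_nonneg (shellFourier K ξ R (R * 2))]

/-- Truncations of the kernel to dyadic annuli. -/
def dyadicTrunc (K : E → ℝ) (N : ℕ) (x : E) : ℝ := (shell (2⁻¹ ^ N) (2 ^ N)).indicator K x

lemma IsDiniKernel.integrable_dyadicTrunc (hK : IsDiniKernel K B) (N : ℕ) :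
    Integrable (fun x => dyadicTrunc K N x) :=
  (integrable_indicator_iff (measurableSet_shell _ _)).2 (hK.integrableOn_shell (by positivity) _)

/-- The Fourier transforms of the dyadic truncations are uniformly bounded and converge. -/
lemma IsDiniKernel.exists_fourier_dyadicTrunc_bound (hK : IsDiniKernel K B) :
    ∃ A : ℝ, (∀ N (ξ : E), ‖𝓕 (fun x : E => ((dyadicTrunc K N x : ℝ) : ℂ)) ξ‖ ≤ A) ∧
      ∀ ξ : E, ξ ≠ 0 →
        ∃ L, Tendsto (fun N => 𝓕 (fun x : E => ((dyadicTrunc K N x : ℝ) : ℂ)) ξ) atTop (𝓝 L) := by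
  have hB := hK.nonneg
  set b : ℤ → ℝ := fun i => if 0 ≤ i then
    (translationModulus K (4⁻¹ * 2⁻¹ ^ i.toNat)).toReal + B * 2⁻¹ ^ i.toNat
    else 16 * Real.pi * B * 2 ^ i with hb
  have hbs : Summable b := by
    refine Summable.of_nat_of_neg_add_one ?_ ?_
    · simp only [hb, Int.natCast_nonneg, if_true, Int.toNat_natCast]
      refine (ENNReal.summable_toReal hK.dini).add (Summable.mul_left _ ?_)
      exact summable_geometric_of_lt_one (by norm_num) (by norm_num)
    · have : ∀ n : ℕ, b (-((n : ℤ) + 1)) = 16 * Real.pi * B * (2⁻¹ * 2⁻¹ ^ n) := by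
        intro n
        have h : ¬ (0 ≤ -((n : ℤ) + 1)) := by omega
        simp only [hb, h, if_false]
        rw [zpow_neg, ← pow_succ', inv_pow]
        norm_cast
      simp_rw [this]
      refine Summable.mul_left _ (Summable.mul_left _ ?_)
      exact summable_geometric_of_lt_one (by norm_num) (by norm_num)
  have key : ∀ ξ : E, ξ ≠ 0 → ∃ n : ℤ, ∀ i : ℤ,
      ‖shellFourier K ξ (2 ^ i) (2 ^ i * 2)‖ ≤ b (i - n) := by
    intro ξ hξ
    have hξ' : 0 < ‖ξ‖ := norm_pos_iff.2 hξ
    obtain ⟨n, hn1, hn2⟩ := exists_mem_Ico_zpow (x := 4 * (2 * ‖ξ‖)⁻¹) (y := 2)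
      (by positivity) (by norm_num)
    refine ⟨n + 1, fun i => ?_⟩
    simp only [hb]
    split_ifs with hi
    · obtain ⟨j, hj⟩ := Int.eq_ofNat_of_zero_le hi
      rw [hj, Int.toNat_natCast]
      refine hK.norm_shellFourier_le_modulus hξ (by positivity) j ?_
      have : (2 : ℝ) ^ i = 2 ^ (n + 1) * 2 ^ j := by
        rw [← zpow_natCast, ← zpow_add₀ (by norm_num)]
        congr 1; omega
      rw [this, inv_pow]
      field_simp
      field_simp at hn2
      linarith
    · refine (hK.norm_shellFourier_le_mul ξ (by positivity)).trans ?_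
      have : (2 : ℝ) ^ i = 2 ^ (i - (n + 1)) * 2 * 2 ^ n := by
        rw [mul_assoc, ← zpow_one_add₀ (by norm_num), ← zpow_add₀ (by norm_num)]
        congr 1; omega
      rw [this]
      have h5 : (2 : ℝ) ^ n * ‖ξ‖ ≤ 2 := by
        field_simp at hn1
        linarith
      calc _ = (8 * Real.pi * B * 2 ^ (i - (n + 1))) * (2 ^ n * ‖ξ‖) := by ring
        _ ≤ (8 * Real.pi * B * 2 ^ (i - (n + 1))) * 2 := by
          have := Real.pi_pos
          gcongr
        _ = _ := by ring
  have htel : ∀ (ξ : E) (N : ℕ), 𝓕 (fun x : E => ((dyadicTrunc K N x : ℝ) : ℂ)) ξ =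
      ∑ i ∈ Finset.range N, (shellFourier K ξ (2 ^ (i : ℤ)) (2 ^ (i : ℤ) * 2) +
        shellFourier K ξ (2 ^ (-((i : ℤ) + 1))) (2 ^ (-((i : ℤ) + 1)) * 2)) := by
    intro ξ N
    change shellFourier K ξ (2⁻¹ ^ N) (2 ^ N) = _
    induction N with
    | zero =>
      have : (shell 1 1 : Set E) = ∅ := by
        ext x; simp only [shell, Set.mem_ofPred_eq, mem_empty_iff_false, iff_false]
        rintro ⟨h1, h2⟩; linarith
      simp [shellFourier_eq, this]
    | succ N ih =>
      have e1 : (2 : ℝ) ^ (-((N : ℤ) + 1)) = 2⁻¹ ^ (N + 1) := by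
        rw [zpow_neg, inv_pow]; norm_cast
      have e2 : (2⁻¹ : ℝ) ^ (N + 1) * 2 = 2⁻¹ ^ N := by rw [pow_succ]; ring
      have h1 : (2⁻¹ : ℝ) ^ N ≤ 1 := pow_le_one₀ (by norm_num) (by norm_num)
      have h2 : (1 : ℝ) ≤ 2 ^ N := one_le_pow₀ (by norm_num)
      have h3 : (0 : ℝ) < 2⁻¹ ^ N := by positivity
      have h4 : (2⁻¹ : ℝ) ^ (N + 1) ≤ 2⁻¹ ^ N := by rw [← e2]; linarith [e2]
      rw [Finset.sum_range_succ, ← ih, e1, e2, zpow_natCast, pow_succ (2 : ℝ) N,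
        hK.shellFourier_add ξ (by positivity) h4 (by linarith),
        hK.shellFourier_add ξ h3 (h1.trans h2) (by linarith)]
      ring
  refine ⟨∑' i, b i, ?_, ?_⟩
  · intro N ξ
    have hb0 : 0 ≤ ∑' i, b i := by
      refine tsum_nonneg fun i => ?_
      have := Real.pi_pos
      simp only [hb]
      split_ifs <;> positivity
    by_cases hξ : ξ = 0
    · have : 𝓕 (fun x : E => ((dyadicTrunc K N x : ℝ) : ℂ)) ξ = 0 := by
        change shellFourier K ξ (2⁻¹ ^ N) (2 ^ N) = _
        rw [shellFourier_eq, hξ]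
        simp only [inner_zero_right, neg_zero, AddChar.map_zero_eq_one, one_smul]
        rw [integral_complex_ofReal, hK.integral_shell _ _ (by positivity)]; simp
      rw [this, norm_zero]
      exact hb0
    · obtain ⟨n, hn⟩ := key ξ hξ
      have hs : Summable fun i => b (i - n) := hbs.comp_injective (sub_left_injective (b := n))
      rw [htel, ← (Equiv.subRight n).tsum_eq b]
      exact norm_sum_range_le_tsum_int hs hn N
  · intro ξ hξ
    obtain ⟨n, hn⟩ := key ξ hξ
    have hs : Summable fun i => b (i - n) := hbs.comp_injective (sub_left_injective (b := n))
    have hs' : Summable fun i : ℤ => shellFourier K ξ (2 ^ i) (2 ^ i * 2) :=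
      Summable.of_norm_bounded hs hn
    simp_rw [htel]
    exact ⟨_, hs'.hasSum.nat_add_neg_add_one.tendsto_sum_nat⟩

end Multiplier

section ApproximateIdentity

open scoped ENNReal Topology
open Module

variable {E : Type*} [NormedAddCommGroup E] [InnerProductSpace ℝ E] [FiniteDimensional ℝ E]
  [MeasurableSpace E] [BorelSpace E]

/-- The `L¹`-normalized dilation of a function. -/
def dilate (D : E → ℝ) (ε : ℝ) (z : E) : ℝ := (ε ^ finrank ℝ E)⁻¹ * D (ε⁻¹ • z)

lemma integral_dilate (D : E → ℝ) {ε : ℝ} (hε : 0 < ε) : ∫ z, dilate D ε z = ∫ z, D z := by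
  simp only [dilate]
  rw [integral_const_mul, Measure.integral_comp_inv_smul_of_nonneg _ _ hε.le, smul_eq_mul,
    inv_mul_cancel_left₀ (by positivity)]

lemma MeasureTheory.Integrable.dilate {D : E → ℝ} (hD : Integrable D) {ε : ℝ} (hε : 0 < ε) :
    Integrable (dilate D ε) :=
  (hD.comp_smul (inv_ne_zero hε.ne')).const_mul _

lemma integral_norm_dilate (D : E → ℝ) {ε : ℝ} (hε : 0 < ε) :
    ∫ z, ‖dilate D ε z‖ = ∫ z, ‖D z‖ := by
  rw [← integral_dilate (fun z => ‖D z‖) hε]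
  congr with z
  simp only [_root_.dilate, norm_mul, norm_inv, norm_pow, Real.norm_of_nonneg hε.le]

lemma tendsto_dilate_of_bounded_support {D : E → ℝ} {m : ℝ} (hm : 0 < m) (hD : Integrable D)
    (hb : ∀ z, ‖D z‖ ≤ m) (hs : ∀ z, m < ‖z‖ → D z = 0) {F : E → ℝ} (hF : LocallyIntegrable F) :
    ∀ᵐ x, Tendsto (fun ε => ∫ y, dilate D ε (x - y) * F y) (𝓝[>] 0) (𝓝 ((∫ z, D z) * F x)) := by
  filter_upwards [IsUnifLocDoublingMeasure.ae_tendsto_average_norm_sub volume hF 1] with x hx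
  have hδ : Tendsto (fun ε : ℝ => m * ε) (𝓝[>] 0) (𝓝[>] 0) := by
    refine tendsto_nhdsWithin_iff.2 ⟨?_, ?_⟩
    · have : Tendsto (fun ε : ℝ => m * ε) (𝓝 0) (𝓝 (m * 0)) := tendsto_id.const_mul m
      rw [mul_zero] at this
      exact this.mono_left nhdsWithin_le_nhds
    · filter_upwards [self_mem_nhdsWithin] with ε hε
      exact mul_pos hm hε
  have h1 := hx (fun _ : ℝ => x) (fun ε => m * ε) hδ (by
    filter_upwards [self_mem_nhdsWithin] with ε hε
    have : 0 < m * ε := mul_pos hm hε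
    simp [this.le])
  have h2 : Tendsto (fun ε => m * (m ^ finrank ℝ E * volume.real (Metric.closedBall (0 : E) 1)) *
      ⨍ y in Metric.closedBall x (m * ε), ‖F y - F x‖) (𝓝[>] 0) (𝓝 0) := by
    simpa using h1.const_mul (m * (m ^ finrank ℝ E * volume.real (Metric.closedBall (0 : E) 1)))
  rw [tendsto_iff_norm_sub_tendsto_zero]
  refine squeeze_zero' (Eventually.of_forall fun _ => norm_nonneg _) ?_ h2
  filter_upwards [self_mem_nhdsWithin] with ε (hε : 0 < ε)
  have hbd : ∀ z, ‖dilate D ε z‖ ≤ (ε ^ finrank ℝ E)⁻¹ * m := by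
    intro z
    rw [dilate, norm_mul, Real.norm_of_nonneg (by positivity)]
    gcongr
    exact hb _
  have hsu : ∀ y, y ∉ Metric.closedBall x (m * ε) → dilate D ε (x - y) = 0 := by
    intro y hy
    rw [dilate, hs, mul_zero]
    rw [Metric.mem_closedBall, dist_comm, dist_eq_norm, not_le] at hy
    rw [norm_smul, norm_inv, Real.norm_of_nonneg hε.le, ← div_eq_inv_mul, lt_div_iff₀ hε]
    exact hy
  have hFb : IntegrableOn F (Metric.closedBall x (m * ε)) :=
    hF.integrableOn_isCompact (isCompact_closedBall _ _)
  have hdm : AEStronglyMeasurable fun y => dilate D ε (x - y) :=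
    ((hD.dilate hε).comp_sub_left x).1
  have hFi : Integrable fun y => dilate D ε (x - y) * F y := by
    rw [← integrableOn_iff_integrable_of_support_subset (s := Metric.closedBall x (m * ε))]
    · exact hFb.bdd_mul hdm.restrict (ae_of_all _ fun y => hbd (x - y))
    · intro y hy
      by_contra hc
      exact hy (by simp only [hsu y hc, zero_mul])
  have hDi : Integrable fun y => dilate D ε (x - y) * F x :=
    ((hD.dilate hε).comp_sub_left x).mul_const _
  have e1 : (∫ y, dilate D ε (x - y) * F y) - (∫ z, D z) * F x =
      ∫ y in Metric.closedBall x (m * ε), dilate D ε (x - y) * (F y - F x) := by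
    rw [setIntegral_eq_integral_of_forall_compl_eq_zero
      (fun y hy => by rw [hsu y hy, zero_mul])]
    simp_rw [mul_sub]
    rw [integral_sub hFi hDi, integral_mul_const,
      integral_sub_left_eq_self (fun z => dilate D ε z) volume x, integral_dilate D hε]
  rw [e1]
  have hv : volume.real (Metric.closedBall x (m * ε)) =
      (m * ε) ^ finrank ℝ E * volume.real (Metric.closedBall (0 : E) 1) := by
    rw [Measure.real, Measure.addHaar_closedBall' _ _ (by positivity), ENNReal.toReal_mul,
      ENNReal.toReal_ofReal (by positivity), Measure.real]
  calc _ ≤ ∫ y in Metric.closedBall x (m * ε), (ε ^ finrank ℝ E)⁻¹ * m * ‖F y - F x‖ := by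
        refine norm_integral_le_of_norm_le ?_ (ae_of_all _ fun y => ?_)
        · refine Integrable.const_mul (Integrable.norm (Integrable.sub hFb ?_)) _
          exact integrableOn_const (measure_closedBall_lt_top.ne)
        · rw [norm_mul]
          gcongr
          exact hbd _
    _ = (ε ^ finrank ℝ E)⁻¹ * m * ∫ y in Metric.closedBall x (m * ε), ‖F y - F x‖ :=
        integral_const_mul _ _
    _ = _ := by
        have hpos : 0 < volume.real (Metric.closedBall x (m * ε)) :=
          ENNReal.toReal_pos (Metric.measure_closedBall_pos _ _ (by positivity)).ne'
            measure_closedBall_lt_top.ne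
        rw [setAverage_eq, smul_eq_mul, hv, mul_pow]
        rw [hv, mul_pow] at hpos
        have : volume.real (Metric.closedBall (0 : E) 1) ≠ 0 := fun h => by simp [h] at hpos
        field_simp

lemma tendsto_dilate_of_bounded {D : E → ℝ} (hD : Integrable D) {g : E → ℝ} {M : ℝ}
    (hg : AEStronglyMeasurable g) (hM : ∀ᵐ x, ‖g x‖ ≤ M) :
    ∀ᵐ x, Tendsto (fun ε => ∫ y, dilate D ε (x - y) * g y) (𝓝[>] 0) (𝓝 ((∫ z, D z) * g x)) := by
  have hgl : LocallyIntegrable g :=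
    ((memLp_top_of_bound hg M hM).locallyIntegrable le_top)
  have happ : ∀ N : ℕ, ∃ D' : E → ℝ, HasCompactSupport D' ∧ ∫ z, ‖D z - D' z‖ ≤ 1 / (N + 1 : ℝ) ∧
      Continuous D' ∧ Integrable D' := fun N =>
    hD.exists_hasCompactSupport_integral_sub_le (by positivity)
  choose D' hcs hle hc hi using happ
  have hlim : ∀ N, ∀ᵐ x, Tendsto (fun ε => ∫ y, dilate (D' N) ε (x - y) * g y) (𝓝[>] 0)
      (𝓝 ((∫ z, D' N z) * g x)) := by
    intro N
    obtain ⟨C, hC⟩ := (hc N).bounded_above_of_compact_support (hcs N)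
    obtain ⟨R, hR⟩ := (hcs N).isCompact.isBounded.subset_closedBall 0
    set m := max (max C R) 1
    refine tendsto_dilate_of_bounded_support (m := m) (by positivity) (hi N)
      (fun z => (hC z).trans ((le_max_left _ _).trans (le_max_left _ _))) (fun z hz => ?_) hgl
    by_contra hne
    have := hR (subset_tsupport _ hne)
    rw [mem_closedBall_zero_iff] at this
    have h2 : R ≤ m := (le_max_right _ _).trans (le_max_left _ _)
    linarith
  filter_upwards [ae_all_iff.2 hlim, hM] with x hx hMx
  have hM0 : 0 ≤ M := (norm_nonneg _).trans hMx
  have hdiff : ∀ N, ∀ ε > 0, ‖(∫ y, dilate D ε (x - y) * g y) -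
      ∫ y, dilate (D' N) ε (x - y) * g y‖ ≤ 1 / (N + 1 : ℝ) * M := by
    intro N ε hε
    have i1 : ∀ {D : E → ℝ}, Integrable D → Integrable fun y => dilate D ε (x - y) * g y :=
      fun hD => ((hD.dilate hε).comp_sub_left x).mul_bdd hg hM
    rw [← integral_sub (i1 hD) (i1 (hi N))]
    calc _ ≤ ∫ y, ‖dilate (fun z => D z - D' N z) ε (x - y)‖ * M := by
          refine norm_integral_le_of_norm_le
            ((((hD.sub (hi N)).dilate hε).comp_sub_left x).norm.mul_const M) ?_
          filter_upwards [hM] with y hy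
          rw [← sub_mul, norm_mul]
          have : dilate D ε (x - y) - dilate (D' N) ε (x - y) =
              dilate (fun z => D z - D' N z) ε (x - y) := by simp only [dilate]; ring
          rw [this]
          gcongr
      _ = (∫ z, ‖D z - D' N z‖) * M := by
          rw [integral_mul_const, integral_sub_left_eq_self
            (fun z => ‖dilate (fun z => D z - D' N z) ε z‖) volume x, integral_norm_dilate _ hε]
      _ ≤ _ := by gcongr; exact hle N
  have hdiff2 : ∀ N, ‖(∫ z, D z) * g x - (∫ z, D' N z) * g x‖ ≤ 1 / (N + 1 : ℝ) * M := by
    intro N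
    rw [← sub_mul, norm_mul, ← integral_sub hD (hi N)]
    gcongr
    exact (norm_integral_le_integral_norm _).trans (hle N)
  rw [Metric.tendsto_nhds]
  intro η hη
  have ht : Tendsto (fun N : ℕ => 1 / (N + 1 : ℝ) * M) atTop (𝓝 0) := by
    simpa using (tendsto_one_div_add_atTop_nhds_zero_nat (𝕜 := ℝ)).mul_const M
  obtain ⟨N, hN⟩ := (ht.eventually (gt_mem_nhds (show (0 : ℝ) < η / 3 by positivity))).exists
  filter_upwards [Metric.tendsto_nhds.1 (hx N) (η / 3) (by positivity), self_mem_nhdsWithin]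
    with ε h1 hε
  have h2 := hdiff N ε hε
  have h3 := hdiff2 N
  rw [← dist_eq_norm] at h2 h3
  rw [dist_comm] at h3
  linarith [dist_triangle4 (∫ y, dilate D ε (x - y) * g y) (∫ y, dilate (D' N) ε (x - y) * g y)
    ((∫ z, D' N z) * g x) ((∫ z, D z) * g x)]

end ApproximateIdentity

section TruncatedIntegrals

open scoped ENNReal FourierTransform Topology Convolution
open Module

variable {E : Type*} [NormedAddCommGroup E] [InnerProductSpace ℝ E] [FiniteDimensional ℝ E]
  [MeasurableSpace E] [BorelSpace E] {K : E → ℝ} {B : ℝ}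

lemma IsDiniKernel.exists_L2_limit [Nontrivial E] (hK : IsDiniKernel K B) :
    ∃ A : ℝ, ∀ (g : E → ℝ) (M : ℝ), Integrable g → (∀ᵐ x, ‖g x‖ ≤ M) →
      ∃ F : E → ℝ, MemLp F 2 ∧ eLpNorm F 2 volume ≤ ENNReal.ofReal A * eLpNorm g 2 volume ∧
        Tendsto (fun N => eLpNorm (fun x => (∫ y, dyadicTrunc K N (x - y) * g y) - F x) 2 volume)
          atTop (𝓝 0) := by
  obtain ⟨A, hA, hlim⟩ := hK.exists_fourier_dyadicTrunc_bound
  refine ⟨A, fun g M hg hM => ?_⟩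
  obtain ⟨F, hF, hFle, hFt⟩ := exists_tendsto_convolution_L2
    (k := fun N x => ((dyadicTrunc K N x : ℝ) : ℂ)) (fun N => (hK.integrable_dyadicTrunc N).ofReal)
    hA hlim (g := fun x => (g x : ℂ)) hg.ofReal (M := M) (by simpa using hM)
  have hre : ∀ z : ℂ, ‖z.re‖ ≤ ‖z‖ := fun z => by simpa using Complex.abs_re_le_norm z
  refine ⟨fun x => (F x).re, hF.re, ?_, ?_⟩
  · calc _ ≤ eLpNorm F 2 volume := eLpNorm_mono fun x => hre _
      _ ≤ _ := hFle
      _ = _ := by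
        congr 1
        exact eLpNorm_congr_norm_ae (ae_of_all _ fun x => by simp)
  · refine tendsto_of_tendsto_of_tendsto_of_le_of_le tendsto_const_nhds hFt
      (fun _ => bot_le) fun N => ?_
    refine eLpNorm_mono fun x => ?_
    have : ((fun x => ((dyadicTrunc K N x : ℝ) : ℂ)) ⋆[ContinuousLinearMap.mul ℂ ℂ]
        fun x => (g x : ℂ)) x = ((∫ y, dyadicTrunc K N (x - y) * g y : ℝ) : ℂ) := by
      rw [convolution_eq_swap, ← integral_complex_ofReal]
      simp
    rw [Pi.sub_apply, this]
    convert hre _ using 1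
    simp

/-- The truncated convolutions are absolutely convergent almost everywhere. -/
lemma IsDiniKernel.ae_integrableOn (hK : IsDiniKernel K B) {f : E → ℝ} (hf : Integrable f) :
    ∀ᵐ x, ∀ ε > 0, IntegrableOn (fun y => K (x - y) * f y) {y | ε < ‖x - y‖} := by
  have hKm := hK.measurable
  have hset : ∀ (a : ℝ) (x : E), MeasurableSet {y : E | a < ‖x - y‖} := fun a x =>
    measurableSet_lt measurable_const (measurable_const.sub measurable_id).norm
  wlog hfm : Measurable f generalizing f
  · have h := this (hf.congr hf.1.ae_eq_mk) hf.1.measurable_mk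
    filter_upwards [h] with x hx ε hε
    refine (hx ε hε).congr_fun_ae (ae_restrict_of_ae ?_)
    filter_upwards [hf.1.ae_eq_mk] with y hy
    rw [hy]
  have key : ∀ k N : ℕ, ∀ᵐ x ∂(volume.restrict (Metric.closedBall (0 : E) (N + 1))),
      ∫⁻ y in {y | (1 / (k + 1 : ℝ)) < ‖x - y‖}, ‖K (x - y)‖ₑ * ‖f y‖ₑ < ⊤ := by
    intro k N
    set a : ℝ := 1 / (k + 1 : ℝ) with ha
    have ha0 : 0 < a := by positivity
    set G : E → E → ℝ≥0∞ := fun x y =>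
      {p : E × E | a < ‖p.1 - p.2‖}.indicator (fun p => ‖K (p.1 - p.2)‖ₑ * ‖f p.2‖ₑ) (x, y) with hG
    have hGm : Measurable (Function.uncurry G) := by
      refine Measurable.indicator ?_
        (measurableSet_lt measurable_const (measurable_fst.sub measurable_snd).norm)
      exact (hKm.comp (measurable_fst.sub measurable_snd)).enorm.mul
        (hfm.comp measurable_snd).enorm
    have hGe : ∀ x, ∫⁻ y in {y | a < ‖x - y‖}, ‖K (x - y)‖ₑ * ‖f y‖ₑ = ∫⁻ y, G x y := by
      intro x
      rw [← lintegral_indicator (hset a x)]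
      rfl
    simp_rw [hGe]
    refine ae_lt_top hGm.lintegral_prod_right' (ne_of_lt ?_)
    rw [lintegral_lintegral_swap hGm.aemeasurable]
    have hin : ∀ y, ∫⁻ x in Metric.closedBall (0 : E) (N + 1), G x y ≤
        (ENNReal.ofReal (B * Real.log (3 * (N + 1) / a + 1)) + ENNReal.ofReal (B * Real.log 6)) *
          ‖f y‖ₑ := by
      intro y
      have hm0 : (0 : ℝ) < N + 1 := by positivity
      refine le_trans ?_ (mul_le_mul_left (hK.lintegral_closedBall_le ha0 hm0 (-y)) ‖f y‖ₑ)
      rw [← lintegral_mul_const _ hKm.enorm, ← lintegral_indicator measurableSet_closedBall,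
        ← lintegral_indicator (by
          refine (measurableSet_lt measurable_const measurable_norm).inter ?_
          exact measurableSet_le (measurable_id.sub_const _).norm measurable_const)]
      refine le_of_le_of_eq (lintegral_mono fun x => ?_) (lintegral_sub_right_eq_self _ y)
      by_cases h1 : x ∈ Metric.closedBall (0 : E) (N + 1) <;> by_cases h2 : a < ‖x - y‖
      · have h3 : x - y ∈ {x | a < ‖x‖ ∧ ‖x - -y‖ ≤ (N : ℝ) + 1} := by
          refine ⟨h2, ?_⟩
          simpa using h1
        rw [indicator_of_mem h1, indicator_of_mem h3, hG]
        simp [h2]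
      · simp [h1, h2, hG]
      · simp [h1]
      · simp [h1]
    refine (lintegral_mono hin).trans_lt ?_
    rw [lintegral_const_mul _ hfm.enorm]
    exact ENNReal.mul_lt_top (by simp) hf.2
  have key2 : ∀ᵐ x, ∀ k N : ℕ, x ∈ Metric.closedBall (0 : E) (N + 1) →
      ∫⁻ y in {y | (1 / (k + 1 : ℝ)) < ‖x - y‖}, ‖K (x - y)‖ₑ * ‖f y‖ₑ < ⊤ := by
    simp_rw [ae_all_iff]
    intro k N
    exact (ae_restrict_iff' measurableSet_closedBall).1 (key k N)
  filter_upwards [key2] with x hx ε hε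
  obtain ⟨k, hk⟩ := exists_nat_one_div_lt hε
  obtain ⟨N, hN⟩ := exists_nat_ge ‖x‖
  have h1 := hx k N (by rw [mem_closedBall_zero_iff]; linarith)
  refine ⟨((hKm.comp (measurable_const.sub measurable_id)).mul hfm).aestronglyMeasurable, ?_⟩
  refine lt_of_le_of_lt ?_ h1
  simp only [enorm_mul]
  exact lintegral_mono_set fun y (hy : ε < ‖x - y‖) => hk.trans hy

end TruncatedIntegrals

section SmoothTruncation

open scoped ENNReal Topology
open Module

variable {E : Type*} [NormedAddCommGroup E] [InnerProductSpace ℝ E] [FiniteDimensional ℝ E]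
  [MeasurableSpace E] [BorelSpace E] {K : E → ℝ} {B : ℝ}

/-- A Lipschitz probability density supported in the unit ball. -/
structure IsLipschitzBump (ψ : E → ℝ) (c : ℝ) : Prop where
  continuous : Continuous ψ
  integrable : Integrable ψ
  integral_eq_one : ∫ x, ψ x = 1
  nonneg : ∀ x, 0 ≤ ψ x
  le : ∀ x, ψ x ≤ c
  lipschitz : ∀ x y, ‖ψ x - ψ y‖ ≤ c * ‖x - y‖
  eq_zero : ∀ x, 1 < ‖x‖ → ψ x = 0

variable (E) in
lemma exists_isLipschitzBump : ∃ (ψ : E → ℝ) (c : ℝ), IsLipschitzBump ψ c := by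
  set φ : E → ℝ := fun x => max 0 (1 - ‖x‖) with hφ
  have hc : Continuous φ := by fun_prop
  have hz : ∀ x, 1 < ‖x‖ → φ x = 0 := fun x hx => max_eq_left (by linarith)
  have h0 : ∀ x, 0 ≤ φ x := fun x => le_max_left _ _
  have hs : HasCompactSupport φ :=
    HasCompactSupport.of_support_subset_isCompact (isCompact_closedBall (0 : E) 1) fun x hx => by
      rw [mem_closedBall_zero_iff]
      by_contra! h
      exact hx (hz x h)
  have hi : Integrable φ := hc.integrable_of_hasCompactSupport hs
  have hpos : 0 < ∫ x, φ x :=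
    hc.integral_pos_of_hasCompactSupport_nonneg_nonzero hs h0 (x := 0) (by simp [hφ])
  refine ⟨fun x => (∫ x, φ x)⁻¹ * φ x, (∫ x, φ x)⁻¹, hc.const_mul _, hi.const_mul _, ?_, ?_, ?_,
    ?_, ?_⟩
  · rw [integral_const_mul, inv_mul_cancel₀ hpos.ne']
  · exact fun x => mul_nonneg (by positivity) (h0 x)
  · refine fun x => mul_le_of_le_one_right (by positivity) (max_le zero_le_one ?_)
    linarith [norm_nonneg x]
  · intro x y
    rw [← mul_sub, norm_mul, Real.norm_of_nonneg (by positivity)]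
    gcongr
    refine (abs_max_sub_max_le_max _ _ _ _).trans ?_
    simp only [sub_self, abs_zero, sub_sub_sub_cancel_left]
    refine max_le (norm_nonneg _) ?_
    rw [norm_sub_rev]
    exact abs_norm_sub_norm_le y x
  · intro x hx
    simp [hz x hx]

variable {ψ : E → ℝ} {c : ℝ}

lemma IsLipschitzBump.const_nonneg (hψ : IsLipschitzBump ψ c) : 0 ≤ c :=
  (hψ.nonneg 0).trans (hψ.le 0)

lemma IsLipschitzBump.norm_le (hψ : IsLipschitzBump ψ c) (x : E) : ‖ψ x‖ ≤ c := by
  rw [Real.norm_of_nonneg (hψ.nonneg x)]; exact hψ.le x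

lemma IsDiniKernel.lintegral_mul_bump_sub_le (hK : IsDiniKernel K B) (hψ : IsLipschitzBump ψ c)
    (x : E) : ∫⁻ y in {y | ‖y‖ ≤ 1}, ‖K y * (ψ (x - y) - ψ x)‖ₑ ≤ ENNReal.ofReal (c * (B * 2)) := by
  have hB := hK.nonneg
  have hc := hψ.const_nonneg
  calc _ ≤ ∫⁻ y in {y | ‖y‖ ≤ 1}, ENNReal.ofReal c * (‖K y‖ₑ * ‖y‖ₑ) := by
        refine lintegral_mono fun y => ?_
        rw [enorm_mul, mul_left_comm]
        gcongr
        rw [← ofReal_norm, ← ofReal_norm y, ← ENNReal.ofReal_mul hc]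
        gcongr
        simpa using hψ.lipschitz (x - y) x
    _ ≤ _ := by
        have hm : Measurable fun y => ‖K y‖ₑ * ‖y‖ₑ := hK.measurable.enorm.mul measurable_enorm
        rw [lintegral_const_mul _ hm, ENNReal.ofReal_mul hc, ENNReal.ofReal_mul hB]
        gcongr
        simpa using hK.lintegral_mul_norm_le

lemma IsDiniKernel.lintegral_mul_bump_le (hK : IsDiniKernel K B) (hψ : IsLipschitzBump ψ c)
    (x : E) : ∫⁻ y in {y | 1 < ‖y‖}, ‖K y * ψ (x - y)‖ₑ ≤
      ENNReal.ofReal (c * (B * Real.log 4 + B * Real.log 6)) := by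
  have hB := hK.nonneg
  have hc := hψ.const_nonneg
  have h4 : 0 ≤ Real.log 4 := Real.log_nonneg (by norm_num)
  have h6 : 0 ≤ Real.log 6 := Real.log_nonneg (by norm_num)
  have hm1 : MeasurableSet {y : E | 1 < ‖y‖} := measurableSet_lt measurable_const measurable_norm
  have hm2 : MeasurableSet {y : E | 1 < ‖y‖ ∧ ‖y - x‖ ≤ 1} :=
    hm1.inter (measurableSet_le (measurable_id.sub_const _).norm measurable_const)
  calc _ ≤ ∫⁻ y in {y | 1 < ‖y‖ ∧ ‖y - x‖ ≤ 1}, ENNReal.ofReal c * ‖K y‖ₑ := by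
        rw [← lintegral_indicator hm1, ← lintegral_indicator hm2]
        refine lintegral_mono fun y => ?_
        by_cases h1 : 1 < ‖y‖ <;> by_cases h2 : ‖y - x‖ ≤ 1
        · rw [indicator_of_mem (by exact h1), indicator_of_mem (by exact ⟨h1, h2⟩), enorm_mul,
            mul_comm]
          gcongr
          rw [← ofReal_norm]
          gcongr
          exact hψ.norm_le _
        · rw [indicator_of_mem (by exact h1), hψ.eq_zero (x - y)]
          · simp
          · rw [norm_sub_rev]; linarith
        · simp [h1]
        · simp [h1]
    _ ≤ _ := by
        rw [lintegral_const_mul _ hK.measurable.enorm, ENNReal.ofReal_mul hc,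
          ENNReal.ofReal_add (by positivity) (by positivity)]
        gcongr
        refine (hK.lintegral_closedBall_le one_pos one_pos x).trans ?_
        norm_num

/-- Convolution of a bump with a truncation of the kernel. -/
def truncConv (K ψ : E → ℝ) (a R : ℝ) (x : E) : ℝ := ∫ y in shell a R, K y * ψ (x - y)

/-- Principal value convolution of a bump with the kernel. -/
def pvConv (K ψ : E → ℝ) (x : E) : ℝ :=
  (∫ y in {y | ‖y‖ ≤ 1}, K y * (ψ (x - y) - ψ x)) + ∫ y in {y | 1 < ‖y‖}, K y * ψ (x - y)

/-- A uniform bound for the convolution of a bump with the kernel. -/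
def convBound (B c : ℝ) : ℝ := c * (B * 2) + c * (B * Real.log 4 + B * Real.log 6)

lemma norm_setIntegral_le_of_lintegral_enorm {S T : Set E} {F : E → ℝ} {b : ℝ} (hb : 0 ≤ b)
    (hST : S ⊆ T) (h : ∫⁻ y in T, ‖F y‖ₑ ≤ ENNReal.ofReal b) : ‖∫ y in S, F y‖ ≤ b := by
  have h1 : ‖∫ y in S, F y‖ₑ ≤ ENNReal.ofReal b :=
    (enorm_integral_le_lintegral_enorm _).trans ((lintegral_mono_set hST).trans h)
  rwa [← ofReal_norm, ENNReal.ofReal_le_ofReal_iff hb] at h1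

lemma IsDiniKernel.integrableOn_mul_bump_sub (hK : IsDiniKernel K B) (hψ : IsLipschitzBump ψ c)
    (x : E) : IntegrableOn (fun y => K y * (ψ (x - y) - ψ x)) {y | ‖y‖ ≤ 1} :=
  ⟨(hK.measurable.mul ((hψ.continuous.measurable.comp (measurable_const.sub measurable_id)).sub_const
    _)).aestronglyMeasurable,
    (hK.lintegral_mul_bump_sub_le hψ x).trans_lt ENNReal.ofReal_lt_top⟩

lemma IsDiniKernel.integrableOn_mul_bump (hK : IsDiniKernel K B) (hψ : IsLipschitzBump ψ c)
    (x : E) : IntegrableOn (fun y => K y * ψ (x - y)) {y | 1 < ‖y‖} :=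
  ⟨(hK.measurable.mul (hψ.continuous.measurable.comp
    (measurable_const.sub measurable_id))).aestronglyMeasurable,
    (hK.lintegral_mul_bump_le hψ x).trans_lt ENNReal.ofReal_lt_top⟩

lemma shell_subset_closedBall (a : ℝ) {b : ℝ} : (shell a b : Set E) ⊆ {y | ‖y‖ ≤ b} :=
  fun _ hy => hy.2

lemma shell_subset_compl {a : ℝ} (b : ℝ) : (shell a b : Set E) ⊆ {y | a < ‖y‖} :=
  fun _ hy => hy.1

lemma IsDiniKernel.truncConv_eq (hK : IsDiniKernel K B) (hψ : IsLipschitzBump ψ c) {a R : ℝ}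
    (ha : 0 < a) (ha1 : a ≤ 1) (hR : 1 ≤ R) (x : E) :
    truncConv K ψ a R x = (∫ y in shell a 1, K y * (ψ (x - y) - ψ x)) +
      ∫ y in shell 1 R, K y * ψ (x - y) := by
  have hu : (shell a R : Set E) = shell a 1 ∪ shell 1 R := by
    ext y
    simp only [shell, Set.mem_ofPred_eq, mem_union]
    constructor
    · rintro ⟨h1, h2⟩
      rcases le_or_gt ‖y‖ 1 with h | h
      · exact .inl ⟨h1, h⟩
      · exact .inr ⟨h, h2⟩
    · rintro (⟨h1, h2⟩ | ⟨h1, h2⟩)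
      · exact ⟨h1, h2.trans hR⟩
      · exact ⟨ha1.trans_lt h1, h2⟩
  have hd : Disjoint (shell a 1 : Set E) (shell 1 R) := by
    rw [Set.disjoint_left]
    rintro y ⟨_, h1⟩ ⟨h2, _⟩
    linarith
  have h1 : IntegrableOn (fun y => K y * (ψ (x - y) - ψ x)) (shell a 1) :=
    (hK.integrableOn_mul_bump_sub hψ x).mono_set (shell_subset_closedBall a)
  have h2 : IntegrableOn (fun y => K y * ψ x) (shell a 1) :=
    (hK.integrableOn_shell ha 1).mul_const _
  have e : (fun y => K y * ψ (x - y)) = fun y => K y * (ψ (x - y) - ψ x) + K y * ψ x := by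
    ext y; ring
  have h3 : IntegrableOn (fun y => K y * ψ (x - y)) (shell a 1) := by
    rw [e]; exact h1.add h2
  rw [truncConv, hu, setIntegral_union hd (measurableSet_shell _ _) h3
    ((hK.integrableOn_mul_bump hψ x).mono_set (shell_subset_compl R))]
  congr 1
  rw [e, integral_add h1 h2, integral_mul_const, hK.integral_shell a 1 ha, zero_mul, add_zero]

lemma convBound_summands_nonneg (hB : 0 ≤ B) (hc : 0 ≤ c) :
    0 ≤ c * (B * 2) ∧ 0 ≤ c * (B * Real.log 4 + B * Real.log 6) := by
  have h4 : 0 ≤ Real.log 4 := Real.log_nonneg (by norm_num)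
  have h6 : 0 ≤ Real.log 6 := Real.log_nonneg (by norm_num)
  constructor <;> positivity

lemma IsDiniKernel.norm_truncConv_le (hK : IsDiniKernel K B) (hψ : IsLipschitzBump ψ c) {a R : ℝ}
    (ha : 0 < a) (ha1 : a ≤ 1) (hR : 1 ≤ R) (x : E) : ‖truncConv K ψ a R x‖ ≤ convBound B c := by
  obtain ⟨h1, h2⟩ := convBound_summands_nonneg hK.nonneg hψ.const_nonneg
  rw [hK.truncConv_eq hψ ha ha1 hR]
  refine (norm_add_le _ _).trans (add_le_add ?_ ?_)
  · exact norm_setIntegral_le_of_lintegral_enorm h1 (shell_subset_closedBall a)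
      (hK.lintegral_mul_bump_sub_le hψ x)
  · exact norm_setIntegral_le_of_lintegral_enorm h2 (shell_subset_compl R)
      (hK.lintegral_mul_bump_le hψ x)

lemma IsDiniKernel.norm_pvConv_le (hK : IsDiniKernel K B) (hψ : IsLipschitzBump ψ c) (x : E) :
    ‖pvConv K ψ x‖ ≤ convBound B c := by
  obtain ⟨h1, h2⟩ := convBound_summands_nonneg hK.nonneg hψ.const_nonneg
  refine (norm_add_le _ _).trans (add_le_add ?_ ?_)
  · exact norm_setIntegral_le_of_lintegral_enorm h1 subset_rfl (hK.lintegral_mul_bump_sub_le hψ x)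
  · exact norm_setIntegral_le_of_lintegral_enorm h2 subset_rfl (hK.lintegral_mul_bump_le hψ x)

lemma measurableSet_norm_le (r : ℝ) : MeasurableSet {y : E | ‖y‖ ≤ r} :=
  measurableSet_le measurable_norm measurable_const

lemma measurableSet_lt_norm (r : ℝ) : MeasurableSet {y : E | r < ‖y‖} :=
  measurableSet_lt measurable_const measurable_norm

lemma tendsto_setIntegral_of_eventually_mem {T : Set E} (hT : MeasurableSet T) {S : ℕ → Set E}
    (hS : ∀ N, MeasurableSet (S N)) (hST : ∀ N, S N ⊆ T)
    (h : ∀ᵐ y, y ∈ T → ∀ᶠ N in atTop, y ∈ S N) {F : E → ℝ} (hF : IntegrableOn F T) :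
    Tendsto (fun N => ∫ y in S N, F y) atTop (𝓝 (∫ y in T, F y)) := by
  simp_rw [← integral_indicator hT, ← fun N => integral_indicator (f := F) (μ := volume) (hS N)]
  refine tendsto_integral_of_dominated_convergence (fun y => ‖T.indicator F y‖)
    (fun N => ((hF.mono_set (hST N)).integrable_indicator (hS N)).1)
    (hF.integrable_indicator hT).norm (fun N => ae_of_all _ fun y => ?_) ?_
  · rw [norm_indicator_eq_indicator_norm, norm_indicator_eq_indicator_norm]
    exact indicator_le_indicator_of_subset (hST N) (fun _ => norm_nonneg _) y
  · filter_upwards [h] with y hy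
    by_cases hyT : y ∈ T
    · refine tendsto_const_nhds.congr' ?_
      filter_upwards [hy hyT] with N hN
      rw [indicator_of_mem hyT, indicator_of_mem hN]
    · have : ∀ N, y ∉ S N := fun N hN => hyT (hST N hN)
      simp [hyT, this]

lemma IsDiniKernel.tendsto_truncConv [Nontrivial E] (hK : IsDiniKernel K B)
    (hψ : IsLipschitzBump ψ c)
    {a R : ℕ → ℝ} (ha0 : ∀ N, 0 < a N) (ha : Tendsto a atTop (𝓝 0)) (hR : Tendsto R atTop atTop)
    (x : E) : Tendsto (fun N => truncConv K ψ (a N) (R N) x) atTop (𝓝 (pvConv K ψ x)) := by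
  have h1 : Tendsto (fun N => ∫ y in shell (a N) 1, K y * (ψ (x - y) - ψ x)) atTop
      (𝓝 (∫ y in {y | ‖y‖ ≤ 1}, K y * (ψ (x - y) - ψ x))) := by
    refine tendsto_setIntegral_of_eventually_mem (measurableSet_norm_le 1)
      (fun N => measurableSet_shell _ _) (fun N => shell_subset_closedBall _) ?_
      (hK.integrableOn_mul_bump_sub hψ x)
    have hne : ∀ᵐ y : E, y ≠ 0 := by simp [ae_iff]
    filter_upwards [hne] with y hy hy1
    filter_upwards [ha.eventually (gt_mem_nhds (norm_pos_iff.2 hy))] with N hN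
    exact ⟨hN, hy1⟩
  have h2 : Tendsto (fun N => ∫ y in shell 1 (R N), K y * ψ (x - y)) atTop
      (𝓝 (∫ y in {y | 1 < ‖y‖}, K y * ψ (x - y))) := by
    refine tendsto_setIntegral_of_eventually_mem (measurableSet_lt_norm 1)
      (fun N => measurableSet_shell _ _) (fun N => shell_subset_compl _) ?_
      (hK.integrableOn_mul_bump hψ x)
    refine ae_of_all _ fun y hy => ?_
    filter_upwards [hR.eventually_ge_atTop ‖y‖] with N hN
    exact ⟨hy, hN⟩
  refine (h1.add h2).congr' ?_
  filter_upwards [ha.eventually (gt_mem_nhds one_pos), hR.eventually_ge_atTop 1] with N h3 h4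
  exact (hK.truncConv_eq hψ (ha0 N) h3.le h4 x).symm

lemma IsDiniKernel.integral_mul_dilate (hK : IsDiniKernel K B) {ε : ℝ} (hε : 0 < ε) (a R : ℝ)
    (x : E) : ∫ y, (shell a R).indicator K y * dilate ψ ε (x - y) =
      dilate (truncConv K ψ (ε⁻¹ * a) (ε⁻¹ * R)) ε x := by
  have h := Measure.integral_comp_smul_of_nonneg volume
    (fun y => (shell a R).indicator K y * dilate ψ ε (x - y)) ε (hR := hε.le)
  have hp : (ε ^ finrank ℝ E) ≠ 0 := by positivity
  rw [smul_eq_mul, eq_inv_mul_iff_mul_eq₀ hp] at h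
  rw [← h, dilate, truncConv, ← integral_indicator (measurableSet_shell _ _), ← integral_const_mul,
    ← integral_const_mul]
  congr with w
  have hw : w ∈ (shell (ε⁻¹ * a) (ε⁻¹ * R) : Set E) ↔ ε • w ∈ (shell a R : Set E) := by
    rw [← smul_mem_shell hε, mul_inv_cancel_left₀ hε.ne', mul_inv_cancel_left₀ hε.ne']
  by_cases hm : ε • w ∈ (shell a R : Set E)
  · rw [indicator_of_mem hm, indicator_of_mem (hw.2 hm), hK.homogeneous ε hε, dilate, smul_sub,
      inv_smul_smul₀ hε.ne']
    field_simp
  · rw [indicator_of_notMem hm, indicator_of_notMem (fun h => hm (hw.1 h))]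
    ring

end SmoothTruncation

section MaximalTruncationBounded

open scoped ENNReal Topology
open Module

variable {E : Type*} [NormedAddCommGroup E] [InnerProductSpace ℝ E] [FiniteDimensional ℝ E]
  [MeasurableSpace E] [BorelSpace E] {K : E → ℝ} {B : ℝ} {ψ : E → ℝ} {c : ℝ}

lemma IsLipschitzBump.measurable (hψ : IsLipschitzBump ψ c) : Measurable ψ :=
  hψ.continuous.measurable

lemma IsDiniKernel.measurable_truncConv (hK : IsDiniKernel K B) (hψ : IsLipschitzBump ψ c)
    (a R : ℝ) : Measurable (truncConv K ψ a R) := by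
  have hKm := hK.measurable
  have hψm := hψ.measurable
  refine (StronglyMeasurable.integral_prod_right
    (f := fun x y => K y * ψ (x - y)) ?_).measurable
  refine Measurable.stronglyMeasurable ?_
  exact (hKm.comp measurable_snd).mul (hψm.comp (measurable_fst.sub measurable_snd))

lemma IsDiniKernel.measurable_pvConv (hK : IsDiniKernel K B) (hψ : IsLipschitzBump ψ c) :
    Measurable (pvConv K ψ) := by
  have hKm := hK.measurable
  have hψm := hψ.measurable
  refine Measurable.add ?_ ?_
  · refine (StronglyMeasurable.integral_prod_right
      (f := fun x y => K y * (ψ (x - y) - ψ x)) ?_).measurable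
    refine Measurable.stronglyMeasurable ?_
    exact (hKm.comp measurable_snd).mul
      ((hψm.comp (measurable_fst.sub measurable_snd)).sub (hψm.comp measurable_fst))
  · refine (StronglyMeasurable.integral_prod_right
      (f := fun x y => K y * ψ (x - y)) ?_).measurable
    refine Measurable.stronglyMeasurable ?_
    exact (hKm.comp measurable_snd).mul (hψm.comp (measurable_fst.sub measurable_snd))

/-- The difference between the sharp truncation of the kernel and its smooth regularization. -/
def truncDefect (K ψ : E → ℝ) (x : E) : ℝ := {y | 1 < ‖y‖}.indicator K x - pvConv K ψ x

lemma IsDiniKernel.measurable_truncDefect (hK : IsDiniKernel K B) (hψ : IsLipschitzBump ψ c) :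
    Measurable (truncDefect K ψ) :=
  (hK.measurable.indicator (measurableSet_lt_norm 1)).sub (hK.measurable_pvConv hψ)

lemma IsDiniKernel.enorm_truncDefect_le (hK : IsDiniKernel K B) (hψ : IsLipschitzBump ψ c)
    {x : E} (hx : 4 < ‖x‖) :
    ‖truncDefect K ψ x‖ₑ ≤ ∫⁻ w, ‖K (x - w) - K x‖ₑ * ‖ψ w‖ₑ := by
  have hfar : ∀ w, ‖w‖ ≤ 1 → 1 < ‖x - w‖ := fun w hw => by
    linarith [norm_sub_norm_le x w]
  have h1 : ∫ y in {y | ‖y‖ ≤ 1}, K y * (ψ (x - y) - ψ x) = 0 := by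
    refine setIntegral_eq_zero_of_forall_eq_zero fun y hy => ?_
    rw [hψ.eq_zero _ (hfar y hy), hψ.eq_zero x (by linarith), sub_self, mul_zero]
  have e : ∀ w, {y : E | 1 < ‖y‖}.indicator (fun y => K y * ψ (x - y)) (x - w) =
      K (x - w) * ψ w := fun w => by
    by_cases hw : ‖w‖ ≤ 1
    · rw [indicator_of_mem (by exact hfar w hw), sub_sub_cancel]
    · rw [hψ.eq_zero w (not_le.1 hw), mul_zero]
      by_cases hw' : 1 < ‖x - w‖
      · rw [indicator_of_mem (by exact hw'), sub_sub_cancel, hψ.eq_zero w (not_le.1 hw), mul_zero]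
      · rw [indicator_of_notMem (by exact hw')]
  have h2 : ∫ y in {y | 1 < ‖y‖}, K y * ψ (x - y) = ∫ w, K (x - w) * ψ w := by
    rw [← integral_indicator (measurableSet_lt_norm 1), ← integral_sub_left_eq_self _ volume x]
    exact integral_congr_ae (ae_of_all _ e)
  have hi : Integrable fun w => K (x - w) * ψ w := by
    have := ((hK.integrableOn_mul_bump hψ x).integrable_indicator
      (measurableSet_lt_norm 1)).comp_sub_left x
    exact this.congr (ae_of_all _ e)
  have h3 : truncDefect K ψ x = -∫ w, (K (x - w) - K x) * ψ w := by
    rw [truncDefect, pvConv, h1, h2, zero_add, indicator_of_mem (by change 1 < ‖x‖; linarith)]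
    simp_rw [sub_mul]
    rw [integral_sub hi (hψ.integrable.const_mul _), integral_const_mul, hψ.integral_eq_one]
    ring
  rw [h3, enorm_neg]
  refine (enorm_integral_le_lintegral_enorm _).trans (le_of_eq ?_)
  simp_rw [enorm_mul]

lemma IsDiniKernel.lintegral_truncDefect_far (hK : IsDiniKernel K B) (hψ : IsLipschitzBump ψ c) :
    ∫⁻ x in {x | 4 < ‖x‖}, ‖truncDefect K ψ x‖ₑ < ⊤ := by
  have hKm := hK.measurable
  have hψm := hψ.measurable
  have hm : Measurable fun p : E × E => ‖K (p.1 - p.2) - K p.1‖ₑ * ‖ψ p.2‖ₑ :=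
    (((hKm.comp (measurable_fst.sub measurable_snd)).sub (hKm.comp measurable_fst)).enorm).mul
      (hψm.comp measurable_snd).enorm
  calc _ ≤ ∫⁻ x in {x | 4 < ‖x‖}, ∫⁻ w, ‖K (x - w) - K x‖ₑ * ‖ψ w‖ₑ :=
        setLIntegral_mono' (measurableSet_lt_norm 4) fun x hx => hK.enorm_truncDefect_le hψ hx
    _ = ∫⁻ w, ∫⁻ x in {x | 4 < ‖x‖}, ‖K (x - w) - K x‖ₑ * ‖ψ w‖ₑ :=
        lintegral_lintegral_swap hm.aemeasurable
    _ ≤ ∫⁻ w, (∑' j : ℕ, translationModulus K (4⁻¹ * 2⁻¹ ^ j)) * ‖ψ w‖ₑ := by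
        refine lintegral_mono fun w => ?_
        rw [lintegral_mul_const' _ _ enorm_ne_top]
        by_cases hw : ‖w‖ ≤ 1
        · gcongr
          have := hK.hormander (h := -w) one_pos (by simpa using hw)
          simpa only [mul_one, ← sub_eq_add_neg] using this
        · simp [hψ.eq_zero w (not_le.1 hw)]
    _ < ⊤ := by
        rw [lintegral_const_mul _ hψm.enorm]
        exact ENNReal.mul_lt_top (lt_top_iff_ne_top.2 hK.dini) hψ.integrable.2

lemma IsDiniKernel.integrable_truncDefect (hK : IsDiniKernel K B) (hψ : IsLipschitzBump ψ c) :
    Integrable (truncDefect K ψ) := by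
  have hu : {x : E | ‖x‖ ≤ 4} ∪ {x | 4 < ‖x‖} = univ := by
    ext x; simp [le_or_gt]
  rw [← integrableOn_univ, ← hu]
  refine IntegrableOn.union ?_ ⟨(hK.measurable_truncDefect hψ).aestronglyMeasurable,
    hK.lintegral_truncDefect_far hψ⟩
  have hv : volume {x : E | ‖x‖ ≤ 4} < ⊤ := by
    have : {x : E | ‖x‖ ≤ 4} = Metric.closedBall 0 4 := by ext; simp
    rw [this]
    exact measure_closedBall_lt_top
  refine Integrable.sub ?_ ?_
  · rw [integrable_indicator_iff (measurableSet_lt_norm 1), IntegrableOn,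
      Measure.restrict_restrict (measurableSet_lt_norm 1)]
    exact hK.integrableOn_shell one_pos 4
  · exact Measure.integrableOn_of_bounded hv.ne (hK.measurable_pvConv hψ).aestronglyMeasurable
      (ae_of_all _ fun x => hK.norm_pvConv_le hψ x)

lemma IsDiniKernel.dilate_truncDefect (hK : IsDiniKernel K B) {ε : ℝ} (hε : 0 < ε) (z : E) :
    dilate (truncDefect K ψ) ε z = {y | ε < ‖y‖}.indicator K z - dilate (pvConv K ψ) ε z := by
  have hn : ‖ε⁻¹ • z‖ = ε⁻¹ * ‖z‖ := by rw [norm_smul, norm_inv, Real.norm_of_nonneg hε.le]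
  have hiff : 1 < ‖ε⁻¹ • z‖ ↔ ε < ‖z‖ := by
    rw [hn, inv_mul_eq_div, one_lt_div hε]
  simp only [dilate, truncDefect, mul_sub]
  congr 1
  by_cases h : ε < ‖z‖
  · rw [indicator_of_mem (by exact hiff.2 h), indicator_of_mem (by exact h),
      hK.homogeneous _ (inv_pos.2 hε)]
    simp [hε.ne']
  · rw [indicator_of_notMem (by exact fun h' => h (hiff.1 h')), indicator_of_notMem (by exact h),
      mul_zero]

end MaximalTruncationBounded

section BoundedTruncation

open scoped ENNReal Topology
open Module

variable {E : Type*} [NormedAddCommGroup E] [InnerProductSpace ℝ E] [FiniteDimensional ℝ E]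
  [MeasurableSpace E] [BorelSpace E] {K : E → ℝ} {B : ℝ} {ψ : E → ℝ} {c : ℝ}

/-- The integral of `f` against the kernel, truncated at distance `ε` from the pole. -/
def truncInt (K f : E → ℝ) (x : E) (ε : ℝ) : ℝ := ∫ y in {y | ε < ‖x - y‖}, K (x - y) * f y

lemma norm_dilate_le {D : E → ℝ} {m : ℝ} (hb : ∀ z, ‖D z‖ ≤ m) {ε : ℝ} (hε : 0 < ε) (z : E) :
    ‖dilate D ε z‖ ≤ (ε ^ finrank ℝ E)⁻¹ * m := by
  rw [dilate, norm_mul, Real.norm_of_nonneg (by positivity)]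
  gcongr
  exact hb _

lemma measurable_dilate {D : E → ℝ} (hD : Measurable D) (ε : ℝ) : Measurable (dilate D ε) :=
  (hD.comp (measurable_const_smul _)).const_mul _

lemma integrable_dilate_mul_of_bounded {D g : E → ℝ} {m : ℝ} (hD : Measurable D)
    (hb : ∀ z, ‖D z‖ ≤ m) (hg : Integrable g) {ε : ℝ} (hε : 0 < ε) (x : E) :
    Integrable fun y => dilate D ε (x - y) * g y :=
  hg.bdd_mul ((measurable_dilate hD ε).comp (measurable_const.sub measurable_id)).aestronglyMeasurable
    (ae_of_all _ fun y => norm_dilate_le hb hε (x - y))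

lemma IsLipschitzBump.memLp_dilate (hψ : IsLipschitzBump ψ c) {ε : ℝ} (hε : 0 < ε) (x : E) :
    MemLp (fun y => dilate ψ ε (x - y)) 2 := by
  have hc : Continuous fun y => dilate ψ ε (x - y) := by
    have := hψ.continuous
    unfold dilate
    fun_prop
  refine hc.memLp_of_hasCompactSupport (HasCompactSupport.of_support_subset_isCompact
    (isCompact_closedBall x ε) fun y hy => ?_)
  rw [Metric.mem_closedBall, dist_eq_norm, norm_sub_rev]
  by_contra! h
  refine hy ?_
  simp only [dilate]
  rw [hψ.eq_zero, mul_zero]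
  rw [norm_smul, norm_inv, Real.norm_of_nonneg hε.le, inv_mul_eq_div, one_lt_div hε]
  exact h

lemma IsDiniKernel.integrable_dyadicTrunc_mul_prod (hK : IsDiniKernel K B) {g : E → ℝ}
    (hg : Integrable g) (N : ℕ) :
    Integrable (fun p : E × E => dyadicTrunc K N (p.1 - p.2) * g p.2) (volume.prod volume) := by
  have h := hg.convolution_integrand (ContinuousLinearMap.mul ℝ ℝ) (hK.integrable_dyadicTrunc N)
  refine h.congr (ae_of_all _ fun p => ?_)
  simp [mul_comm]

lemma IsDiniKernel.integral_dilate_mul_dyadicTrunc (hK : IsDiniKernel K B)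
    (hψ : IsLipschitzBump ψ c) {g : E → ℝ} (hg : Integrable g) {ε : ℝ} (hε : 0 < ε) (N : ℕ)
    (x : E) :
    ∫ y, dilate ψ ε (x - y) * ∫ z, dyadicTrunc K N (y - z) * g z =
      ∫ z, dilate (truncConv K ψ (ε⁻¹ * 2⁻¹ ^ N) (ε⁻¹ * 2 ^ N)) ε (x - z) * g z := by
  have hinteg : Integrable (fun p : E × E =>
      dilate ψ ε (x - p.1) * (dyadicTrunc K N (p.1 - p.2) * g p.2)) (volume.prod volume) :=
    (hK.integrable_dyadicTrunc_mul_prod hg N).bdd_mul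
      ((measurable_dilate hψ.measurable ε).comp
        (measurable_const.sub measurable_fst)).aestronglyMeasurable
      (ae_of_all _ fun p => norm_dilate_le hψ.norm_le hε _)
  simp_rw [← integral_const_mul]
  rw [integral_integral_swap hinteg]
  refine integral_congr_ae (ae_of_all _ fun z => ?_)
  simp only
  rw [← hK.integral_mul_dilate hε, ← integral_mul_const,
    ← integral_add_right_eq_self _ z]
  refine integral_congr_ae (ae_of_all _ fun w => ?_)
  simp only [add_sub_cancel_right, dyadicTrunc]
  rw [sub_add_eq_sub_sub_swap]
  ring

lemma IsDiniKernel.integral_dilate_mul_L2_limit [Nontrivial E] (hK : IsDiniKernel K B)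
    (hψ : IsLipschitzBump ψ c) {g F : E → ℝ} (hg : Integrable g) (hF : MemLp F 2)
    (hlim : Tendsto (fun N => eLpNorm (fun x => (∫ y, dyadicTrunc K N (x - y) * g y) - F x) 2 volume)
      atTop (𝓝 0)) {ε : ℝ} (hε : 0 < ε) (x : E) :
    ∫ y, dilate ψ ε (x - y) * F y = ∫ y, dilate (pvConv K ψ) ε (x - y) * g y := by
  set u : ℕ → E → ℝ := fun N y => ∫ z, dyadicTrunc K N (y - z) * g z with hu
  have hui : ∀ N, Integrable (u N) := fun N =>
    (hK.integrable_dyadicTrunc_mul_prod hg N).integral_prod_left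
  have hψi := hψ.memLp_dilate hε x
  have h1 : Tendsto (fun N => ∫ y, dilate ψ ε (x - y) * u N y) atTop
      (𝓝 (∫ y, dilate ψ ε (x - y) * F y)) := by
    rw [tendsto_iff_edist_tendsto_0]
    have hz : Tendsto (fun N => eLpNorm (fun y => dilate ψ ε (x - y)) 2 volume *
        eLpNorm (fun y => u N y - F y) 2 volume) atTop (𝓝 0) := by
      have := ENNReal.Tendsto.const_mul (a := eLpNorm (fun y => dilate ψ ε (x - y)) 2 volume) hlim
        (Or.inr hψi.2.ne)
      simpa using this
    refine tendsto_of_tendsto_of_tendsto_of_le_of_le tendsto_const_nhds hz (fun _ => bot_le)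
      fun N => ?_
    have hi1 : Integrable fun y => dilate ψ ε (x - y) * u N y :=
      integrable_dilate_mul_of_bounded hψ.measurable hψ.norm_le (hui N) hε x
    have hi2 : Integrable fun y => dilate ψ ε (x - y) * F y := hψi.integrable_mul hF
    change edist (∫ y, dilate ψ ε (x - y) * u N y) _ ≤ _
    rw [edist_eq_enorm_sub, ← integral_sub hi1 hi2]
    refine (enorm_integral_le_lintegral_enorm _).trans ?_
    simp_rw [← mul_sub]
    have := eLpNorm_smul_le_mul_eLpNorm (p := 2) (q := 2) (r := 1)
      (f := fun y => u N y - F y) (φ := fun y => dilate ψ ε (x - y)) ((hui N).1.sub hF.1) hψi.1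
    rwa [eLpNorm_one_eq_lintegral_enorm] at this
  have h2 : Tendsto (fun N => ∫ y, dilate ψ ε (x - y) * u N y) atTop
      (𝓝 (∫ y, dilate (pvConv K ψ) ε (x - y) * g y)) := by
    simp only [hu]
    simp_rw [fun N => hK.integral_dilate_mul_dyadicTrunc hψ hg hε N x]
    have ha : Tendsto (fun N : ℕ => ε⁻¹ * (2⁻¹ : ℝ) ^ N) atTop (𝓝 0) := by
      have := (tendsto_pow_atTop_nhds_zero_of_lt_one (r := (2⁻¹ : ℝ)) (by norm_num)
        (by norm_num)).const_mul ε⁻¹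
      rwa [mul_zero] at this
    have hR : Tendsto (fun N : ℕ => ε⁻¹ * (2 : ℝ) ^ N) atTop atTop :=
      (tendsto_pow_atTop_atTop_of_one_lt (by norm_num)).const_mul_atTop (inv_pos.2 hε)
    refine tendsto_integral_filter_of_dominated_convergence
      (fun z => (ε ^ finrank ℝ E)⁻¹ * convBound B c * ‖g z‖) (.of_forall fun N => ?_) ?_
      (hg.norm.const_mul _) (ae_of_all _ fun z => ?_)
    · exact ((measurable_dilate (hK.measurable_truncConv hψ _ _) ε).comp
        (measurable_const.sub measurable_id)).aestronglyMeasurable.mul hg.1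
    · filter_upwards [ha.eventually (gt_mem_nhds one_pos), hR.eventually_ge_atTop 1] with N h3 h4
      refine ae_of_all _ fun z => ?_
      rw [norm_mul]
      gcongr
      exact norm_dilate_le (fun z => hK.norm_truncConv_le hψ (by positivity) h3.le h4 z) hε _
    · refine Tendsto.mul_const _ ?_
      exact (hK.tendsto_truncConv hψ (fun N => by positivity) ha hR _).const_mul _
  exact tendsto_nhds_unique h1 h2

lemma IsDiniKernel.exists_ae_tendsto_truncInt [Nontrivial E] (hK : IsDiniKernel K B) :
    ∃ A : ℝ, ∀ (g : E → ℝ) (M : ℝ), Integrable g → (∀ᵐ x, ‖g x‖ ≤ M) →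
      ∃ F : E → ℝ, AEStronglyMeasurable F ∧ eLpNorm F 2 volume ≤ ENNReal.ofReal A * eLpNorm g 2 volume ∧
        ∀ᵐ x, Tendsto (truncInt K g x) (𝓝[>] 0) (𝓝 (F x)) := by
  obtain ⟨ψ, c, hψ⟩ := exists_isLipschitzBump E
  obtain ⟨A, hA⟩ := hK.exists_L2_limit
  have hD := hK.integrable_truncDefect hψ
  set I := ∫ z, truncDefect K ψ z with hI
  refine ⟨|A| + |I|, fun g M hg hM => ?_⟩
  obtain ⟨F, hF, hFle, hlim⟩ := hA g M hg hM
  refine ⟨fun x => I * g x + F x, (hg.1.const_mul _).add hF.1, ?_, ?_⟩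
  · refine (eLpNorm_add_le (hg.1.const_mul _) hF.1 one_le_two).trans ?_
    rw [ENNReal.ofReal_add (abs_nonneg _) (abs_nonneg _), add_mul, add_comm]
    refine add_le_add (hFle.trans ?_) ?_
    · gcongr
      exact le_abs_self A
    · have := eLpNorm_const_smul (p := 2) (μ := (volume : Measure E)) I g
      refine (le_of_eq this).trans ?_
      gcongr
      rw [← ofReal_norm, Real.norm_eq_abs]
  · have h1 := tendsto_dilate_of_bounded hD hg.1 hM
    have h2 := tendsto_dilate_of_bounded_support (m := max c 1) (by positivity) hψ.integrable
      (fun z => (hψ.norm_le z).trans (le_max_left _ _))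
      (fun z hz => hψ.eq_zero z ((le_max_right _ _).trans_lt hz)) (hF.locallyIntegrable one_le_two)
    filter_upwards [h1, h2] with x hx1 hx2
    rw [hψ.integral_eq_one, one_mul] at hx2
    refine (hx1.add hx2).congr' ?_
    filter_upwards [self_mem_nhdsWithin] with ε hε
    have hε : 0 < ε := hε
    have hm : MeasurableSet {y : E | ε < ‖x - y‖} :=
      measurableSet_lt measurable_const (measurable_const.sub measurable_id).norm
    have hi1 : Integrable fun y => dilate (truncDefect K ψ) ε (x - y) * g y :=
      ((hD.dilate hε).comp_sub_left x).mul_bdd hg.1 hM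
    have hi2 : Integrable fun y => dilate (pvConv K ψ) ε (x - y) * g y :=
      integrable_dilate_mul_of_bounded (hK.measurable_pvConv hψ) (hK.norm_pvConv_le hψ) hg hε x
    rw [hK.integral_dilate_mul_L2_limit hψ hg hF hlim hε, ← integral_add hi1 hi2, truncInt,
      ← integral_indicator hm]
    refine integral_congr_ae (ae_of_all _ fun y => ?_)
    simp only [hK.dilate_truncDefect hε]
    by_cases h : ε < ‖x - y‖
    · rw [indicator_of_mem (by exact h), indicator_of_mem (by exact h)]; ring
    · rw [indicator_of_notMem (by exact h), indicator_of_notMem (by exact h)]; ring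

end BoundedTruncation

section Atom

open scoped ENNReal Topology
open Module

/-- A piecewise linear cutoff that equals one on `[1/4, 4]` and vanishes off `[1/8, 8]`. -/
def tent (r : ℝ) : ℝ := max 0 (min 1 (min (8 * r - 1) (2 - r / 4)))

lemma tent_nonneg (r : ℝ) : 0 ≤ tent r := le_max_left _ _

lemma tent_le_one (r : ℝ) : tent r ≤ 1 := max_le zero_le_one (min_le_left _ _)

lemma tent_eq_one {r : ℝ} (h1 : 1 / 4 ≤ r) (h2 : r ≤ 4) : tent r = 1 := by
  rw [tent, min_eq_left (le_min (by linarith) (by linarith)), max_eq_right zero_le_one]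

lemma tent_eq_zero_of_ge {r : ℝ} (h : 8 ≤ r) : tent r = 0 :=
  max_eq_left ((min_le_right _ _).trans ((min_le_right _ _).trans (by linarith)))

lemma tent_eq_zero_of_le {r : ℝ} (h : r ≤ 1 / 8) : tent r = 0 :=
  max_eq_left ((min_le_right _ _).trans ((min_le_left _ _).trans (by linarith)))

lemma continuous_tent : Continuous tent := by
  unfold tent
  fun_prop

lemma abs_tent_sub_le (a b : ℝ) : |tent a - tent b| ≤ 8 * |a - b| := by
  unfold tent
  refine (abs_max_sub_max_le_max _ _ _ _).trans (max_le (by simp) ?_)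
  refine (abs_min_sub_min_le_max _ _ _ _).trans (max_le (by simp) ?_)
  refine (abs_min_sub_min_le_max _ _ _ _).trans (max_le ?_ ?_)
  · rw [sub_sub_sub_cancel_right, ← mul_sub, abs_mul]
    norm_num
  · rw [sub_sub_sub_cancel_left, ← sub_div, abs_div, abs_sub_comm b a]
    norm_num
    linarith [abs_nonneg (a - b)]

lemma abs_tent_div_sub_le {a b ε : ℝ} (hε : 0 < ε) (hb : 0 < b) (h : |a - b| ≤ b / 4) :
    |tent (a / ε) - tent (b / ε)| ≤ 128 * (|a - b| / b) := by
  rcases le_or_gt (16 * ε) b with hbig | hsmall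
  · rw [tent_eq_zero_of_ge (r := a / ε), tent_eq_zero_of_ge (r := b / ε)]
    · simp only [sub_self, abs_zero]; positivity
    · rw [le_div_iff₀ hε]; linarith
    · rw [le_div_iff₀ hε]; linarith [(abs_le.1 h).1]
  · refine (abs_tent_sub_le _ _).trans ?_
    rw [← sub_div, abs_div, abs_of_pos hε]
    have : |a - b| / ε ≤ |a - b| / (b / 16) := by
      gcongr
      linarith
    have e : |a - b| / (b / 16) = 16 * (|a - b| / b) := by field_simp
    linarith

variable {E : Type*} [NormedAddCommGroup E] [InnerProductSpace ℝ E] [FiniteDimensional ℝ E]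
  [MeasurableSpace E] [BorelSpace E] {K : E → ℝ} {B : ℝ}

/-- The absolute value of the kernel, localized near the unit sphere. -/
def tentKernel (K : E → ℝ) (z : E) : ℝ := tent ‖z‖ * |K z|

lemma IsDiniKernel.dilate_tentKernel (hK : IsDiniKernel K B) {ε : ℝ} (hε : 0 < ε) (z : E) :
    dilate (tentKernel K) ε z = tent (‖z‖ / ε) * |K z| := by
  have hn : ‖ε⁻¹ • z‖ = ‖z‖ / ε := by
    rw [norm_smul, norm_inv, Real.norm_of_nonneg hε.le, inv_mul_eq_div]
  have : |((ε⁻¹ ^ finrank ℝ E)⁻¹)| = ε ^ finrank ℝ E := by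
    rw [inv_pow, inv_inv, abs_of_pos (by positivity)]
  rw [dilate, tentKernel, hn, hK.homogeneous _ (inv_pos.2 hε), abs_mul, this]
  field_simp

lemma IsDiniKernel.measurable_tentKernel (hK : IsDiniKernel K B) : Measurable (tentKernel K) :=
  (continuous_tent.measurable.comp measurable_norm).mul hK.measurable.abs

lemma IsDiniKernel.integrable_tentKernel (hK : IsDiniKernel K B) :
    Integrable (tentKernel K) := by
  have hs := (hK.integrableOn_shell (a := 1 / 8) (by norm_num) 8).integrable_indicator
    (measurableSet_shell _ _)
  refine hs.mono hK.measurable_tentKernel.aestronglyMeasurable (ae_of_all _ fun x => ?_)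
  by_cases h : x ∈ (shell (1 / 8) 8 : Set E)
  · rw [indicator_of_mem h, tentKernel, norm_mul, Real.norm_of_nonneg (tent_nonneg _),
      Real.norm_eq_abs, abs_abs, Real.norm_eq_abs]
    exact mul_le_of_le_one_left (abs_nonneg _) (tent_le_one _)
  · rw [indicator_of_notMem h, tentKernel]
    have : tent ‖x‖ = 0 := by
      rcases le_or_gt ‖x‖ (1 / 8) with h1 | h1
      · exact tent_eq_zero_of_le h1
      · refine tent_eq_zero_of_ge ?_
        by_contra! h2
        exact h ⟨h1, h2.le⟩
    simp [this]

/-- A mean-zero integrable function supported in a ball. -/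
structure IsMeanZeroAtom (b : E → ℝ) (z : E) (s : ℝ) : Prop where
  pos : 0 < s
  measurable : Measurable b
  integrable : Integrable b
  integral_eq_zero : ∫ y, b y = 0
  eq_zero : ∀ y, s < ‖y - z‖ → b y = 0

/-- The pointwise majorant of the singular integral of an atom away from its support. -/
def atomMajorant (K b : E → ℝ) (z : E) (s : ℝ) (x : E) : ℝ≥0∞ :=
  ∫⁻ y, ‖b y‖ₑ * (‖K (x - y) - K (x - z)‖ₑ + ‖K (x - z)‖ₑ * ENNReal.ofReal (s / ‖x - z‖))

variable {b : E → ℝ} {z : E} {s : ℝ}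

lemma IsDiniKernel.measurable_atomMajorant_integrand (hK : IsDiniKernel K B) (hb : Measurable b) :
    Measurable fun p : E × E => ‖b p.2‖ₑ *
      (‖K (p.1 - p.2) - K (p.1 - z)‖ₑ + ‖K (p.1 - z)‖ₑ * ENNReal.ofReal (s / ‖p.1 - z‖)) := by
  have hKm := hK.measurable
  have h1 : Measurable fun p : E × E => K (p.1 - p.2) :=
    hKm.comp (measurable_fst.sub measurable_snd)
  have h2 : Measurable fun p : E × E => K (p.1 - z) := hKm.comp (measurable_fst.sub_const _)
  have h3 : Measurable fun p : E × E => s / ‖p.1 - z‖ :=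
    measurable_const.div (measurable_fst.sub_const _).norm
  exact (hb.comp measurable_snd).enorm.mul ((h1.sub h2).enorm.add (h2.enorm.mul h3.ennreal_ofReal))

lemma IsDiniKernel.measurable_atomMajorant (hK : IsDiniKernel K B) (hb : Measurable b) :
    Measurable (atomMajorant K b z s) :=
  (hK.measurable_atomMajorant_integrand hb).lintegral_prod_right'

lemma setLIntegral_lt_norm_sub (F : E → ℝ≥0∞) (r : ℝ) (z : E) :
    ∫⁻ x in {x | r < ‖x - z‖}, F (x - z) = ∫⁻ x in {x | r < ‖x‖}, F x := by
  have hm : MeasurableSet {x : E | r < ‖x - z‖} :=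
    measurableSet_lt measurable_const (measurable_id.sub_const _).norm
  rw [← lintegral_indicator hm, ← lintegral_indicator (measurableSet_lt_norm r),
    ← lintegral_sub_right_eq_self (μ := (volume : Measure E)) ({x | r < ‖x‖}.indicator F) z]
  rfl

lemma IsDiniKernel.lintegral_atomMajorant_le (hK : IsDiniKernel K B) (hb : IsMeanZeroAtom b z s) :
    ∫⁻ x in {x | 4 * s < ‖x - z‖}, atomMajorant K b z s x ≤
      ((∑' j : ℕ, translationModulus K (4⁻¹ * 2⁻¹ ^ j)) + ENNReal.ofReal B) * ∫⁻ y, ‖b y‖ₑ := by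
  have hKm := hK.measurable
  simp only [atomMajorant]
  rw [lintegral_lintegral_swap (hK.measurable_atomMajorant_integrand hb.measurable).aemeasurable,
    ← lintegral_const_mul _ hb.measurable.enorm]
  refine lintegral_mono fun y => ?_
  simp only
  rw [lintegral_const_mul' _ _ enorm_ne_top, mul_comm]
  by_cases hy : ‖y - z‖ ≤ s
  · gcongr
    rw [lintegral_add_left]
    · refine add_le_add ?_ ?_
      · have := hK.hormander (h := z - y) hb.pos (by rwa [norm_sub_rev])
        refine le_trans (le_of_eq ?_) this
        rw [← setLIntegral_lt_norm_sub _ _ z]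
        congr with x
        rw [sub_add_sub_cancel]
      · refine le_trans (le_of_eq ?_) (hK.lintegral_mul_inv_norm_le hb.pos)
        rw [← setLIntegral_lt_norm_sub _ _ z]
    · exact ((hKm.comp (measurable_id.sub_const _)).sub (hKm.comp (measurable_id.sub_const _))).enorm
  · simp [hb.eq_zero y (not_le.1 hy)]

lemma IsMeanZeroAtom.integral_mul_bound (hb : IsMeanZeroAtom b z s) {κ : E → ℝ} (hκ : Measurable κ) (κ₀ : ℝ)
    {C : ℝ≥0∞} (hC : C ≠ ⊤) {x : E}
    (h : ∀ y, ‖y - z‖ ≤ s → ‖κ y - κ₀‖ₑ ≤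
      C * (‖K (x - y) - K (x - z)‖ₑ + ‖K (x - z)‖ₑ * ENNReal.ofReal (s / ‖x - z‖)))
    (hfin : atomMajorant K b z s x ≠ ⊤) :
    Integrable (fun y => κ y * b y) ∧ ‖∫ y, κ y * b y‖ₑ ≤ C * atomMajorant K b z s x := by
  have hle : ∫⁻ y, ‖(κ y - κ₀) * b y‖ₑ ≤ C * atomMajorant K b z s x := by
    rw [atomMajorant, ← lintegral_const_mul' _ _ hC]
    refine lintegral_mono fun y => ?_
    by_cases hy : ‖y - z‖ ≤ s
    · rw [enorm_mul, mul_comm, mul_left_comm]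
      gcongr
      exact h y hy
    · simp [hb.eq_zero y (not_le.1 hy)]
  have hi : Integrable fun y => (κ y - κ₀) * b y :=
    ⟨((hκ.sub_const _).mul hb.measurable).aestronglyMeasurable,
      hle.trans_lt (ENNReal.mul_lt_top hC.lt_top hfin.lt_top)⟩
  have e : (fun y => κ y * b y) = fun y => (κ y - κ₀) * b y + κ₀ * b y := by
    ext y; ring
  have hi2 := hb.integrable.const_mul κ₀
  refine ⟨by rw [e]; exact hi.add hi2, ?_⟩
  rw [e, integral_add hi hi2, integral_const_mul, hb.integral_eq_zero, mul_zero, add_zero]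
  exact (enorm_integral_le_lintegral_enorm _).trans hle

lemma IsDiniKernel.atom_integral_bound (hK : IsDiniKernel K B) (hb : IsMeanZeroAtom b z s) {x : E}
    (hfin : atomMajorant K b z s x ≠ ⊤) :
    Integrable (fun y => K (x - y) * b y) ∧
      ‖∫ y, K (x - y) * b y‖ₑ ≤ atomMajorant K b z s x := by
  have h := hb.integral_mul_bound (K := K) (hK.measurable.comp (measurable_const.sub measurable_id))
    (K (x - z)) (C := 1) ENNReal.one_ne_top (x := x) (fun y _ => by
      rw [one_mul]; exact le_self_add) hfin
  rwa [one_mul] at h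

lemma IsDiniKernel.atom_tent_integral_bound (hK : IsDiniKernel K B) (hb : IsMeanZeroAtom b z s) {x : E}
    (hx : 4 * s < ‖x - z‖) (hfin : atomMajorant K b z s x ≠ ⊤) {ε : ℝ} (hε : 0 < ε) :
    Integrable (fun y => dilate (tentKernel K) ε (x - y) * b y) ∧
      ‖∫ y, dilate (tentKernel K) ε (x - y) * b y‖ₑ ≤ 128 * atomMajorant K b z s x := by
  have hs := hb.pos
  refine hb.integral_mul_bound (K := K)
    ((measurable_dilate hK.measurable_tentKernel ε).comp (measurable_const.sub measurable_id))
    (dilate (tentKernel K) ε (x - z)) (C := 128) (by norm_num) (fun y hy => ?_) hfin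
  have h1 : |‖x - y‖ - ‖x - z‖| ≤ s := by
    refine (abs_norm_sub_norm_le _ _).trans ?_
    rwa [sub_sub_sub_cancel_left, norm_sub_rev]
  have h2 := abs_tent_div_sub_le hε (b := ‖x - z‖) (a := ‖x - y‖) (by linarith) (by linarith)
  simp only [Function.comp]
  rw [hK.dilate_tentKernel hε, hK.dilate_tentKernel hε]
  have hpos : 0 < ‖x - z‖ := by linarith
  have h3 : ‖tent (‖x - y‖ / ε) * |K (x - y)| - tent (‖x - z‖ / ε) * |K (x - z)|‖ ≤
      128 * (‖K (x - y) - K (x - z)‖ + ‖K (x - z)‖ * (s / ‖x - z‖)) := by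
    have e : tent (‖x - y‖ / ε) * |K (x - y)| - tent (‖x - z‖ / ε) * |K (x - z)| =
      tent (‖x - y‖ / ε) * (|K (x - y)| - |K (x - z)|) +
        (tent (‖x - y‖ / ε) - tent (‖x - z‖ / ε)) * |K (x - z)| := by ring
    rw [e]
    refine (norm_add_le _ _).trans ?_
    rw [mul_add, norm_mul, norm_mul]
    refine add_le_add ?_ ?_
    · have ha : ‖tent (‖x - y‖ / ε)‖ ≤ 1 := by
        rw [Real.norm_of_nonneg (tent_nonneg _)]; exact tent_le_one _
      have hb' : ‖|K (x - y)| - |K (x - z)|‖ ≤ ‖K (x - y) - K (x - z)‖ :=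
        abs_abs_sub_abs_le_abs_sub _ _
      nlinarith [norm_nonneg (K (x - y) - K (x - z)), norm_nonneg (|K (x - y)| - |K (x - z)|)]
    · rw [Real.norm_eq_abs |_|, abs_abs, mul_left_comm, mul_comm, Real.norm_eq_abs, Real.norm_eq_abs]
      refine mul_le_mul_of_nonneg_left (h2.trans ?_) (abs_nonneg _)
      gcongr
  rw [← ofReal_norm]
  refine (ENNReal.ofReal_le_ofReal h3).trans (le_of_eq ?_)
  rw [ENNReal.ofReal_mul (by norm_num), ENNReal.ofReal_add (norm_nonneg _) (by positivity),
    ENNReal.ofReal_mul (norm_nonneg _), ofReal_norm, ofReal_norm]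
  norm_num

lemma IsMeanZeroAtom.norm_sub_ge (hb : IsMeanZeroAtom b z s) {x y : E} (hx : 4 * s < ‖x - z‖) (hy : b y ≠ 0) :
    |‖x - y‖ - ‖x - z‖| ≤ ‖x - z‖ / 4 := by
  have h : ‖y - z‖ ≤ s := by
    by_contra! h
    exact hy (hb.eq_zero y h)
  refine (abs_norm_sub_norm_le _ _).trans ?_
  rw [sub_sub_sub_cancel_left, norm_sub_rev]
  linarith

lemma IsDiniKernel.eventually_atom_tent_integral_eq_zero (hK : IsDiniKernel K B)
    (hb : IsMeanZeroAtom b z s) {x : E} (hx : 4 * s < ‖x - z‖) :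
    ∀ᶠ ε in 𝓝[>] (0 : ℝ), ∫ y, dilate (tentKernel K) ε (x - y) * b y = 0 := by
  have hpos : 0 < ‖x - z‖ := by linarith [hb.pos]
  have h16 : 0 < ‖x - z‖ / 16 := by positivity
  filter_upwards [self_mem_nhdsWithin, nhdsWithin_le_nhds (gt_mem_nhds h16)] with ε (hε : 0 < ε) hε2
  refine integral_eq_zero_of_ae (ae_of_all _ fun y => ?_)
  by_cases hy : b y = 0
  · simp [hy]
  · have := (abs_le.1 (hb.norm_sub_ge hx hy)).1
    simp only [Pi.zero_apply]
    rw [hK.dilate_tentKernel hε, tent_eq_zero_of_ge, zero_mul, zero_mul]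
    rw [le_div_iff₀ hε]
    linarith

lemma IsDiniKernel.norm_truncInt_atom_sub_le (hK : IsDiniKernel K B)
    (hb : IsMeanZeroAtom b z s) {x : E} (hx : 4 * s < ‖x - z‖) (hfin : atomMajorant K b z s x ≠ ⊤)
    {ε : ℝ} (hε : 0 < ε) :
    ‖truncInt K b x ε - ∫ y, K (x - y) * b y‖ ≤
      (if ‖x - z‖ < 2 * ε then ‖∫ y, K (x - y) * b y‖ else 0) +
        ∫ y, dilate (tentKernel K) ε (x - y) * |b y| := by
  have hm : MeasurableSet {y : E | ε < ‖x - y‖} :=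
    measurableSet_lt measurable_const (measurable_const.sub measurable_id).norm
  have hnn : 0 ≤ ∫ y, dilate (tentKernel K) ε (x - y) * |b y| := by
    refine integral_nonneg fun y => ?_
    simp only [Pi.zero_apply]
    rw [hK.dilate_tentKernel hε]
    have := tent_nonneg (‖x - y‖ / ε)
    positivity
  rw [truncInt]
  split_ifs with h
  · rw [add_comm]
    refine (norm_sub_le _ _).trans ?_
    gcongr
    rw [← integral_indicator hm]
    have hinteg : Integrable fun y => dilate (tentKernel K) ε (x - y) * |b y| := by
      refine (hK.atom_tent_integral_bound hb hx hfin hε).1.norm.congr (ae_of_all _ fun y => ?_)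
      simp only
      rw [hK.dilate_tentKernel hε, norm_mul, norm_mul, Real.norm_of_nonneg (tent_nonneg _),
        Real.norm_eq_abs, abs_abs, Real.norm_eq_abs]
    refine norm_integral_le_of_norm_le hinteg (ae_of_all _ fun y => ?_)
    rw [hK.dilate_tentKernel hε]
    by_cases hy : b y = 0
    · simp [hy, indicator]
    have := (abs_le.1 (hb.norm_sub_ge hx hy)).2
    by_cases hyε : ε < ‖x - y‖
    · rw [indicator_of_mem (by exact hyε), tent_eq_one, one_mul, norm_mul]
      · rfl
      · rw [le_div_iff₀ hε]; linarith
      · rw [div_le_iff₀ hε]; linarith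
    · rw [indicator_of_notMem (by exact hyε), norm_zero]
      have := tent_nonneg (‖x - y‖ / ε)
      positivity
  · rw [← integral_indicator hm, zero_add]
    refine le_trans (le_of_eq ?_) hnn
    rw [norm_eq_zero, sub_eq_zero]
    refine integral_congr_ae (ae_of_all _ fun y => ?_)
    by_cases hy : b y = 0
    · simp [hy, indicator]
    have := (abs_le.1 (hb.norm_sub_ge hx hy)).1
    simp only
    rw [indicator_of_mem]
    change ε < ‖x - y‖
    linarith

end Atom

section AtomFamily

open scoped ENNReal Topology
open Module

variable {E : Type*} [NormedAddCommGroup E] [InnerProductSpace ℝ E] [FiniteDimensional ℝ E]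
  [MeasurableSpace E] [BorelSpace E] {K : E → ℝ} {B : ℝ} {ι : Type*}

/-- The data of the bad part of a Calderón–Zygmund decomposition: mean-zero atoms `b i` supported in
the balls `closedBall (z i) (s i)` with sum `bt`, whose negative parts are dominated by functions
`e i` with bounded sum `G`. -/
structure IsAtomFamily (b e : ι → E → ℝ) (z : ι → E) (s : ι → ℝ) (bt β G : E → ℝ) (M : ℝ) :
    Prop where
  atom : ∀ i, IsMeanZeroAtom (b i) (z i) (s i)
  hasSum : ∀ y, HasSum (fun i => b i y) (bt y)
  hasSum_abs : ∀ y, HasSum (fun i => |b i y|) (β y)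
  integrable_abs : Integrable β
  abs_le : ∀ i y, |b i y| ≤ b i y + 2 * e i y
  measurable : ∀ i, Measurable (e i)
  nonneg : ∀ i y, 0 ≤ e i y
  hasSum_majorant : ∀ y, HasSum (fun i => e i y) (G y)
  measurable_majorant : Measurable G
  majorant_le : ∀ y, G y ≤ M
  majorant_eq_zero : ∀ y, (∀ i, 4 * s i < ‖y - z i‖) → G y = 0

variable {b e : ι → E → ℝ} {z : ι → E} {s : ι → ℝ} {bt β G : E → ℝ} {M : ℝ}

lemma IsAtomFamily.majorant_nonneg (h : IsAtomFamily b e z s bt β G M) (y : E) : 0 ≤ G y :=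
  (h.hasSum_majorant y).nonneg fun i => h.nonneg i y

lemma IsAtomFamily.norm_majorant_le (h : IsAtomFamily b e z s bt β G M) (y : E) : ‖G y‖ ≤ M := by
  rw [Real.norm_of_nonneg (h.majorant_nonneg y)]; exact h.majorant_le y

lemma IsAtomFamily.norm_le (h : IsAtomFamily b e z s bt β G M) (i : ι) (y : E) : ‖e i y‖ ≤ M := by
  rw [Real.norm_of_nonneg (h.nonneg i y)]
  exact (le_hasSum (h.hasSum_majorant y) i fun j _ => h.nonneg j y).trans (h.majorant_le y)

lemma IsAtomFamily.hasSum_truncInt [Countable ι] (h : IsAtomFamily b e z s bt β G M)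
    (hK : IsDiniKernel K B) {x : E} {ε : ℝ}
    (hinteg : IntegrableOn (fun y => K (x - y) * β y) {y | ε < ‖x - y‖}) :
    HasSum (fun i => truncInt K (b i) x ε) (truncInt K bt x ε) := by
  have hKm : Measurable fun y => K (x - y) := hK.measurable.comp (measurable_const.sub measurable_id)
  have hβ : ∀ y, 0 ≤ β y := fun y => (h.hasSum_abs y).nonneg fun i => abs_nonneg _
  refine hasSum_integral_of_dominated_convergence (fun i y => ‖K (x - y)‖ * |b i y|)
    (fun i => (hKm.mul (h.atom i).measurable).aestronglyMeasurable)
    (fun i => ae_of_all _ fun y => by rw [norm_mul, Real.norm_eq_abs (b i y)])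
    (ae_of_all _ fun y => ((h.hasSum_abs y).mul_left _).summable) ?_
    (ae_of_all _ fun y => (h.hasSum y).mul_left _)
  refine hinteg.norm.congr (ae_of_all _ fun y => ?_)
  simp only
  rw [((h.hasSum_abs y).mul_left _).tsum_eq, norm_mul, Real.norm_of_nonneg (hβ y)]

lemma IsDiniKernel.integrable_tent_mul (hK : IsDiniKernel K B) {g : E → ℝ} {M : ℝ}
    (hg : Measurable g) (hM : ∀ y, ‖g y‖ ≤ M) {ε : ℝ} (hε : 0 < ε) (x : E) :
    Integrable fun y => dilate (tentKernel K) ε (x - y) * g y :=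
  ((hK.integrable_tentKernel.dilate hε).comp_sub_left x).mul_bdd hg.aestronglyMeasurable
    (ae_of_all _ hM)

lemma IsDiniKernel.dilate_tentKernel_nonneg (hK : IsDiniKernel K B) {ε : ℝ} (hε : 0 < ε) (x : E) :
    0 ≤ dilate (tentKernel K) ε x := by
  rw [hK.dilate_tentKernel hε]
  exact mul_nonneg (tent_nonneg _) (abs_nonneg _)

lemma IsAtomFamily.hasSum_tent [Countable ι] (h : IsAtomFamily b e z s bt β G M)
    (hK : IsDiniKernel K B) {ε : ℝ} (hε : 0 < ε) (x : E) :
    HasSum (fun i => ∫ y, dilate (tentKernel K) ε (x - y) * e i y)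
      (∫ y, dilate (tentKernel K) ε (x - y) * G y) := by
  refine hasSum_integral_of_dominated_convergence
    (fun i y => dilate (tentKernel K) ε (x - y) * e i y)
    (fun i => (hK.integrable_tent_mul (h.measurable i) (h.norm_le i) hε x).1)
    (fun i => ae_of_all _ fun y => ?_)
    (ae_of_all _ fun y => ((h.hasSum_majorant y).mul_left _).summable) ?_
    (ae_of_all _ fun y => (h.hasSum_majorant y).mul_left _)
  · rw [Real.norm_of_nonneg (mul_nonneg (hK.dilate_tentKernel_nonneg hε _) (h.nonneg i y))]
  · refine (hK.integrable_tent_mul h.measurable_majorant h.norm_majorant_le hε x).congr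
      (ae_of_all _ fun y => ?_)
    exact ((h.hasSum_majorant y).mul_left _).tsum_eq.symm

lemma IsAtomFamily.ae_exists_tendsto_truncInt [Countable ι] (h : IsAtomFamily b e z s bt β G M)
    (hK : IsDiniKernel K B) :
    ∀ᵐ x, (∀ i, 4 * s i < ‖x - z i‖) → ∑' i, atomMajorant K (b i) (z i) (s i) x ≠ ⊤ →
      ∃ L, Tendsto (truncInt K bt x) (𝓝[>] 0) (𝓝 L) ∧
        ‖L‖ₑ ≤ ∑' i, atomMajorant K (b i) (z i) (s i) x := by
  filter_upwards [hK.ae_integrableOn h.integrable_abs,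
    tendsto_dilate_of_bounded hK.integrable_tentKernel h.measurable_majorant.aestronglyMeasurable
      (ae_of_all _ h.norm_majorant_le)] with x hx1 hx2 hx hfin
  rw [h.majorant_eq_zero x hx, mul_zero] at hx2
  have hfi : ∀ i, atomMajorant K (b i) (z i) (s i) x ≠ ⊤ := ENNReal.ne_top_of_tsum_ne_top hfin
  set H : ι → ℝ := fun i => (atomMajorant K (b i) (z i) (s i) x).toReal with hH
  have hHs : Summable H := ENNReal.summable_toReal hfin
  have hH0 : ∀ i, 0 ≤ H i := fun i => ENNReal.toReal_nonneg
  set t : ι → ℝ := fun i => ∫ y, K (x - y) * b i y with ht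
  have htH : ∀ i, ‖t i‖ ≤ H i := fun i => by
    have := (hK.atom_integral_bound (h.atom i) (hfi i)).2
    rw [hH, ← ENNReal.ofReal_le_iff_le_toReal (hfi i), ofReal_norm]
    exact this
  have hts : Summable t := hHs.of_norm_bounded htH
  refine ⟨∑' i, t i, ?_, ?_⟩
  swap
  · refine enorm_tsum_le_tsum_enorm.trans (ENNReal.tsum_le_tsum fun i => ?_)
    exact (hK.atom_integral_bound (h.atom i) (hfi i)).2
  set v : ι → ℝ → ℝ := fun i ε => (if ‖x - z i‖ < 2 * ε then ‖t i‖ else 0) +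
    ∫ y, dilate (tentKernel K) ε (x - y) * b i y with hv
  have hvle : ∀ ε > 0, ∀ i, ‖v i ε‖ ≤ 129 * H i := fun ε hε i => by
    have h1 := (hK.atom_tent_integral_bound (h.atom i) (hx i) (hfi i) hε).2
    have h2 : ‖∫ y, dilate (tentKernel K) ε (x - y) * b i y‖ ≤ 128 * H i := by
      have e : 128 * H i = (128 * atomMajorant K (b i) (z i) (s i) x).toReal := by
        simp [hH]
      rw [e, ← ENNReal.ofReal_le_iff_le_toReal (ENNReal.mul_ne_top (by norm_num) (hfi i)),
        ofReal_norm]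
      exact h1
    have h3 : ‖(if ‖x - z i‖ < 2 * ε then ‖t i‖ else 0)‖ ≤ H i := by
      split_ifs
      · rw [norm_norm]; exact htH i
      · simpa using hH0 i
    calc _ ≤ H i + 128 * H i := (norm_add_le _ _).trans (add_le_add h3 h2)
      _ = _ := by ring
  have hv0 : ∀ i, Tendsto (v i) (𝓝[>] 0) (𝓝 0) := fun i => by
    have hpos : 0 < ‖x - z i‖ / 2 := by linarith [(h.atom i).pos, hx i]
    refine tendsto_const_nhds.congr' ?_
    filter_upwards [hK.eventually_atom_tent_integral_eq_zero (h.atom i) (hx i),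
      nhdsWithin_le_nhds (gt_mem_nhds hpos)] with ε h1 h2
    simp only [hv]
    rw [h1, if_neg (by linarith), add_zero]
  have hvlim : Tendsto (fun ε => ∑' i, v i ε) (𝓝[>] 0) (𝓝 0) := by
    have := tendsto_tsum_of_dominated_convergence (f := fun ε i => v i ε) (g := fun _ : ι => (0 : ℝ))
      (hHs.mul_left 129) hv0 (by
        filter_upwards [self_mem_nhdsWithin] with ε (hε : 0 < ε) i using hvle ε hε i)
    simpa using this
  have hlim : Tendsto (fun ε => ∑' i, v i ε + 2 * ∫ y, dilate (tentKernel K) ε (x - y) * G y)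
      (𝓝[>] 0) (𝓝 0) := by
    simpa using hvlim.add (hx2.const_mul 2)
  rw [tendsto_iff_norm_sub_tendsto_zero]
  refine squeeze_zero' (.of_forall fun _ => norm_nonneg _) ?_ hlim
  filter_upwards [self_mem_nhdsWithin] with ε (hε : 0 < ε)
  have hs1 := (h.hasSum_truncInt hK (hx1 ε hε)).sub hts.hasSum
  rw [← hs1.tsum_eq]
  have hs2 : HasSum (fun i => v i ε) (∑' i, v i ε) :=
    ((hHs.mul_left 129).of_norm_bounded (hvle ε hε)).hasSum
  refine tsum_of_norm_bounded (hs2.add ((h.hasSum_tent hK hε x).mul_left 2)) fun i => ?_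
  refine (hK.norm_truncInt_atom_sub_le (h.atom i) (hx i) (hfi i) hε).trans ?_
  simp only [hv]
  rw [add_assoc]
  gcongr
  have hi1 := (hK.atom_tent_integral_bound (h.atom i) (hx i) (hfi i) hε).1
  have hi2 := hK.integrable_tent_mul (h.measurable i) (h.norm_le i) hε x
  have hi3 : Integrable fun y => dilate (tentKernel K) ε (x - y) * |b i y| := by
    refine hi1.norm.congr (ae_of_all _ fun y => ?_)
    simp only
    rw [norm_mul, Real.norm_of_nonneg (hK.dilate_tentKernel_nonneg hε _), Real.norm_eq_abs]
  rw [← integral_const_mul, ← integral_add hi1 (hi2.const_mul 2)]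
  refine integral_mono hi3 (hi1.add (hi2.const_mul 2)) fun y => ?_
  calc _ ≤ dilate (tentKernel K) ε (x - y) * (b i y + 2 * e i y) :=
        mul_le_mul_of_nonneg_left (h.abs_le i y) (hK.dilate_tentKernel_nonneg hε _)
    _ = _ := by ring

end AtomFamily

section VitaliSelection

open scoped ENNReal Topology
open Module

variable {E : Type*} [NormedAddCommGroup E] [InnerProductSpace ℝ E] [FiniteDimensional ℝ E]
  [MeasurableSpace E] [BorelSpace E] {f : E → ℝ} {α : ℝ}

open Metric in
lemma volume_real_closedBall_mul (x : E) {k r : ℝ} (hk : 0 ≤ k) (hr : 0 ≤ r) :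
    volume.real (closedBall x (k * r)) = k ^ finrank ℝ E * volume.real (closedBall x r) := by
  simp only [Measure.real]
  rw [Measure.addHaar_closedBall _ _ hr, Measure.addHaar_closedBall _ _ (by positivity), mul_pow,
    ENNReal.ofReal_mul (by positivity), ENNReal.toReal_mul, ENNReal.toReal_mul, ENNReal.toReal_mul,
    ENNReal.toReal_ofReal (by positivity), mul_assoc]

/-- The ball average of `f` exceeds `α`. -/
def IsHighBall (f : E → ℝ) (α : ℝ) (x : E) (r : ℝ) : Prop :=
  α * volume.real (Metric.closedBall x r) < ∫ y in Metric.closedBall x r, f y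

lemma exists_radius_bound [Nontrivial E] (hf : Integrable f) (h0 : ∀ y, 0 ≤ f y) (hα : 0 < α) :
    ∃ R : ℝ, ∀ x r, 0 < r → IsHighBall f α x r → r ≤ R := by
  set ν := volume.real (Metric.closedBall (0 : E) 1) with hν
  have hνpos : 0 < ν :=
    ENNReal.toReal_pos (Metric.measure_closedBall_pos _ _ one_pos).ne' measure_closedBall_lt_top.ne
  refine ⟨max 1 ((∫ y, f y) / (α * ν)), fun x r hr h => ?_⟩
  rcases le_or_gt r 1 with h1 | h1
  · exact h1.trans (le_max_left _ _)
  · refine le_trans ?_ (le_max_right _ _)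
    rw [le_div_iff₀ (by positivity)]
    have hv : volume.real (Metric.closedBall x r) = r ^ finrank ℝ E * ν := by
      have e := volume_real_closedBall_mul x hr.le zero_le_one
      rw [mul_one] at e
      rw [e, hν]
      simp only [Measure.real]
      rw [Measure.addHaar_closedBall_center]
    have h2 : ∫ y in Metric.closedBall x r, f y ≤ ∫ y, f y :=
      setIntegral_le_integral hf (ae_of_all _ h0)
    have h3 : r ≤ r ^ finrank ℝ E := le_self_pow₀ h1.le finrank_pos.ne'
    unfold IsHighBall at h
    rw [hv] at h
    have h4 : r * (α * ν) ≤ r ^ finrank ℝ E * (α * ν) := by gcongr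
    linarith

lemma exists_isHighBall_not_isHighBall [Nontrivial E] (hf : Integrable f) (h0 : ∀ y, 0 ≤ f y)
    (hα : 0 < α) {x : E} {r₀ : ℝ} (hr₀ : 0 < r₀) (h : IsHighBall f α x r₀) :
    ∃ r, 0 < r ∧ IsHighBall f α x r ∧ ¬ IsHighBall f α x (5 * r) := by
  obtain ⟨R, hR⟩ := exists_radius_bound hf h0 hα
  by_contra! hcon
  have hall : ∀ k : ℕ, IsHighBall f α x (5 ^ k * r₀) := by
    intro k
    induction k with
    | zero => simpa using h
    | succ k ih =>
      have := hcon _ (by positivity) ih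
      rwa [← mul_assoc, ← pow_succ'] at this
  have hlim : Tendsto (fun k : ℕ => (5 : ℝ) ^ k * r₀) atTop atTop :=
    (tendsto_pow_atTop_atTop_of_one_lt (by norm_num)).atTop_mul_const hr₀
  obtain ⟨k, hk⟩ := (hlim.eventually_gt_atTop R).exists
  exact absurd (hR x _ (by positivity) (hall k)) (not_le.2 hk)

lemma ae_le_of_not_isHighBall (hf : Integrable f) :
    ∀ᵐ x, (∀ r, 0 < r → ¬ IsHighBall f α x r) → f x ≤ α := by
  filter_upwards [IsUnifLocDoublingMeasure.ae_tendsto_average volume hf.locallyIntegrable 1]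
    with x hx h
  have hlim := hx (l := 𝓝[>] (0 : ℝ)) (fun _ => x) id tendsto_id (by
    filter_upwards [self_mem_nhdsWithin] with r (hr : 0 < r)
    simpa using hr.le)
  refine le_of_tendsto hlim ?_
  filter_upwards [self_mem_nhdsWithin] with r (hr : 0 < r)
  have := h r hr
  unfold IsHighBall at this
  have hpos : 0 < volume.real (Metric.closedBall x r) :=
    ENNReal.toReal_pos (Metric.measure_closedBall_pos _ _ hr).ne' measure_closedBall_lt_top.ne
  rw [setAverage_eq, smul_eq_mul, id, inv_mul_le_iff₀ hpos, mul_comm]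
  exact not_lt.1 this

/-- Disjoint balls on which `f` has average comparable to `α` and whose enlargements cover the set
where `f` exceeds `α`. -/
lemma exists_disjoint_highBalls [Nontrivial E] (hf : Integrable f) (h0 : ∀ y, 0 ≤ f y)
    (hα : 0 < α) :
    ∃ (u : Set E) (r : E → ℝ), u.Countable ∧ (∀ x ∈ u, 0 < r x) ∧
      u.PairwiseDisjoint (fun x => Metric.closedBall x (r x)) ∧
      (∀ x ∈ u, IsHighBall f α x (r x) ∧ ¬ IsHighBall f α x (5 * r x)) ∧
      ∀ᵐ x, x ∉ ⋃ i : u, Metric.closedBall (i : E) (5 * r i) → f x ≤ α := by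
  obtain ⟨R, hR⟩ := exists_radius_bound hf h0 hα
  set t : Set E := {x | ∃ r, 0 < r ∧ IsHighBall f α x r ∧ ¬ IsHighBall f α x (5 * r)} with ht
  choose! r hr using fun (x : E) (hx : x ∈ t) => hx
  obtain ⟨u, hut, hd, hcov⟩ := Vitali.exists_disjoint_subfamily_covering_enlargement_closedBall t id
    r R (fun x hx => hR x _ (hr x hx).1 (hr x hx).2.1) 5 (by norm_num)
  refine ⟨u, r, ?_, fun x hx => (hr x (hut hx)).1, hd, fun x hx => (hr x (hut hx)).2, ?_⟩
  · refine hd.countable_of_nonempty_interior fun x hx => ?_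
    exact ⟨x, Metric.ball_subset_interior_closedBall
      (Metric.mem_ball_self (hr x (hut hx)).1)⟩
  · filter_upwards [ae_le_of_not_isHighBall (α := α) hf] with x hx hxu
    refine hx fun ρ hρ hhigh => hxu ?_
    have hxt : x ∈ t := exists_isHighBall_not_isHighBall hf h0 hα hρ hhigh
    obtain ⟨i, hi, hsub⟩ := hcov x hxt
    rw [mem_iUnion]
    exact ⟨⟨i, hi⟩, hsub (Metric.mem_closedBall_self (hr x hxt).1.le)⟩

lemma exists_disjoint_refinement {ι : Type*} [Countable ι] {X : Type*} [MeasurableSpace X]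
    (A : ι → Set X) (hA : ∀ i, MeasurableSet (A i)) :
    ∃ Q : ι → Set X, (∀ i, MeasurableSet (Q i)) ∧ (∀ i, Q i ⊆ A i) ∧ Pairwise (Function.onFun Disjoint Q) ∧
      ⋃ i, Q i = ⋃ i, A i := by
  obtain ⟨n, hn⟩ := exists_injective_nat ι
  refine ⟨fun i => A i \ ⋃ j ∈ {j | n j < n i}, A j, fun i => ?_, fun i => sdiff_subset, ?_, ?_⟩
  · exact (hA i).diff (MeasurableSet.biUnion (to_countable _) fun j _ => hA j)
  · intro i j hij
    rw [Function.onFun, Set.disjoint_left]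
    rintro x ⟨hi, hi'⟩ ⟨hj, hj'⟩
    rcases lt_trichotomy (n i) (n j) with h | h | h
    · exact hj' (mem_biUnion (show i ∈ {k | n k < n j} from h) hi)
    · exact hij (hn h)
    · exact hi' (mem_biUnion (show j ∈ {k | n k < n i} from h) hj)
  · refine Subset.antisymm (iUnion_mono fun i => sdiff_subset) fun x hx => ?_
    rw [mem_iUnion] at hx
    have hex : ∃ m, ∃ i, x ∈ A i ∧ n i = m := by
      obtain ⟨i, hi⟩ := hx
      exact ⟨_, i, hi, rfl⟩
    classical
    obtain ⟨i, hi, hni⟩ := Nat.find_spec hex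
    refine mem_iUnion.2 ⟨i, hi, fun hmem => ?_⟩
    simp only [mem_iUnion, Set.mem_ofPred_eq] at hmem
    obtain ⟨j, hj, hxj⟩ := hmem
    exact Nat.find_min hex (hni ▸ hj) ⟨j, hxj, rfl⟩

lemma hasSum_indicator_iUnion {ι X : Type*} {Q : ι → Set X}
    (hQ : Pairwise (Function.onFun Disjoint Q)) (f : X → ℝ) (x : X) :
    HasSum (fun i => (Q i).indicator f x) ((⋃ i, Q i).indicator f x) := by
  by_cases hx : x ∈ ⋃ i, Q i
  · obtain ⟨i, hi⟩ := mem_iUnion.1 hx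
    rw [indicator_of_mem hx, ← indicator_of_mem hi f]
    refine hasSum_single i fun j hj => indicator_of_notMem (fun hxj => ?_) _
    exact Set.disjoint_left.1 (hQ hj) hxj hi
  · have : ∀ i, (Q i).indicator f x = 0 := fun i =>
      indicator_of_notMem (fun h => hx (mem_iUnion.2 ⟨i, h⟩)) _
    simp only [this, indicator_of_notMem hx]
    exact hasSum_zero

lemma finite_setOf_mem_of_pairwise_disjoint {ι X : Type*} {Q : ι → Set X}
    (hQ : Pairwise (Function.onFun Disjoint Q)) (x : X) : {i | x ∈ Q i}.Finite :=
  Set.Subsingleton.finite fun i hi j hj => by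
    by_contra h
    exact Set.disjoint_left.1 (hQ h) hi hj

lemma measurable_of_hasSum {ι X : Type*} [Countable ι] [MeasurableSpace X] {F : ι → X → ℝ}
    {S : X → ℝ} (hF : ∀ i, Measurable (F i)) (h : ∀ x, HasSum (fun i => F i x) (S x)) :
    Measurable S := by
  refine measurable_of_tendsto_metrizable' (atTop : Filter (Finset ι))
    (f := fun t x => ∑ i ∈ t, F i x) (fun t => Finset.measurable_sum _ fun i _ => hF i) ?_
  rw [tendsto_pi_nhds]
  exact fun x => h x

end VitaliSelection

section Decomposition

open scoped ENNReal Topology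
open Module

variable {E : Type*} [NormedAddCommGroup E] [InnerProductSpace ℝ E] [FiniteDimensional ℝ E]
  [MeasurableSpace E] [BorelSpace E] {f : E → ℝ} {α : ℝ}

/-- The Calderón–Zygmund decomposition of `f` into a bounded part and mean-zero atoms. -/
lemma exists_calderonZygmund_decomposition [Nontrivial E] (hfm : Measurable f) (hf : Integrable f)
    (h0 : ∀ y, 0 ≤ f y) (hα : 0 < α) :
    ∃ (u : Set E) (b e : u → E → ℝ) (s : u → ℝ) (g bt β G : E → ℝ), u.Countable ∧
      IsAtomFamily b e (fun i => (i : E)) s bt β G (5 ^ finrank ℝ E * α) ∧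
      (∀ y, f y = g y + bt y) ∧ Measurable g ∧ (∀ᵐ y, ‖g y‖ ≤ (1 + 5 ^ finrank ℝ E) * α) ∧
      ∫⁻ y, ‖g y‖ₑ ≤ ∫⁻ y, ‖f y‖ₑ ∧ ∑' i, ∫⁻ y, ‖b i y‖ₑ ≤ 2 * ∫⁻ y, ‖f y‖ₑ ∧
      ENNReal.ofReal α * volume (⋃ i : u, Metric.closedBall (i : E) (4 * s i)) ≤
        20 ^ finrank ℝ E * ∫⁻ y, ‖f y‖ₑ := by
  obtain ⟨u, r, hu, hr, hd, hhigh, hae⟩ := exists_disjoint_highBalls hf h0 hα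
  have : Countable u := hu.to_subtype
  set Bl : u → Set E := fun i => Metric.closedBall (i : E) (r i) with hBl
  set A : u → Set E := fun i => Metric.closedBall (i : E) (5 * r i) with hA
  have hBm : ∀ i, MeasurableSet (Bl i) := fun i => measurableSet_closedBall
  have hrp : ∀ i : u, 0 < r i := fun i => hr i i.2
  have hBd : Pairwise (Function.onFun Disjoint Bl) := fun i j hij =>
    hd i.2 j.2 (fun h => hij (Subtype.ext h))
  obtain ⟨Q, hQm, hQA, hQd, hQU⟩ := exists_disjoint_refinement A fun i => measurableSet_closedBall
  set O : Set E := ⋃ i, Q i with hO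
  have hOm : MeasurableSet O := MeasurableSet.iUnion hQm
  set V : u → ℝ := fun i => volume.real (Bl i) with hV
  have hVpos : ∀ i, 0 < V i := fun i =>
    ENNReal.toReal_pos (Metric.measure_closedBall_pos _ _ (hrp i)).ne' measure_closedBall_lt_top.ne
  set m : u → ℝ := fun i => (∫ y in Q i, f y) / V i with hm
  have hm0 : ∀ i, 0 ≤ m i := fun i =>
    div_nonneg (setIntegral_nonneg (hQm i) fun y _ => h0 y) (hVpos i).le
  have hmle : ∀ i, m i ≤ 5 ^ finrank ℝ E * α := fun i => by
    rw [hm, div_le_iff₀ (hVpos i)]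
    have h1 : ∫ y in Q i, f y ≤ ∫ y in A i, f y :=
      setIntegral_mono_set hf.integrableOn (ae_of_all _ h0) (hQA i).eventuallyLE
    have h2 := not_lt.1 (hhigh i i.2).2
    rw [volume_real_closedBall_mul _ (by norm_num) (hrp i).le] at h2
    calc _ ≤ _ := h1.trans h2
      _ = _ := by ring
  set e : u → E → ℝ := fun i => (Bl i).indicator fun _ => m i with he
  set b : u → E → ℝ := fun i y => (Q i).indicator f y - e i y with hb
  have hem : ∀ i, Measurable (e i) := fun i => measurable_const.indicator (hBm i)
  have he0 : ∀ i y, 0 ≤ e i y := fun i y => indicator_nonneg (fun _ _ => hm0 i) y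
  have hei : ∀ i, Integrable (e i) := fun i =>
    (integrableOn_const measure_closedBall_lt_top.ne).integrable_indicator (hBm i)
  have hq0 : ∀ i y, 0 ≤ (Q i).indicator f y := fun i y => indicator_nonneg (fun _ _ => h0 _) y
  have hqi : ∀ i, Integrable ((Q i).indicator f) := fun i => hf.indicator (hQm i)
  have heint : ∀ i, ∫ y, e i y = ∫ y in Q i, f y := fun i => by
    rw [integral_indicator (hBm i), setIntegral_const, smul_eq_mul, hm]
    exact mul_div_cancel₀ _ (hVpos i).ne'
  have helint : ∀ i, ∫⁻ y, ‖e i y‖ₑ = ∫⁻ y in Q i, ‖f y‖ₑ := fun i => by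
    have h1 : ∀ y, ‖e i y‖ₑ = ENNReal.ofReal (e i y) := fun y => Real.enorm_of_nonneg (he0 i y)
    have h2 : ∀ y, ‖f y‖ₑ = ENNReal.ofReal (f y) := fun y => Real.enorm_of_nonneg (h0 y)
    simp_rw [h1, h2]
    rw [← ofReal_integral_eq_lintegral_ofReal (hei i) (ae_of_all _ (he0 i)),
      ← ofReal_integral_eq_lintegral_ofReal hf.integrableOn (ae_of_all _ h0), heint]
  have hQsum : ∑' i, ∫⁻ y in Q i, ‖f y‖ₑ = ∫⁻ y in O, ‖f y‖ₑ :=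
    (lintegral_iUnion hQm hQd _).symm
  have heS : ∀ y, Summable fun i => e i y := fun y =>
    summable_of_hasFiniteSupport ((finite_setOf_mem_of_pairwise_disjoint hBd y).subset fun i hi => by
      by_contra h
      exact hi (indicator_of_notMem h _))
  set G : E → ℝ := fun y => ∑' i, e i y with hG
  have hGs : ∀ y, HasSum (fun i => e i y) (G y) := fun y => (heS y).hasSum
  have hGm : Measurable G := measurable_of_hasSum hem hGs
  have hG0 : ∀ y, (∀ i, y ∉ Bl i) → G y = 0 := fun y hy => by
    have : ∀ i, e i y = 0 := fun i => indicator_of_notMem (hy i) _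
    simp [hG, this]
  have hGle : ∀ y, G y ≤ 5 ^ finrank ℝ E * α := fun y => by
    by_cases hy : ∃ i, y ∈ Bl i
    · obtain ⟨i, hi⟩ := hy
      have h1 : HasSum (fun i => e i y) (e i y) := hasSum_single i fun j hj =>
        indicator_of_notMem (fun h => Set.disjoint_left.1 (hBd hj) h hi) _
      rw [(hGs y).unique h1, he]
      simp only [indicator_of_mem hi]
      exact hmle i
    · rw [hG0 y fun i h => hy ⟨i, h⟩]
      positivity
  have hGnn : ∀ y, 0 ≤ G y := fun y => (hGs y).nonneg fun i => he0 i y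
  have hGlint : ∫⁻ y, ‖G y‖ₑ ≤ ∫⁻ y in O, ‖f y‖ₑ := by
    calc _ ≤ ∫⁻ y, ∑' i, ‖e i y‖ₑ := lintegral_mono fun y => enorm_tsum_le_tsum_enorm
      _ = ∑' i, ∫⁻ y, ‖e i y‖ₑ := lintegral_tsum fun i => (hem i).enorm.aemeasurable
      _ = _ := by simp_rw [helint, hQsum]
  have hbm : ∀ i, Measurable (b i) := fun i => (hfm.indicator (hQm i)).sub (hem i)
  have hble : ∀ i, ∫⁻ y, ‖b i y‖ₑ ≤ 2 * ∫⁻ y in Q i, ‖f y‖ₑ := fun i => by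
    calc _ ≤ ∫⁻ y, (‖(Q i).indicator f y‖ₑ + ‖e i y‖ₑ) := lintegral_mono fun y => enorm_sub_le
      _ = _ := by
        rw [lintegral_add_right _ (hem i).enorm, helint, two_mul]
        simp_rw [enorm_indicator_eq_indicator_enorm]
        rw [lintegral_indicator (hQm i)]
  have hbsum : ∑' i, ∫⁻ y, ‖b i y‖ₑ ≤ 2 * ∫⁻ y, ‖f y‖ₑ := by
    refine (ENNReal.tsum_le_tsum hble).trans ?_
    rw [ENNReal.tsum_mul_left, hQsum]
    gcongr
    exact Measure.restrict_le_self
  have hbS : ∀ y, Summable fun i => |b i y| := fun y =>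
    summable_of_hasFiniteSupport (((finite_setOf_mem_of_pairwise_disjoint hBd y).union
      (finite_setOf_mem_of_pairwise_disjoint hQd y)).subset fun i hi => by
        by_contra h
        rw [mem_union, not_or] at h
        refine hi ?_
        simp only [hb, he]
        rw [indicator_of_notMem (by exact h.2), indicator_of_notMem (by exact h.1)]
        simp)
  set β : E → ℝ := fun y => ∑' i, |b i y| with hβ
  have hβs : ∀ y, HasSum (fun i => |b i y|) (β y) := fun y => (hbS y).hasSum
  have hβm : Measurable β := measurable_of_hasSum (fun i => (hbm i).abs) hβs
  have hftop : ∫⁻ y, ‖f y‖ₑ < ⊤ := hf.2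
  have hβi : Integrable β := by
    refine ⟨hβm.aestronglyMeasurable, ?_⟩
    calc ∫⁻ y, ‖β y‖ₑ ≤ ∫⁻ y, ∑' i, ‖b i y‖ₑ := lintegral_mono fun y => by
          refine enorm_tsum_le_tsum_enorm.trans (le_of_eq ?_)
          simp
      _ = ∑' i, ∫⁻ y, ‖b i y‖ₑ := lintegral_tsum fun i => (hbm i).enorm.aemeasurable
      _ ≤ 2 * ∫⁻ y, ‖f y‖ₑ := hbsum
      _ < ⊤ := ENNReal.mul_lt_top (by norm_num) hftop
  refine ⟨u, b, e, fun i => 5 * r i, fun y => Oᶜ.indicator f y + G y,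
    fun y => O.indicator f y - G y, β, G, hu, ?_, ?_, ?_, ?_, ?_, hbsum, ?_⟩
  · refine ⟨fun i => ⟨by have := hrp i; positivity, hbm i, (hqi i).sub (hei i), ?_, fun y hy => ?_⟩,
      fun y => (hasSum_indicator_iUnion hQd f y).sub (hGs y), hβs, hβi, fun i y => ?_, hem, he0, hGs,
      hGm, hGle, fun y hy => hG0 y fun i h => ?_⟩
    · rw [integral_sub (hqi i) (hei i), heint, integral_indicator (hQm i), sub_self]
    · have h1 : y ∉ A i := fun h => absurd (mem_closedBall_iff_norm.1 h) (not_le.2 hy)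
      have h2 : y ∉ Bl i := fun h => h1 (Metric.closedBall_subset_closedBall
        (by linarith [hrp i]) h)
      simp only [hb, he]
      rw [indicator_of_notMem (fun h => h1 (hQA i h)), indicator_of_notMem h2, sub_zero]
    · simp only [hb]
      refine (abs_sub _ _).trans ?_
      rw [abs_of_nonneg (hq0 i y), abs_of_nonneg (he0 i y)]
      linarith
    · have h1 := mem_closedBall_iff_norm.1 h
      have h2 := hy i
      linarith [hrp i]
  · intro y
    have := congrFun (indicator_self_add_compl O f) y
    simp only [Pi.add_apply] at this
    linarith
  · exact (hfm.indicator hOm.compl).add hGm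
  · filter_upwards [hae] with y hy
    rw [Real.norm_of_nonneg (add_nonneg (indicator_nonneg (fun _ _ => h0 _) y) (hGnn y)), add_mul,
      one_mul]
    refine add_le_add ?_ (hGle y)
    by_cases hyO : y ∈ O
    · rw [indicator_of_notMem (by simpa using hyO)]; exact hα.le
    · rw [indicator_of_mem (by exact hyO)]
      rw [hQU] at hyO
      exact hy hyO
  · calc _ ≤ ∫⁻ y, (‖Oᶜ.indicator f y‖ₑ + ‖G y‖ₑ) := lintegral_mono fun y => enorm_add_le _ _
      _ ≤ (∫⁻ y in Oᶜ, ‖f y‖ₑ) + ∫⁻ y in O, ‖f y‖ₑ := by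
        rw [lintegral_add_right _ hGm.enorm]
        simp_rw [enorm_indicator_eq_indicator_enorm]
        rw [lintegral_indicator hOm.compl]
        gcongr
      _ = _ := by rw [add_comm]; exact lintegral_add_compl _ hOm
  · calc _ ≤ ENNReal.ofReal α * ∑' i : u, volume (Metric.closedBall (i : E) (4 * (5 * r i))) := by
          gcongr
          exact measure_iUnion_le _
      _ = 20 ^ finrank ℝ E * ∑' i : u, ENNReal.ofReal α * volume (Bl i) := by
          rw [← ENNReal.tsum_mul_left, ← ENNReal.tsum_mul_left]
          congr with i
          have h20 : 4 * (5 * r i) = 20 * r i := by ring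
          have hfin : ∀ ρ, volume (Metric.closedBall (i : E) ρ) =
              ENNReal.ofReal (volume.real (Metric.closedBall (i : E) ρ)) := fun ρ => by
            rw [Measure.real, ENNReal.ofReal_toReal measure_closedBall_lt_top.ne]
          rw [h20, hfin, volume_real_closedBall_mul _ (by norm_num) (hrp i).le,
            ENNReal.ofReal_mul (by positivity), ← hfin, ENNReal.ofReal_pow (by norm_num),
            mul_left_comm, ENNReal.ofReal_ofNat]
      _ ≤ 20 ^ finrank ℝ E * ∑' i : u, ∫⁻ y in Bl i, ‖f y‖ₑ := by
          gcongr with i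
          have h1 : ENNReal.ofReal (α * volume.real (Bl i)) ≤ ENNReal.ofReal (∫ y in Bl i, f y) :=
            ENNReal.ofReal_le_ofReal (hhigh i i.2).1.le
          rw [ENNReal.ofReal_mul hα.le, Measure.real,
            ENNReal.ofReal_toReal measure_closedBall_lt_top.ne] at h1
          refine h1.trans ?_
          rw [ofReal_integral_eq_lintegral_ofReal hf.integrableOn (ae_of_all _ h0)]
          refine lintegral_mono fun y => ?_
          rw [Real.enorm_of_nonneg (h0 y)]
      _ ≤ _ := by
          gcongr
          rw [← lintegral_iUnion hBm hBd]
          exact setLIntegral_le_lintegral _ _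

end Decomposition

section WeakType

open scoped ENNReal Topology
open Module

variable {E : Type*} [NormedAddCommGroup E] [InnerProductSpace ℝ E] [FiniteDimensional ℝ E]
  [MeasurableSpace E] [BorelSpace E] {K : E → ℝ} {B : ℝ}

lemma truncInt_add {f g : E → ℝ} {x : E} {ε : ℝ}
    (hf : IntegrableOn (fun y => K (x - y) * f y) {y | ε < ‖x - y‖})
    (hg : IntegrableOn (fun y => K (x - y) * g y) {y | ε < ‖x - y‖}) :
    truncInt K (fun y => f y + g y) x ε = truncInt K f x ε + truncInt K g x ε := by
  simp only [truncInt, mul_add]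
  exact integral_add hf hg

/-- Chebyshev's inequality in `L²` for the image `F` of a function `g` bounded by `c * α`. -/
lemma ofReal_mul_measure_le_of_eLpNorm_two_le {F g : E → ℝ} {A c α : ℝ} (hα : 0 < α) (hc : 0 ≤ c)
    (hF : AEStronglyMeasurable F)
    (hFg : eLpNorm F 2 volume ≤ ENNReal.ofReal A * eLpNorm g 2 volume)
    (hb : ∀ᵐ y, ‖g y‖ ≤ c * α) :
    ENNReal.ofReal α * volume {x | ENNReal.ofReal (α / 2) ≤ ‖F x‖ₑ} ≤
      4 * ENNReal.ofReal A ^ 2 * ENNReal.ofReal c * ∫⁻ y, ‖g y‖ₑ := by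
  have h1 := mul_meas_ge_le_pow_eLpNorm' (μ := volume) (p := 2) two_ne_zero ENNReal.ofNat_ne_top hF
    (ENNReal.ofReal (α / 2))
  have h2 : eLpNorm g 2 volume ^ (2 : ℕ) ≤ ENNReal.ofReal (c * α) * ∫⁻ y, ‖g y‖ₑ := by
    rw [eLpNorm_eq_lintegral_rpow_enorm_toReal two_ne_zero ENNReal.ofNat_ne_top,
      ← ENNReal.rpow_natCast, ← ENNReal.rpow_mul]
    simp only [ENNReal.toReal_ofNat, Nat.cast_ofNat, one_div]
    rw [inv_mul_cancel₀ two_ne_zero, ENNReal.rpow_one, ← lintegral_const_mul' _ _ ENNReal.ofReal_ne_top]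
    refine lintegral_mono_ae ?_
    filter_upwards [hb] with y hy
    rw [ENNReal.rpow_two, sq]
    gcongr
    rw [← ofReal_norm]
    exact ENNReal.ofReal_le_ofReal hy
  simp only [ENNReal.toReal_ofNat, ENNReal.rpow_two] at h1
  have h0 : ENNReal.ofReal α ≠ 0 := by simpa using hα
  have h4 : ENNReal.ofReal α = 2 * ENNReal.ofReal (α / 2) := by
    rw [← ENNReal.ofReal_ofNat 2, ← ENNReal.ofReal_mul (by norm_num)]
    congr 1; ring
  refine (ENNReal.mul_le_mul_iff_right h0 ENNReal.ofReal_ne_top).1 ?_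
  calc ENNReal.ofReal α * (ENNReal.ofReal α * volume {x | ENNReal.ofReal (α / 2) ≤ ‖F x‖ₑ})
      = 4 * (ENNReal.ofReal (α / 2) ^ 2 * volume {x | ENNReal.ofReal (α / 2) ≤ ‖F x‖ₑ}) := by
        rw [h4]; ring
    _ ≤ 4 * (ENNReal.ofReal A * eLpNorm g 2 volume) ^ 2 := by
        gcongr
        exact h1.trans (by gcongr)
    _ = 4 * ENNReal.ofReal A ^ 2 * eLpNorm g 2 volume ^ 2 := by ring
    _ ≤ 4 * ENNReal.ofReal A ^ 2 * (ENNReal.ofReal (c * α) * ∫⁻ y, ‖g y‖ₑ) := by gcongr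
    _ = _ := by rw [ENNReal.ofReal_mul hc]; ring

/-- Chebyshev's inequality for the sum of the atom majorants, off the dilated balls. -/
lemma IsDiniKernel.ofReal_mul_measure_atomMajorant_le {ι : Type*} [Countable ι]
    (hK : IsDiniKernel K B) {b : ι → E → ℝ} {z : ι → E} {s : ι → ℝ}
    (hb : ∀ i, IsMeanZeroAtom (b i) (z i) (s i)) {α : ℝ} :
    ENNReal.ofReal α * volume ({x | ENNReal.ofReal (α / 2) ≤
        ∑' i, atomMajorant K (b i) (z i) (s i) x} ∩ (⋃ i, Metric.closedBall (z i) (4 * s i))ᶜ) ≤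
      2 * ((∑' j : ℕ, translationModulus K (4⁻¹ * 2⁻¹ ^ j)) + ENNReal.ofReal B) *
        ∑' i, ∫⁻ y, ‖b i y‖ₑ := by
  have hm : ∀ i, Measurable (atomMajorant K (b i) (z i) (s i)) := fun i =>
    hK.measurable_atomMajorant (hb i).measurable
  have hS : MeasurableSet (⋃ i, Metric.closedBall (z i) (4 * s i))ᶜ :=
    (MeasurableSet.iUnion fun i => measurableSet_closedBall).compl
  have h4 : ENNReal.ofReal α = 2 * ENNReal.ofReal (α / 2) := by
    rw [← ENNReal.ofReal_ofNat 2, ← ENNReal.ofReal_mul (by norm_num)]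
    congr 1; ring
  rw [h4, mul_assoc, mul_assoc, ← Measure.restrict_apply' hS]
  refine mul_le_mul_right ?_ 2
  calc _ ≤ ∫⁻ x in (⋃ i, Metric.closedBall (z i) (4 * s i))ᶜ,
        ∑' i, atomMajorant K (b i) (z i) (s i) x :=
        mul_meas_ge_le_lintegral (Measurable.tsum hm) _
    _ = ∑' i, ∫⁻ x in (⋃ i, Metric.closedBall (z i) (4 * s i))ᶜ,
        atomMajorant K (b i) (z i) (s i) x := lintegral_tsum fun i => (hm i).aemeasurable
    _ ≤ ∑' i, ∫⁻ x in {x | 4 * s i < ‖x - z i‖}, atomMajorant K (b i) (z i) (s i) x := by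
        gcongr with i
        intro x hx
        simp only [mem_compl_iff, mem_iUnion, Metric.mem_closedBall, dist_eq_norm, not_exists,
          not_le] at hx
        exact hx i
    _ ≤ _ := by
        rw [← ENNReal.tsum_mul_left]
        gcongr with i
        exact hK.lintegral_atomMajorant_le (hb i)

/-- The weak type `(1,1)` bound for a Dini kernel on nonnegative functions, including the existence
of the principal values outside the exceptional set. -/
theorem IsDiniKernel.exists_weak_type [Nontrivial E] (hK : IsDiniKernel K B) :
    ∃ C : ℝ≥0∞, C ≠ ⊤ ∧ ∀ f : E → ℝ, Measurable f → Integrable f → (∀ y, 0 ≤ f y) →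
      ∀ α : ℝ, 0 < α → ∃ S : Set E, ENNReal.ofReal α * volume S ≤ C * ∫⁻ y, ‖f y‖ₑ ∧
        ∀ᵐ x, x ∉ S → ∃ L, Tendsto (truncInt K f x) (𝓝[>] 0) (𝓝 L) ∧ |L| ≤ α := by
  obtain ⟨A, hA⟩ := hK.exists_ae_tendsto_truncInt
  set T : ℝ≥0∞ := (∑' j : ℕ, translationModulus K (4⁻¹ * 2⁻¹ ^ j)) + ENNReal.ofReal B
  have hT : T ≠ ⊤ := ENNReal.add_ne_top.2 ⟨hK.dini, ENNReal.ofReal_ne_top⟩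
  set c : ℝ := 1 + 5 ^ finrank ℝ E with hc
  refine ⟨20 ^ finrank ℝ E + 2 * T * 2 + 4 * ENNReal.ofReal A ^ 2 * ENNReal.ofReal c, ?_, ?_⟩
  · finiteness
  intro f hfm hf h0 α hα
  obtain ⟨u, b, e, s, g, bt, β, G, hu, hat, hfg, hgm, hgb, hgf, hbf, hvol⟩ :=
    exists_calderonZygmund_decomposition hfm hf h0 hα
  have := hu.to_subtype
  have hgi : Integrable g := ⟨hgm.aestronglyMeasurable, hgf.trans_lt hf.2⟩
  have hbt : bt = fun y => f y - g y := by ext y; rw [hfg y]; ring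
  have hbi : Integrable bt := hbt ▸ hf.sub hgi
  obtain ⟨F, hFm, hFn, hFt⟩ := hA g _ hgi hgb
  refine ⟨(⋃ i : u, Metric.closedBall (i : E) (4 * s i)) ∪
    ({x | ENNReal.ofReal (α / 2) ≤ ∑' i : u, atomMajorant K (b i) i (s i) x} ∩
      (⋃ i : u, Metric.closedBall (i : E) (4 * s i))ᶜ) ∪ {x | ENNReal.ofReal (α / 2) ≤ ‖F x‖ₑ}, ?_, ?_⟩
  · refine (mul_le_mul_right ((measure_union_le _ _).trans
      (add_le_add_left (measure_union_le _ _) _)) _).trans ?_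
    rw [mul_add, mul_add, add_mul, add_mul]
    gcongr ?_ + ?_ + ?_
    · exact (hK.ofReal_mul_measure_atomMajorant_le hat.atom).trans (by rw [mul_assoc _ 2]; gcongr)
    · refine (ofReal_mul_measure_le_of_eLpNorm_two_le hα (by positivity) hFm hFn hgb).trans ?_
      gcongr
  · filter_upwards [hFt, hat.ae_exists_tendsto_truncInt hK, hK.ae_integrableOn hgi,
      hK.ae_integrableOn hbi] with x hxF hxb hxg hxi hx
    simp only [mem_union, mem_inter_iff, mem_ofPred_eq, not_or, not_and, not_le, mem_compl_iff,
      mem_iUnion, Metric.mem_closedBall, dist_eq_norm, not_exists] at hx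
    obtain ⟨⟨hx1, hx2⟩, hx3⟩ := hx
    have hx2' : ∑' i : u, atomMajorant K (b i) i (s i) x < ENNReal.ofReal (α / 2) := by
      by_contra! hcon
      exact hx2 hcon hx1
    obtain ⟨L, hL, hLb⟩ := hxb hx1 (hx2'.trans ENNReal.ofReal_lt_top).ne
    refine ⟨F x + L, (hxF.add hL).congr' ?_, ?_⟩
    · filter_upwards [self_mem_nhdsWithin] with ε hε
      rw [← truncInt_add (hxg ε hε) (hxi ε hε)]
      exact congrArg (fun h => truncInt K h x ε) (funext fun y => (hfg y).symm)
    · have h1 : |F x| ≤ α / 2 := by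
        rw [← ofReal_norm] at hx3
        exact (ENNReal.ofReal_le_ofReal_iff (by positivity)).1 hx3.le
      have h2 : |L| ≤ α / 2 := by
        have := hLb.trans hx2'.le
        rw [← ofReal_norm] at this
        exact (ENNReal.ofReal_le_ofReal_iff (by positivity)).1 this
      linarith [abs_add_le (F x) L]

end WeakType

section ReflectionGeometry

open scoped ENNReal Topology RealInnerProductSpace
open Module

variable {E : Type*} [NormedAddCommGroup E] [InnerProductSpace ℝ E]

/-- The point `‖u‖² • S_u x`, where `S_u` is the reflection in the line spanned by `u`. -/
def scaledReflection (x u : E) : E := (2 * ⟪x, u⟫) • u - (‖u‖ ^ 2) • x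

lemma scaledReflection_eq_smul {u : E} (hu : u ≠ 0) (x : E) :
    scaledReflection x u = (‖u‖ ^ 2) • (ℝ ∙ u).reflection x := by
  have : ‖u‖ ≠ 0 := norm_ne_zero_iff.2 hu
  rw [Submodule.reflection_singleton_apply, scaledReflection, smul_sub, two_smul, ← add_smul,
    smul_smul, real_inner_comm]
  congr 2
  simp only [RCLike.ofReal_real_eq_id, id_eq]
  field_simp
  ring

lemma continuous_scaledReflection : Continuous fun p : E × E => scaledReflection p.1 p.2 := by
  unfold scaledReflection
  fun_prop

/-- The derivative of `u ↦ scaledReflection x u`. -/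
def scaledReflectionDeriv (x u : E) : E →L[ℝ] E :=
  (2 * ⟪x, u⟫) • ContinuousLinearMap.id ℝ E + ((2 : ℝ) • innerSL ℝ x).smulRight u -
    ((2 : ℝ) • innerSL ℝ u).smulRight x

lemma hasFDerivAt_scaledReflection (x u : E) :
    HasFDerivAt (scaledReflection x) (scaledReflectionDeriv x u) u := by
  have h1 : HasFDerivAt (fun v : E => 2 * ⟪x, v⟫) ((2 : ℝ) • innerSL ℝ x) u :=
    (innerSL ℝ x).hasFDerivAt.const_mul 2
  have h2 : HasFDerivAt (fun v : E => ‖v‖ ^ 2) ((2 : ℝ) • innerSL ℝ u) u := by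
    convert (hasStrictFDerivAt_norm_sq u).hasFDerivAt using 1
    rw [two_smul, two_smul]
  exact (h1.smul (hasFDerivAt_id u)).sub (h2.smul_const x)

lemma norm_scaledReflectionDeriv_le (x u : E) : ‖scaledReflectionDeriv x u‖ ≤ 6 * ‖x‖ * ‖u‖ := by
  refine ContinuousLinearMap.opNorm_le_bound _ (by positivity) fun v => ?_
  simp only [scaledReflectionDeriv, _root_.sub_apply, _root_.add_apply,
    _root_.smul_apply, ContinuousLinearMap.id_apply,
    ContinuousLinearMap.smulRight_apply, innerSL_apply_apply, smul_eq_mul]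
  have h1 := abs_real_inner_le_norm x u
  have h2 := abs_real_inner_le_norm x v
  have h3 := abs_real_inner_le_norm u v
  calc _ ≤ ‖(2 * ⟪x, u⟫) • v‖ + ‖(2 * ⟪x, v⟫) • u‖ + ‖(2 * ⟪u, v⟫) • x‖ :=
        (norm_sub_le _ _).trans (by gcongr; exact norm_add_le _ _)
    _ = 2 * |⟪x, u⟫| * ‖v‖ + 2 * |⟪x, v⟫| * ‖u‖ + 2 * |⟪u, v⟫| * ‖x‖ := by
        simp only [norm_smul, norm_mul, Real.norm_eq_abs, Nat.abs_ofNat]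
    _ ≤ 2 * (‖x‖ * ‖u‖) * ‖v‖ + 2 * (‖x‖ * ‖v‖) * ‖u‖ + 2 * (‖u‖ * ‖v‖) * ‖x‖ := by gcongr
    _ = _ := by ring

lemma abs_sqrt_sub_one_le {t : ℝ} (ht : 0 ≤ t) : |√t - 1| ≤ |t - 1| := by
  have h : t - 1 = (√t - 1) * (√t + 1) := by nlinarith [Real.mul_self_sqrt ht]
  rw [h, abs_mul]
  have : 1 ≤ |√t + 1| := by rw [abs_of_pos (by positivity)]; linarith [Real.sqrt_nonneg t]
  nlinarith [abs_nonneg (√t - 1)]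

lemma exists_scaledReflection_eq_of_pos {e x y : E} {κ δ : ℝ} (he : ‖e‖ = 1) (hκ : 0 < κ) (hκ1 : κ ≤ 1)
    (hx : 1 / 2 ≤ ‖x‖) (hxe : κ * ‖x‖ ≤ ⟪x, e⟫) (hδ : δ ≤ κ / 4) (hy : ‖y - x‖ ≤ δ) :
    ∃ u, ‖u - e‖ ≤ 10 / κ * δ ∧ scaledReflection (scaledReflection x e) u = y := by
  set x' := scaledReflection x e with hx'
  have hδ0 : 0 ≤ δ := (norm_nonneg _).trans hy
  have hp : 0 < ‖x‖ := by linarith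
  have hxx' : x' = (2 * ⟪x, e⟫) • e - x := by simp [hx', scaledReflection, he]
  have hnx' : ‖x'‖ = ‖x‖ := by
    have h0 : e ≠ 0 := by rintro rfl; simp at he
    rw [hx', scaledReflection_eq_smul h0, he]
    simp
  have hpq := abs_norm_sub_norm_le y x
  have hq : 0 < ‖y‖ := by
    have := abs_le.1 (hpq.trans hy)
    linarith
  set a := ‖x‖⁻¹ • x' + ‖y‖⁻¹ • y with ha
  set β := 2 * ⟪x, e⟫ / ‖x‖ with hβ
  have hβκ : 2 * κ ≤ β := by
    rw [hβ, le_div_iff₀ hp]; linarith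
  have hab : ‖a - β • e‖ ≤ 4 * δ := by
    have h1 : a - β • e = ‖x‖⁻¹ • (y - x) + (‖y‖⁻¹ - ‖x‖⁻¹) • y := by
      rw [ha, hxx', hβ, smul_sub, smul_smul, div_eq_inv_mul, smul_sub, sub_smul]
      abel
    have h2 : ‖(‖y‖⁻¹ - ‖x‖⁻¹) • y‖ = ‖x‖⁻¹ * |‖y‖ - ‖x‖| := by
      have : ‖y‖⁻¹ - ‖x‖⁻¹ = ‖x‖⁻¹ * (-(‖y‖ - ‖x‖)) * ‖y‖⁻¹ := by field_simp; ring
      rw [norm_smul, this, norm_mul, norm_mul, norm_neg, norm_inv, norm_inv, norm_norm, norm_norm,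
        mul_assoc, inv_mul_cancel₀ hq.ne', mul_one, Real.norm_eq_abs]
    have h3 : ‖x‖⁻¹ ≤ 2 := by rw [inv_le_comm₀ hp two_pos]; linarith
    rw [h1]
    calc _ ≤ ‖x‖⁻¹ * ‖y - x‖ + ‖x‖⁻¹ * |‖y‖ - ‖x‖| := by
          refine (norm_add_le _ _).trans ?_
          rw [h2, norm_smul, norm_inv, norm_norm]
      _ ≤ 2 * δ + 2 * δ := by gcongr; exact hpq.trans hy
      _ = 4 * δ := by ring
  have hβa : |β - ‖a‖| ≤ 4 * δ := by
    have h1 : ‖β • e‖ = β := by rw [norm_smul, he, mul_one, Real.norm_of_nonneg (by linarith)]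
    have := abs_norm_sub_norm_le (β • e) a
    rw [h1, norm_sub_rev] at this
    exact this.trans hab
  have hak : κ ≤ ‖a‖ := by
    have := abs_le.1 hβa
    linarith
  have ha0 : 0 < ‖a‖ := hκ.trans_le hak
  have hdir : ‖‖a‖⁻¹ • a - e‖ ≤ 8 / κ * δ := by
    have h1 : ‖a‖⁻¹ • a - e = ‖a‖⁻¹ • ((a - β • e) + (β - ‖a‖) • e) := by
      rw [sub_smul, sub_add_sub_cancel, smul_sub, smul_smul, inv_mul_cancel₀ ha0.ne', one_smul]
    rw [h1, norm_smul, norm_inv, norm_norm]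
    calc _ ≤ κ⁻¹ * (4 * δ + 4 * δ) := by
          gcongr
          refine (norm_add_le _ _).trans (add_le_add hab ?_)
          rwa [norm_smul, he, mul_one, Real.norm_eq_abs]
      _ = _ := by ring
  have hsq := abs_sqrt_sub_one_le (t := ‖y‖ / ‖x‖) (by positivity)
  have hsq' : |√(‖y‖ / ‖x‖) - 1| ≤ 2 * δ := by
    refine hsq.trans ?_
    have : ‖y‖ / ‖x‖ - 1 = (‖y‖ - ‖x‖) / ‖x‖ := by field_simp
    rw [this, abs_div, abs_of_pos hp, div_le_iff₀ hp]
    nlinarith [hpq.trans hy]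
  refine ⟨√(‖y‖ / ‖x‖) • ‖a‖⁻¹ • a, ?_, ?_⟩
  · have h1 : √(‖y‖ / ‖x‖) • ‖a‖⁻¹ • a - e =
        (√(‖y‖ / ‖x‖) - 1) • (‖a‖⁻¹ • a) + (‖a‖⁻¹ • a - e) := by
      rw [sub_smul, one_smul]; abel
    have h2 : ‖‖a‖⁻¹ • a‖ = 1 := by rw [norm_smul, norm_inv, norm_norm, inv_mul_cancel₀ ha0.ne']
    rw [h1]
    refine (norm_add_le _ _).trans ?_
    rw [norm_smul, h2, mul_one, Real.norm_eq_abs]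
    have h3 : 2 * δ ≤ 2 / κ * δ := by
      gcongr
      rw [le_div_iff₀ hκ]; linarith
    calc _ ≤ 2 / κ * δ + 8 / κ * δ := add_le_add (hsq'.trans h3) hdir
      _ = _ := by ring
  · have hin : ⟪x', a⟫ = ‖x‖ * ‖a‖ ^ 2 / 2 := by
      have h1 : ‖a‖ ^ 2 = 2 + 2 * (‖x‖⁻¹ * ‖y‖⁻¹ * ⟪x', y⟫) := by
        rw [ha, norm_add_sq_real, norm_smul, norm_smul, hnx', norm_inv, norm_inv, norm_norm,
          norm_norm, inv_mul_cancel₀ hp.ne', inv_mul_cancel₀ hq.ne', inner_smul_left,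
          inner_smul_right]
        simp only [conj_trivial]
        ring
      rw [h1, ha, inner_add_right, inner_smul_right, inner_smul_right, real_inner_self_eq_norm_sq,
        hnx']
      field_simp
    have hs : √(‖y‖ / ‖x‖) ^ 2 = ‖y‖ / ‖x‖ := Real.sq_sqrt (by positivity)
    set s := √(‖y‖ / ‖x‖)
    have h1 : (2 * ⟪x', s • ‖a‖⁻¹ • a⟫) • s • ‖a‖⁻¹ • a = ‖y‖ • a := by
      rw [inner_smul_right, inner_smul_right, hin, smul_smul s, smul_smul]
      congr 1
      have : 2 * (s * (‖a‖⁻¹ * (‖x‖ * ‖a‖ ^ 2 / 2))) * (s * ‖a‖⁻¹) = s ^ 2 * ‖x‖ := by field_simp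
      rw [this, hs]
      field_simp
    have h2 : ‖s • ‖a‖⁻¹ • a‖ ^ 2 = ‖y‖ / ‖x‖ := by
      rw [norm_smul, norm_smul, norm_inv, norm_norm, inv_mul_cancel₀ ha0.ne', mul_one,
        Real.norm_eq_abs, sq_abs, hs]
    rw [scaledReflection, h1, h2, ha, smul_add, smul_smul, smul_smul, mul_inv_cancel₀ hq.ne', one_smul,
      div_eq_mul_inv]
    abel

/-- Every point near `x` is a rescaled image of `x` under a product of two line reflections in
nearby lines. -/
lemma exists_scaledReflection_eq {e x y : E} {κ δ : ℝ} (he : ‖e‖ = 1) (hκ : 0 < κ) (hκ1 : κ ≤ 1)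
    (hx : 1 / 2 ≤ ‖x‖) (hxe : κ * ‖x‖ ≤ |⟪x, e⟫|) (hδ : δ ≤ κ / 4) (hy : ‖y - x‖ ≤ δ) :
    ∃ u, ‖u - e‖ ≤ 10 / κ * δ ∧ scaledReflection (scaledReflection x e) u = y := by
  have hneg : ∀ x u : E, scaledReflection (-x) u = - scaledReflection x u := fun x u => by
    simp only [scaledReflection, inner_neg_left, mul_neg, neg_smul, smul_neg]; abel
  rcases abs_cases ⟪x, e⟫ with h | h
  · exact exists_scaledReflection_eq_of_pos he hκ hκ1 hx (h.1 ▸ hxe) hδ hy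
  · obtain ⟨u, hu, hu'⟩ := exists_scaledReflection_eq_of_pos (x := -x) (y := -y) he hκ hκ1
      (by rwa [norm_neg]) (by rw [norm_neg, inner_neg_left]; exact h.1 ▸ hxe) hδ
      (by rwa [← neg_sub', norm_neg])
    exact ⟨u, hu, by rwa [hneg, hneg, neg_inj] at hu'⟩

/-- The rotation `S_u ∘ S_e` obtained by composing two line reflections. -/
def reflectionComp [FiniteDimensional ℝ E] (u e : E) : E ≃ₗᵢ[ℝ] E :=
  (ℝ ∙ e).reflection.trans (ℝ ∙ u).reflection

lemma det_reflectionComp [FiniteDimensional ℝ E] {u e : E} (hu : u ≠ 0) (he : e ≠ 0) :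
    LinearMap.det ((reflectionComp u e).toLinearEquiv : E →ₗ[ℝ] E) = 1 := by
  have h1 : ((reflectionComp u e).toLinearEquiv : E →ₗ[ℝ] E) =
      ((ℝ ∙ u).reflection.toLinearEquiv : E →ₗ[ℝ] E) ∘ₗ ((ℝ ∙ e).reflection.toLinearEquiv : E →ₗ[ℝ] E) :=
    rfl
  have h2 : ∀ v : E, v ≠ 0 → LinearMap.det ((ℝ ∙ v).reflection.toLinearEquiv : E →ₗ[ℝ] E) =
      (-1) ^ (finrank ℝ E - 1) := fun v hv => by
    have h3 := Submodule.det_reflection (ℝ ∙ v)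
    have h4 := (ℝ ∙ v).finrank_add_finrank_orthogonal
    rw [finrank_span_singleton hv] at h4
    rw [← h4, Nat.add_sub_cancel_left]
    exact h3
  rw [h1, LinearMap.det_comp, h2 u hu, h2 e he, ← mul_pow]
  norm_num

lemma scaledReflection_scaledReflection [FiniteDimensional ℝ E] {u e : E} (hu : u ≠ 0) (he : ‖e‖ = 1)
    (x : E) :
    scaledReflection (scaledReflection x e) u = (‖u‖ ^ 2) • reflectionComp u e x := by
  have h0 : e ≠ 0 := by rintro rfl; simp at he
  rw [scaledReflection_eq_smul hu, scaledReflection_eq_smul h0, he, one_pow, one_smul]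
  rfl

lemma norm_reflectionComp_sub_le [FiniteDimensional ℝ E] {u e : E} (he : ‖e‖ = 1)
    (hu : u ≠ 0) (x : E) : ‖reflectionComp u e x - x‖ ≤ 8 * ‖u - e‖ * ‖x‖ := by
  have h0 : e ≠ 0 := by rintro rfl; simp at he
  have hu0 : 0 < ‖u‖ := norm_pos_iff.2 hu
  set w := (ℝ ∙ e).reflection x with hw
  have hwx : ‖w‖ = ‖x‖ := LinearIsometryEquiv.norm_map _ _
  have h1 : x = (ℝ ∙ e).reflection w := by rw [hw, Submodule.reflection_reflection]
  have h2 : reflectionComp u e x = (ℝ ∙ u).reflection w := rfl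
  set v := ‖u‖⁻¹ • u with hv
  have hv1 : ‖v‖ = 1 := by rw [hv, norm_smul, norm_inv, norm_norm, inv_mul_cancel₀ hu0.ne']
  have h3 : (ℝ ∙ u).reflection w = (2 * ⟪w, v⟫) • v - w := by
    rw [Submodule.reflection_singleton_apply, hv, inner_smul_right, smul_smul, two_smul, ← add_smul,
      real_inner_comm]
    congr 2
    simp only [RCLike.ofReal_real_eq_id, id_eq]
    field_simp
    ring
  have h4 : (ℝ ∙ e).reflection w = (2 * ⟪w, e⟫) • e - w := by
    rw [Submodule.reflection_singleton_apply, two_smul, ← add_smul, real_inner_comm, he]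
    congr 2
    simp
    ring
  have h5 : ‖v - e‖ ≤ 2 * ‖u - e‖ := by
    have h6 : v - e = (v - u) + (u - e) := by abel
    have h7 : ‖v - u‖ = |‖u‖ - 1| := by
      have : v - u = (‖u‖⁻¹ - 1) • u := by rw [sub_smul, one_smul]
      calc _ = |‖u‖⁻¹ - 1| * |‖u‖| := by rw [this, norm_smul, Real.norm_eq_abs, abs_norm]
        _ = |1 - ‖u‖| := by rw [← abs_mul, sub_mul, inv_mul_cancel₀ hu0.ne', one_mul]
        _ = _ := abs_sub_comm _ _
    rw [h6]
    refine (norm_add_le _ _).trans ?_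
    have := abs_norm_sub_norm_le u e
    rw [he] at this
    linarith
  have h8 : reflectionComp u e x - x = (2 * ⟪w, v - e⟫) • v + (2 * ⟪w, e⟫) • (v - e) := by
    have h4' : x = (2 * ⟪w, e⟫) • e - w := h1.trans h4
    rw [h2, h3]
    conv_lhs => rw [h4']
    rw [inner_sub_right, smul_sub, mul_sub, sub_smul]
    abel
  rw [h8]
  have h9 := abs_real_inner_le_norm w (v - e)
  have h10 := abs_real_inner_le_norm w e
  rw [he, mul_one] at h10
  calc _ ≤ 2 * |⟪w, v - e⟫| * ‖v‖ + 2 * |⟪w, e⟫| * ‖v - e‖ := by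
        refine (norm_add_le _ _).trans (le_of_eq ?_)
        simp only [norm_smul, norm_mul, Real.norm_eq_abs, Nat.abs_ofNat]
    _ ≤ 2 * (‖w‖ * ‖v - e‖) * 1 + 2 * ‖w‖ * ‖v - e‖ := by rw [hv1]; gcongr
    _ = 4 * ‖x‖ * ‖v - e‖ := by rw [hwx]; ring
    _ ≤ 4 * ‖x‖ * (2 * ‖u - e‖) := by gcongr
    _ = _ := by ring

lemma exists_inner_basis_ge {ι : Type*} [Fintype ι] (b : OrthonormalBasis ι ℝ E) {x : E} (hx : x ≠ 0) :
    ∃ i, (Fintype.card ι : ℝ)⁻¹ * ‖x‖ ≤ |⟪x, b i⟫| := by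
  by_contra! h
  have h1 : ‖x‖ ≤ ∑ i, |⟪x, b i⟫| := by
    conv_lhs => rw [← b.sum_repr' x]
    refine (norm_sum_le _ _).trans (le_of_eq (Finset.sum_congr rfl fun i _ => ?_))
    rw [norm_smul, b.norm_eq_one, mul_one, real_inner_comm, Real.norm_eq_abs]
  have hne : Nonempty ι := by
    by_contra hemp
    rw [not_nonempty_iff] at hemp
    exact hx (norm_le_zero_iff.1 (by simpa using h1))
  have h2 : ∑ i, |⟪x, b i⟫| < ∑ _i : ι, (Fintype.card ι : ℝ)⁻¹ * ‖x‖ :=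
    Finset.sum_lt_sum_of_nonempty Finset.univ_nonempty fun i _ => h i
  have hc : (Fintype.card ι : ℝ) ≠ 0 := by simp
  rw [Finset.sum_const, nsmul_eq_mul, Finset.card_univ, ← mul_assoc, mul_inv_cancel₀ hc, one_mul] at h2
  linarith

end ReflectionGeometry

section RotationAverage

open scoped ENNReal Topology RealInnerProductSpace
open Module

variable {E : Type*} [NormedAddCommGroup E] [InnerProductSpace ℝ E] [FiniteDimensional ℝ E]
  [MeasurableSpace E] [BorelSpace E]

lemma volume_closedBall_zero_mul {k r : ℝ} (hk : 0 ≤ k) (hr : 0 ≤ r) :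
    volume (Metric.closedBall (0 : E) (k * r)) =
      ENNReal.ofReal k ^ finrank ℝ E * volume (Metric.closedBall (0 : E) r) := by
  rw [Measure.addHaar_closedBall_mul _ _ hk hr, ENNReal.ofReal_pow hk]

lemma ContinuousLinearMap.ofReal_abs_det_le (A : E →L[ℝ] E) :
    ENNReal.ofReal |A.det| ≤ ENNReal.ofReal ‖A‖ ^ finrank ℝ E := by
  have h0 : volume (Metric.closedBall (0 : E) 1) ≠ 0 := by
    simpa using (Metric.measure_closedBall_pos volume (0 : E) one_pos).ne'
  have h1 : A '' Metric.closedBall 0 1 ⊆ Metric.closedBall 0 (‖A‖ * 1) := by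
    rintro _ ⟨x, hx, rfl⟩
    rw [mem_closedBall_zero_iff] at hx ⊢
    exact (A.le_opNorm x).trans (by gcongr)
  have h2 := measure_mono (μ := (volume : Measure E)) h1
  rw [Measure.addHaar_image_continuousLinearMap, volume_closedBall_zero_mul (norm_nonneg _)
    zero_le_one] at h2
  exact (ENNReal.mul_le_mul_iff_left h0 measure_closedBall_lt_top.ne).1 h2

/-- A change of variables inequality for a map that need not be injective. -/
lemma setLIntegral_le_of_subset_image {g : E → E} {g' : E → E →L[ℝ] E} {U V : Set E} {L : ℝ}
    (hU : MeasurableSet U) (hgm : Measurable g) (hg : ∀ x ∈ U, HasFDerivAt g (g' x) x)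
    (hL : ∀ x ∈ U, ‖g' x‖ ≤ L) (hV : V ⊆ g '' U) {F : E → ℝ≥0∞} (hF : Measurable F) :
    ∫⁻ y in V, F y ≤ ENNReal.ofReal L ^ finrank ℝ E * ∫⁻ u in U, F (g u) := by
  have hle : volume.restrict V ≤
      ENNReal.ofReal L ^ finrank ℝ E • (volume.restrict U).map g := by
    refine Measure.le_iff.2 fun S hS => ?_
    rw [Measure.restrict_apply hS, Measure.smul_apply, Measure.map_apply hgm hS,
      Measure.restrict_apply (hgm hS), smul_eq_mul]
    have hsub : S ∩ V ⊆ g '' (g ⁻¹' S ∩ U) := by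
      rintro y ⟨hyS, hyV⟩
      obtain ⟨u, hu, rfl⟩ := hV hyV
      exact ⟨u, ⟨hyS, hu⟩, rfl⟩
    refine (measure_mono hsub).trans ((addHaar_image_le_lintegral_abs_det_fderiv volume
      ((hgm hS).inter hU) fun x hx => (hg x hx.2).hasFDerivWithinAt).trans ?_)
    rw [← setLIntegral_const]
    refine setLIntegral_mono measurable_const fun x hx => ?_
    refine (ContinuousLinearMap.ofReal_abs_det_le _).trans ?_
    gcongr
    exact hL x hx.2
  calc _ ≤ ∫⁻ y, F y ∂(ENNReal.ofReal L ^ finrank ℝ E • (volume.restrict U).map g) :=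
        lintegral_mono' hle le_rfl
    _ = _ := by rw [lintegral_smul_measure, lintegral_map hF hgm, smul_eq_mul]

variable {Ω : E → ℝ}

lemma lintegral_closedBall_le_scaledReflection (hΩ : Measurable Ω) {e x : E} {κ δ : ℝ}
    (he : ‖e‖ = 1) (hκ : 0 < κ) (hκ1 : κ ≤ 1) (hx : x ∈ (shell (1 / 2) 3 : Set E))
    (hxe : κ * ‖x‖ ≤ |⟪x, e⟫|) (hδ : 10 / κ * δ ≤ 1 / 2) :
    ∫⁻ y in Metric.closedBall x δ, ‖Ω y - Ω x‖ₑ ≤ 27 ^ finrank ℝ E *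
      ∫⁻ u in Metric.closedBall e (10 / κ * δ),
        ‖Ω (scaledReflection (scaledReflection x e) u) - Ω x‖ₑ := by
  have h0 : e ≠ 0 := by rintro rfl; simp at he
  have hx' : ‖scaledReflection x e‖ = ‖x‖ := by
    rw [scaledReflection_eq_smul h0, he]; simp
  rw [← ENNReal.ofReal_ofNat 27]
  refine setLIntegral_le_of_subset_image (F := fun y => ‖Ω y - Ω x‖ₑ) measurableSet_closedBall
    (continuous_scaledReflection.comp (Continuous.prodMk_right _)).measurable
    (fun u _ => hasFDerivAt_scaledReflection _ u) (fun u hu => ?_) (fun y hy => ?_)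
    (hΩ.sub_const _).enorm
  · refine (norm_scaledReflectionDeriv_le _ _).trans ?_
    change 6 * ‖scaledReflection x e‖ * ‖u‖ ≤ 27
    rw [hx']
    rw [Metric.mem_closedBall, dist_eq_norm] at hu
    have h1 : ‖u‖ ≤ 3 / 2 := by
      have := norm_le_norm_add_norm_sub e u
      rw [norm_sub_rev] at hu
      linarith
    have h2 := hx.2
    calc _ ≤ 6 * 3 * (3 / 2 : ℝ) := by gcongr
      _ = 27 := by norm_num
  · rw [Metric.mem_closedBall, dist_eq_norm] at hy
    obtain ⟨u, hu, hu'⟩ := exists_scaledReflection_eq he hκ hκ1 hx.1.le hxe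
      (by rw [div_mul_eq_mul_div, div_le_iff₀ hκ] at hδ; linarith) hy
    exact ⟨u, by rwa [Metric.mem_closedBall, dist_eq_norm], hu'⟩

/-- Averages of local oscillations are controlled by rotations. -/
lemma lintegral_oscillation_le [Nontrivial E] (hΩ : Measurable Ω)
    (hhom : ∀ t : ℝ, 0 < t → ∀ x, Ω (t • x) = Ω x)
    {δ : ℝ} (hδ : 10 * finrank ℝ E * δ ≤ 1 / 2) {R : ℝ≥0∞}
    (hR : ∀ ρ : E ≃ₗᵢ[ℝ] E, LinearMap.det (ρ.toLinearEquiv : E →ₗ[ℝ] E) = 1 →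
      (∀ x, ‖ρ x - x‖ ≤ 80 * finrank ℝ E * δ * ‖x‖) →
      ∫⁻ x in shell (1 / 2) 3, ‖Ω (ρ x) - Ω x‖ₑ ≤ R) :
    ∫⁻ x in shell (1 / 2) 3, ∫⁻ y in Metric.closedBall x δ, ‖Ω y - Ω x‖ₑ ≤
      finrank ℝ E * 27 ^ finrank ℝ E *
        volume (Metric.closedBall (0 : E) (10 * finrank ℝ E * δ)) * R := by
  set d := finrank ℝ E with hd
  have hd0 : 0 < (d : ℝ) := by exact_mod_cast (finrank_pos : 0 < finrank ℝ E)
  have hd1 : (1 : ℝ) ≤ d := by exact_mod_cast (finrank_pos : 0 < finrank ℝ E)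
  set b := stdOrthonormalBasis ℝ E
  set C : Fin d → Set E := fun i => shell (1 / 2) 3 ∩ {x | (d : ℝ)⁻¹ * ‖x‖ ≤ |⟪x, b i⟫|} with hC
  have hCm : ∀ i, MeasurableSet (C i) := fun i => (measurableSet_shell _ _).inter
    (measurableSet_le (by fun_prop) (by fun_prop))
  have hcov : (shell (1 / 2) 3 : Set E) ⊆ ⋃ i, C i := fun x hx => by
    have hx0 : x ≠ 0 := by
      rintro rfl
      have := hx.1
      norm_num at this
    obtain ⟨i, hi⟩ := exists_inner_basis_ge b hx0
    rw [Fintype.card_fin] at hi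
    exact mem_iUnion.2 ⟨i, hx, hi⟩
  have hr : 10 / (d : ℝ)⁻¹ * δ = 10 * d * δ := by rw [div_inv_eq_mul]
  have hper : ∀ i, ∫⁻ x in C i, ∫⁻ y in Metric.closedBall x δ, ‖Ω y - Ω x‖ₑ ≤
      27 ^ d * volume (Metric.closedBall (0 : E) (10 * d * δ)) * R := fun i => by
    have he : ‖b i‖ = 1 := b.norm_eq_one i
    have h0 : b i ≠ 0 := by intro h; rw [h] at he; simp at he
    have hm : Measurable (Function.uncurry fun x u : E =>
        ‖Ω (scaledReflection (scaledReflection x (b i)) u) - Ω x‖ₑ) := by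
      have h1 : Continuous fun p : E × E => scaledReflection (scaledReflection p.1 (b i)) p.2 := by
        unfold scaledReflection
        fun_prop
      exact ((hΩ.comp h1.measurable).sub (hΩ.comp measurable_fst)).enorm
    calc _ ≤ ∫⁻ x in C i, 27 ^ d * ∫⁻ u in Metric.closedBall (b i) (10 * d * δ),
            ‖Ω (scaledReflection (scaledReflection x (b i)) u) - Ω x‖ₑ := by
          refine setLIntegral_mono' (hCm i) fun x hx => ?_
          rw [← hr]
          exact lintegral_closedBall_le_scaledReflection hΩ he (inv_pos.2 hd0)
            (inv_le_one_of_one_le₀ hd1) hx.1 hx.2 (hr ▸ hδ)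
      _ = 27 ^ d * ∫⁻ u in Metric.closedBall (b i) (10 * d * δ), ∫⁻ x in C i,
            ‖Ω (scaledReflection (scaledReflection x (b i)) u) - Ω x‖ₑ := by
          rw [lintegral_const_mul' _ _ (by finiteness), lintegral_lintegral_swap hm.aemeasurable]
      _ ≤ 27 ^ d * ∫⁻ u in Metric.closedBall (b i) (10 * d * δ), R := by
          gcongr 27 ^ d * ?_
          refine setLIntegral_mono measurable_const fun u hu => ?_
          rw [Metric.mem_closedBall, dist_eq_norm] at hu
          have hu0 : u ≠ 0 := by
            rintro rfl
            rw [zero_sub, norm_neg, he] at hu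
            linarith
          refine (lintegral_mono_set inter_subset_left).trans ((le_of_eq ?_).trans
            (hR (reflectionComp u (b i)) (det_reflectionComp hu0 h0) fun x => ?_))
          · refine lintegral_congr fun x => ?_
            rw [scaledReflection_scaledReflection hu0 he, hhom _ (by positivity)]
          · refine (norm_reflectionComp_sub_le he hu0 x).trans ?_
            exact mul_le_mul_of_nonneg_right (by linarith) (norm_nonneg _)
      _ = _ := by
          rw [setLIntegral_const, Measure.addHaar_closedBall_center]
          ring
  calc _ ≤ ∑' i, ∫⁻ x in C i, ∫⁻ y in Metric.closedBall x δ, ‖Ω y - Ω x‖ₑ :=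
        (lintegral_mono_set hcov).trans (lintegral_iUnion_le _ _)
    _ ≤ ∑' _i : Fin d, 27 ^ d * volume (Metric.closedBall (0 : E) (10 * d * δ)) * R :=
        ENNReal.tsum_le_tsum hper
    _ = _ := by
        rw [tsum_fintype, Finset.sum_const, Finset.card_univ, Fintype.card_fin, nsmul_eq_mul]
        ring

/-- Translations are controlled by rotations. -/
lemma lintegral_translate_le [Nontrivial E] (hΩ : Measurable Ω)
    (hhom : ∀ t : ℝ, 0 < t → ∀ x, Ω (t • x) = Ω x)
    {δ : ℝ} (hδ0 : 0 < δ) (hδ : 40 * finrank ℝ E * δ ≤ 1) {R : ℝ≥0∞}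
    (hR : ∀ ρ : E ≃ₗᵢ[ℝ] E, LinearMap.det (ρ.toLinearEquiv : E →ₗ[ℝ] E) = 1 →
      (∀ x, ‖ρ x - x‖ ≤ 160 * finrank ℝ E * δ * ‖x‖) →
      ∫⁻ x in shell (1 / 2) 3, ‖Ω (ρ x) - Ω x‖ₑ ≤ R) {h : E} (hh : ‖h‖ ≤ δ) :
    ∫⁻ x in shell 1 2, ‖Ω (x + h) - Ω x‖ₑ ≤
      2 * (finrank ℝ E * 27 ^ finrank ℝ E * ENNReal.ofReal (20 * finrank ℝ E) ^ finrank ℝ E) * R := by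
  set d := finrank ℝ E with hd
  have hd1 : (1 : ℝ) ≤ d := by exact_mod_cast (finrank_pos : 0 < finrank ℝ E)
  have hδ1 : 40 * δ ≤ 1 := by nlinarith
  have hosc := lintegral_oscillation_le (R := R) (δ := 2 * δ) hΩ hhom (by rw [← hd]; linarith)
    (fun ρ h1 h2 => hR ρ h1 fun x => (h2 x).trans (le_of_eq (by rw [← hd]; ring)))
  rw [← hd] at hosc
  set A := ∫⁻ x in shell (1 / 2) 3, ∫⁻ y in Metric.closedBall x (2 * δ), ‖Ω y - Ω x‖ₑ with hA
  have hA1 : ∫⁻ x in shell 1 2, ∫⁻ y in Metric.closedBall x δ, ‖Ω y - Ω x‖ₑ ≤ A := by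
    have hsub : (shell 1 2 : Set E) ⊆ shell (1 / 2) 3 := fun x hx =>
      ⟨by linarith [hx.1], by linarith [hx.2]⟩
    refine (lintegral_mono_set hsub).trans ?_
    refine lintegral_mono fun x => lintegral_mono_set (Metric.closedBall_subset_closedBall (by linarith))
  have hA2 : ∫⁻ x in shell 1 2, ∫⁻ y in Metric.closedBall (x + h) (2 * δ), ‖Ω y - Ω (x + h)‖ₑ ≤ A := by
    set Φ : E → ℝ≥0∞ := (shell (1 / 2) 3).indicator fun x =>
      ∫⁻ y in Metric.closedBall x (2 * δ), ‖Ω y - Ω x‖ₑ with hΦ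
    calc _ ≤ ∫⁻ x in shell 1 2, Φ (x + h) := by
          refine setLIntegral_mono' (measurableSet_shell _ _) fun x hx => ?_
          rw [hΦ, indicator_of_mem]
          have h1 := norm_add_le x h
          have h2 := norm_sub_le (x + h) h
          rw [add_sub_cancel_right] at h2
          exact ⟨by linarith [hx.1], by linarith [hx.2]⟩
      _ ≤ ∫⁻ x, Φ (x + h) := setLIntegral_le_lintegral _ _
      _ = A := by
          rw [lintegral_add_right_eq_self, hΦ, lintegral_indicator (measurableSet_shell _ _)]
  have hv0 : volume (Metric.closedBall (0 : E) δ) ≠ 0 :=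
    (Metric.measure_closedBall_pos volume (0 : E) hδ0).ne'
  have hm1 : Measurable fun x : E => ∫⁻ y in Metric.closedBall x δ, ‖Ω y - Ω x‖ₑ := by
    have h1 : Measurable (Function.uncurry fun x y : E =>
        (Metric.closedBall x δ).indicator (fun y => ‖Ω y - Ω x‖ₑ) y) := by
      have hs : MeasurableSet {p : E × E | dist p.2 p.1 ≤ δ} :=
        measurableSet_le (by fun_prop) measurable_const
      exact (((hΩ.comp measurable_snd).sub (hΩ.comp measurable_fst)).enorm).indicator hs
    have h2 := h1.lintegral_prod_right' (ν := volume)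
    refine (congrArg Measurable (funext fun x => ?_)).mp h2
    exact lintegral_indicator measurableSet_closedBall _
  refine (ENNReal.mul_le_mul_iff_right hv0 measure_closedBall_lt_top.ne).1 ?_
  calc volume (Metric.closedBall (0 : E) δ) * ∫⁻ x in shell 1 2, ‖Ω (x + h) - Ω x‖ₑ
      = ∫⁻ x in shell 1 2, ∫⁻ y in Metric.closedBall x δ, ‖Ω (x + h) - Ω x‖ₑ := by
        rw [← lintegral_const_mul' _ _ measure_closedBall_lt_top.ne]
        refine lintegral_congr fun x => ?_
        rw [setLIntegral_const, Measure.addHaar_closedBall_center volume x, mul_comm]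
    _ ≤ ∫⁻ x in shell 1 2, ((∫⁻ y in Metric.closedBall x δ, ‖Ω y - Ω x‖ₑ) +
          ∫⁻ y in Metric.closedBall (x + h) (2 * δ), ‖Ω y - Ω (x + h)‖ₑ) := by
        refine lintegral_mono fun x => ?_
        calc _ ≤ ∫⁻ y in Metric.closedBall x δ, (‖Ω y - Ω x‖ₑ + ‖Ω y - Ω (x + h)‖ₑ) := by
              refine lintegral_mono fun y => ?_
              rw [← sub_sub_sub_cancel_left (Ω x) (Ω (x + h)) (Ω y)]
              exact enorm_sub_le
          _ = _ := lintegral_add_left (hΩ.sub_const _).enorm _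
          _ ≤ _ := by
              gcongr
              intro y hy
              rw [Metric.mem_closedBall, dist_eq_norm] at hy ⊢
              have : y - (x + h) = (y - x) - h := by abel
              rw [this]
              linarith [norm_sub_le (y - x) h]
    _ ≤ A + A := by
        rw [lintegral_add_left hm1]
        exact add_le_add hA1 hA2
    _ ≤ 2 * (d * 27 ^ d * volume (Metric.closedBall (0 : E) (10 * d * (2 * δ))) * R) := by
        rw [two_mul]; exact add_le_add hosc hosc
    _ = _ := by
        have : 10 * (d : ℝ) * (2 * δ) = 20 * d * δ := by ring
        rw [this, volume_closedBall_zero_mul (by positivity) hδ0.le]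
        ring

end RotationAverage

section PolarCoordinates

open scoped ENNReal Topology
open Module

variable {E : Type*} [NormedAddCommGroup E] [InnerProductSpace ℝ E] [FiniteDimensional ℝ E]
  [MeasurableSpace E] [BorelSpace E]

lemma lintegral_eq_lintegral_polar [Nontrivial E] (P : E → ℝ≥0∞) :
    ∫⁻ x, P x = ∫⁻ p, P ((p.2 : ℝ) • (p.1 : E))
      ∂((volume : Measure E).toSphere.prod (Measure.volumeIoiPow (finrank ℝ E - 1))) := by
  have h : ∫⁻ x, P x = ∫⁻ x : ({0}ᶜ : Set E), P x ∂(volume.comap Subtype.val) := by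
    rw [lintegral_subtype_comap (measurableSet_singleton _).compl, restrict_compl_singleton]
  rw [← (volume : Measure E).measurePreserving_homeomorphUnitSphereProd.lintegral_comp_emb
    (homeomorphUnitSphereProd E).measurableEmbedding, h]
  refine lintegral_congr fun x => ?_
  congr 1
  exact (congrArg Subtype.val ((homeomorphUnitSphereProd E).symm_apply_apply x)).symm

lemma integral_eq_integral_polar [Nontrivial E] (P : E → ℝ) :
    ∫ x, P x = ∫ p, P ((p.2 : ℝ) • (p.1 : E))
      ∂((volume : Measure E).toSphere.prod (Measure.volumeIoiPow (finrank ℝ E - 1))) := by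
  have h : ∫ x, P x = ∫ x : ({0}ᶜ : Set E), P x ∂(volume.comap Subtype.val) := by
    rw [integral_subtype_comap (measurableSet_singleton _).compl, restrict_compl_singleton]
  rw [← (volume : Measure E).measurePreserving_homeomorphUnitSphereProd.integral_comp
    (homeomorphUnitSphereProd E).measurableEmbedding, h]
  refine integral_congr_ae (ae_of_all _ fun x => ?_)
  refine congrArg P ?_
  exact (congrArg Subtype.val ((homeomorphUnitSphereProd E).symm_apply_apply x)).symm

lemma ae_iff_ae_polar [Nontrivial E] {P : E → Prop} :
    (∀ᵐ x, P x) ↔ ∀ᵐ p ∂((volume : Measure E).toSphere.prod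
      (Measure.volumeIoiPow (finrank ℝ E - 1))), P ((p.2 : ℝ) • (p.1 : E)) := by
  have h : (∀ᵐ x, P x) ↔ ∀ᵐ x : ({0}ᶜ : Set E) ∂(volume.comap Subtype.val), P x := by
    rw [← (MeasurableEmbedding.subtype_coe (measurableSet_singleton (0 : E)).compl).ae_map_iff,
      map_comap_subtype_coe (measurableSet_singleton (0 : E)).compl, restrict_compl_singleton]
  rw [← (volume : Measure E).measurePreserving_homeomorphUnitSphereProd.map_eq,
    (homeomorphUnitSphereProd E).measurableEmbedding.ae_map_iff, h]
  refine eventually_congr (ae_of_all _ fun x => ?_)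
  refine iff_of_eq (congrArg P ?_)
  exact (congrArg Subtype.val ((homeomorphUnitSphereProd E).symm_apply_apply x)).symm

lemma volumeIoiPow_ne_zero (k : ℕ) : Measure.volumeIoiPow k ≠ 0 := by
  intro h
  have := Measure.volumeIoiPow_apply_Iio k ⟨1, mem_Ioi.2 one_pos⟩
  rw [h, Measure.coe_zero, Pi.zero_apply, eq_comm, ENNReal.ofReal_eq_zero, one_pow] at this
  have h2 : (0 : ℝ) < 1 / (k + 1) := by positivity
  exact absurd this (not_le.2 h2)

/-- A property invariant under positive dilations holds almost everywhere in the space if and only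
if it holds almost everywhere on the unit sphere. -/
lemma ae_iff_ae_toSphere [Nontrivial E] {P : E → Prop}
    (hP : ∀ t : ℝ, 0 < t → ∀ x : E, x ≠ 0 → (P (t • x) ↔ P x)) :
    (∀ᵐ x, P x) ↔ ∀ᵐ θ : Metric.sphere (0 : E) 1 ∂(volume : Measure E).toSphere, P θ := by
  have hθ : ∀ p : Metric.sphere (0 : E) 1 × Ioi (0 : ℝ), P ((p.2 : ℝ) • (p.1 : E)) ↔ P p.1 :=
    fun p => hP _ p.2.2 _ (ne_zero_of_mem_unit_sphere p.1)
  rw [ae_iff_ae_polar, eventually_congr (ae_of_all _ hθ)]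
  constructor
  · intro h
    have hne : (ae (Measure.volumeIoiPow (finrank ℝ E - 1))).NeBot :=
      ae_neBot.2 (volumeIoiPow_ne_zero _)
    filter_upwards [Measure.ae_ae_of_ae_prod h] with θ hθ
    exact hθ.exists.choose_spec
  · exact fun h => Measure.quasiMeasurePreserving_fst.ae (p := fun θ : Metric.sphere (0 : E) 1 => P θ) h

lemma lintegral_volumeIoiPow (k : ℕ) {w : ℝ → ℝ≥0∞} (hw : Measurable w) :
    ∫⁻ r, w r ∂(Measure.volumeIoiPow k) = ∫⁻ r in Ioi (0 : ℝ), ENNReal.ofReal (r ^ k) * w r := by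
  rw [Measure.volumeIoiPow, lintegral_withDensity_eq_lintegral_mul (g := fun r : Ioi (0 : ℝ) => w r) _
    (by fun_prop) (hw.comp measurable_subtype_coe)]
  exact lintegral_subtype_comap measurableSet_Ioi fun r => ENNReal.ofReal (r ^ k) * w r

lemma smul_mem_shell_iff {a b r : ℝ} (hr : 0 < r) (θ : Metric.sphere (0 : E) 1) :
    r • (θ : E) ∈ (shell a b : Set E) ↔ r ∈ Ioc a b := by
  simp [shell, norm_smul, abs_of_pos hr]

/-- Integration over a shell of a product of an angular and a radial function. -/
lemma setLIntegral_shell_eq [Nontrivial E] {P : E → ℝ≥0∞}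
    {G : Metric.sphere (0 : E) 1 → ℝ≥0∞} {w : ℝ → ℝ≥0∞} (hG : Measurable G) (hw : Measurable w)
    (hP : ∀ θ : Metric.sphere (0 : E) 1, ∀ r : ℝ, 0 < r → P (r • (θ : E)) = G θ * w r)
    {a b : ℝ} (ha : 0 < a) :
    ∫⁻ x in shell a b, P x = (∫⁻ θ, G θ ∂(volume : Measure E).toSphere) *
      ∫⁻ r in Ioc a b, ENNReal.ofReal (r ^ (finrank ℝ E - 1)) * w r := by
  rw [← lintegral_indicator (measurableSet_shell _ _), lintegral_eq_lintegral_polar]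
  have h1 : ∀ p : Metric.sphere (0 : E) 1 × Ioi (0 : ℝ),
      (shell a b).indicator P ((p.2 : ℝ) • (p.1 : E)) = G p.1 * (Ioc a b).indicator w p.2 := fun p => by
    by_cases h : (p.2 : ℝ) ∈ Ioc a b
    · rw [indicator_of_mem h, indicator_of_mem ((smul_mem_shell_iff p.2.2 _).2 h), hP _ _ p.2.2]
    · rw [indicator_of_notMem h, indicator_of_notMem (mt (smul_mem_shell_iff p.2.2 _).1 h), mul_zero]
  have hwi : Measurable ((Ioc a b).indicator w) := hw.indicator measurableSet_Ioc
  rw [lintegral_congr h1, lintegral_prod_mul hG.aemeasurable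
    (hwi.comp measurable_subtype_coe).aemeasurable (g := fun r : Ioi (0 : ℝ) => (Ioc a b).indicator w r),
    lintegral_volumeIoiPow _ hwi]
  congr 1
  rw [← lintegral_indicator measurableSet_Ioi, ← lintegral_indicator measurableSet_Ioc]
  refine lintegral_congr fun r => ?_
  by_cases h : r ∈ Ioc a b
  · rw [indicator_of_mem h, indicator_of_mem (show r ∈ Ioi (0 : ℝ) from ha.trans h.1), indicator_of_mem h]
  · rw [indicator_of_notMem h]
    by_cases h' : r ∈ Ioi (0 : ℝ)
    · rw [indicator_of_mem h', indicator_of_notMem h, mul_zero]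
    · rw [indicator_of_notMem h']

lemma integral_shell_eq_zero [Nontrivial E] {P : E → ℝ} {φ : Metric.sphere (0 : E) 1 → ℝ} {w : ℝ → ℝ}
    (hP : ∀ θ : Metric.sphere (0 : E) 1, ∀ r : ℝ, 0 < r → P (r • (θ : E)) = φ θ * w r)
    (hφ : ∫ θ, φ θ ∂(volume : Measure E).toSphere = 0) (a b : ℝ) :
    ∫ x in shell a b, P x = 0 := by
  rw [← integral_indicator (measurableSet_shell _ _), integral_eq_integral_polar]
  have h1 : ∀ p : Metric.sphere (0 : E) 1 × Ioi (0 : ℝ),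
      (shell a b).indicator P ((p.2 : ℝ) • (p.1 : E)) = φ p.1 * (Ioc a b).indicator w p.2 := fun p => by
    by_cases h : (p.2 : ℝ) ∈ Ioc a b
    · rw [indicator_of_mem h, indicator_of_mem ((smul_mem_shell_iff p.2.2 _).2 h), hP _ _ p.2.2]
    · rw [indicator_of_notMem h, indicator_of_notMem (mt (smul_mem_shell_iff p.2.2 _).1 h), mul_zero]
  rw [integral_congr_ae (ae_of_all _ h1), integral_prod_mul φ fun r : Ioi (0 : ℝ) =>
    (Ioc a b).indicator w r, hφ, zero_mul]

open Classical in
/-- The extension of a function on the unit sphere that is homogeneous of degree zero. -/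
def radialExt (φ : Metric.sphere (0 : E) 1 → ℝ) (x : E) : ℝ :=
  if h : x = 0 then 0 else φ (homeomorphUnitSphereProd E ⟨x, h⟩).1

lemma radialExt_smul (φ : Metric.sphere (0 : E) 1 → ℝ) {t : ℝ} (ht : 0 < t) (x : E) :
    radialExt φ (t • x) = radialExt φ x := by
  by_cases hx : x = 0
  · simp [hx]
  · have h : t • x ≠ 0 := smul_ne_zero ht.ne' hx
    rw [radialExt, radialExt, dif_neg hx, dif_neg h]
    congr 1
    ext
    simp only [homeomorphUnitSphereProd_apply_fst_coe, norm_smul, Real.norm_of_nonneg ht.le,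
      smul_smul]
    congr 1
    field_simp

lemma radialExt_coe (φ : Metric.sphere (0 : E) 1 → ℝ) (θ : Metric.sphere (0 : E) 1) :
    radialExt φ (θ : E) = φ θ := by
  rw [radialExt, dif_neg (ne_zero_of_mem_unit_sphere θ)]
  congr 1
  ext
  simp

lemma radialExt_smul_coe (φ : Metric.sphere (0 : E) 1 → ℝ) {r : ℝ} (hr : 0 < r)
    (θ : Metric.sphere (0 : E) 1) : radialExt φ (r • (θ : E)) = φ θ := by
  rw [radialExt_smul φ hr, radialExt_coe]

lemma measurable_radialExt {φ : Metric.sphere (0 : E) 1 → ℝ} (hφ : Measurable φ) :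
    Measurable (radialExt φ) := by
  classical
  refine Measurable.dite (s := {0}) (f := fun _ => 0)
    (g := fun x => φ (homeomorphUnitSphereProd E x).1) measurable_const ?_
    (measurableSet_singleton 0)
  exact hφ.comp (measurable_fst.comp (homeomorphUnitSphereProd E).measurable)

end PolarCoordinates

section SphericalKernel

open scoped ENNReal Topology
open Module

variable {E : Type*} [NormedAddCommGroup E] [InnerProductSpace ℝ E] [FiniteDimensional ℝ E]
  [MeasurableSpace E] [BorelSpace E]

/-- The kernel, homogeneous of degree `-dim E`, with given values on the unit sphere. -/
def sphericalKernel (φ : Metric.sphere (0 : E) 1 → ℝ) (x : E) : ℝ :=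
  radialExt φ x * (‖x‖ ^ finrank ℝ E)⁻¹

lemma ENNReal.tsum_ne_top_of_tail {f : ℕ → ℝ≥0∞} (hf : ∀ j, f j ≠ ⊤) (N : ℕ)
    (h : ∑' j, f (j + N) ≠ ⊤) : ∑' j, f j ≠ ⊤ := by
  rw [← Summable.sum_add_tsum_nat_add' (k := N) ENNReal.summable]
  exact ENNReal.add_ne_top.2 ⟨ENNReal.sum_ne_top.2 fun j _ => hf j, h⟩

/-- The Dini integral of an increasing function dominates its sum over a geometric sequence. -/
lemma tsum_ofReal_geometric_ne_top {ω : ℝ → ℝ} (hmono : ∀ s t, 0 ≤ s → s ≤ t → ω s ≤ ω t)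
    (hω : ∫⁻ δ in Ioo (0 : ℝ) 1, ENNReal.ofReal (ω δ / δ) ≠ ⊤) (h0 : ∀ t, 0 ≤ t → 0 ≤ ω t)
    {A : ℝ} (hA : 0 < A) :
    ∑' j : ℕ, ENNReal.ofReal (ω (A * 2⁻¹ ^ j)) ≠ ⊤ := by
  obtain ⟨N, hN⟩ : ∃ N : ℕ, (2⁻¹ : ℝ) ^ N < (2 * A)⁻¹ :=
    exists_pow_lt_of_lt_one (by positivity) (by norm_num)
  refine ENNReal.tsum_ne_top_of_tail (fun _ => ENNReal.ofReal_ne_top) N ?_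
  set s : ℕ → ℝ := fun j => A * 2⁻¹ ^ (j + N) with hs
  have hs0 : ∀ j, 0 < s j := fun j => by positivity
  have hsucc : ∀ j, 2 * s (j + 1) = s j := fun j => by simp only [hs]; ring
  have hanti : Antitone s := antitone_nat_of_succ_le fun j => by linarith [hsucc j, hs0 (j + 1)]
  have hs1 : ∀ j, 2 * s j ≤ 1 := fun j => by
    have h1 : s j ≤ s 0 := hanti (Nat.zero_le j)
    have h2 : s 0 ≤ A * (2 * A)⁻¹ := by
      simp only [hs, zero_add]
      gcongr
    have h3 : A * (2 * A)⁻¹ = 1 / 2 := by field_simp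
    linarith
  have hdisj : Pairwise (Function.onFun Disjoint fun j => Ioo (s j) (2 * s j)) := by
    refine (pairwise_disjoint_on _).2 fun i j hij => ?_
    refine disjoint_left.2 fun δ hδi hδj => ?_
    have h1 : s j ≤ s (i + 1) := hanti hij
    have h2 := hsucc i
    linarith [hδi.1, hδj.2]
  have hterm : ∀ j, ENNReal.ofReal (ω (s j)) ≤
      2 * ∫⁻ δ in Ioo (s j) (2 * s j), ENNReal.ofReal (ω δ / δ) := fun j => by
    have hj := hs0 j
    have hwj := h0 _ hj.le
    calc ENNReal.ofReal (ω (s j))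
        = 2 * ∫⁻ _ in Ioo (s j) (2 * s j), ENNReal.ofReal (ω (s j) / (2 * s j)) := by
          rw [setLIntegral_const, Real.volume_Ioo, ← ENNReal.ofReal_mul (by positivity),
            ← ENNReal.ofReal_ofNat 2, ← ENNReal.ofReal_mul (by positivity)]
          congr 1
          field_simp
          ring
      _ ≤ _ := by
          gcongr 2 * ?_
          refine setLIntegral_mono' measurableSet_Ioo fun δ hδ => ?_
          have hδ0 : 0 < δ := hj.trans hδ.1
          have := hmono _ _ hj.le hδ.1.le
          refine ENNReal.ofReal_le_ofReal ?_
          exact div_le_div₀ (hwj.trans this) this hδ0 hδ.2.le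
  refine ne_top_of_le_ne_top ?_ (ENNReal.tsum_le_tsum hterm)
  rw [ENNReal.tsum_mul_left, ← lintegral_iUnion (fun _ => measurableSet_Ioo) hdisj]
  refine ENNReal.mul_ne_top (by simp) (ne_top_of_le_ne_top hω (lintegral_mono_set ?_))
  exact iUnion_subset fun j => Ioo_subset_Ioo (hs0 j).le (hs1 j)

lemma sphericalKernel_smul_coe (φ : Metric.sphere (0 : E) 1 → ℝ) {r : ℝ} (hr : 0 < r)
    (θ : Metric.sphere (0 : E) 1) :
    sphericalKernel φ (r • (θ : E)) = φ θ * (r ^ finrank ℝ E)⁻¹ := by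
  rw [sphericalKernel, radialExt_smul_coe φ hr, norm_smul, norm_eq_of_mem_sphere, mul_one,
    Real.norm_of_nonneg hr.le]

lemma sphericalKernel_smul (φ : Metric.sphere (0 : E) 1 → ℝ) {t : ℝ} (ht : 0 < t) (x : E) :
    sphericalKernel φ (t • x) = (t ^ finrank ℝ E)⁻¹ * sphericalKernel φ x := by
  rw [sphericalKernel, sphericalKernel, radialExt_smul φ ht, norm_smul, mul_pow,
    Real.norm_of_nonneg ht.le, mul_inv]
  ring

lemma lintegral_inv_Ioc {a b : ℝ} (ha : 0 < a) (hab : a ≤ b) :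
    ∫⁻ r in Ioc a b, ENNReal.ofReal r⁻¹ = ENNReal.ofReal (Real.log (b / a)) := by
  rw [← integral_inv_of_pos ha (ha.trans_le hab), intervalIntegral.integral_of_le hab,
    ofReal_integral_eq_lintegral_ofReal]
  · refine (intervalIntegrable_iff_integrableOn_Ioc_of_le hab).1
      (intervalIntegrable_inv_iff.2 (Or.inr ?_))
    rw [uIcc_of_le hab]
    exact fun h => absurd h.1 (not_le.2 ha)
  · filter_upwards [ae_restrict_mem measurableSet_Ioc] with r hr
    exact inv_nonneg.2 (ha.trans hr.1).le

lemma lintegral_shell_enorm_sphericalKernel [Nontrivial E] {φ : Metric.sphere (0 : E) 1 → ℝ}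
    (hφ : Measurable φ) {a b : ℝ} (ha : 0 < a) (hab : a ≤ b) :
    ∫⁻ x in shell a b, ‖sphericalKernel φ x‖ₑ =
      (∫⁻ θ, ‖φ θ‖ₑ ∂(volume : Measure E).toSphere) * ENNReal.ofReal (Real.log (b / a)) := by
  rw [setLIntegral_shell_eq (w := fun r => ENNReal.ofReal (r ^ finrank ℝ E)⁻¹) hφ.enorm
    (by fun_prop) (fun θ r hr => ?_) ha, ← lintegral_inv_Ioc ha hab]
  · congr 1
    refine setLIntegral_congr_fun measurableSet_Ioc fun r hr => ?_
    have hr0 : 0 < r := ha.trans hr.1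
    obtain ⟨k, hk⟩ := Nat.exists_eq_add_one.2 (finrank_pos (R := ℝ) (M := E))
    simp only [hk, Nat.add_sub_cancel]
    rw [← ENNReal.ofReal_mul (by positivity)]
    congr 1
    rw [pow_succ]
    field_simp
  · rw [sphericalKernel_smul_coe φ hr, enorm_mul,
      Real.enorm_of_nonneg (r := (r ^ finrank ℝ E)⁻¹) (by positivity)]

lemma lintegral_shell_radialExt [Nontrivial E] {φ : Metric.sphere (0 : E) 1 → ℝ}
    (hφ : Measurable φ) {a b : ℝ} (ha : 0 < a) :
    ∫⁻ x in shell a b, ‖radialExt φ x‖ₑ = (∫⁻ θ, ‖φ θ‖ₑ ∂(volume : Measure E).toSphere) *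
      ∫⁻ r in Ioc a b, ENNReal.ofReal (r ^ (finrank ℝ E - 1)) := by
  rw [setLIntegral_shell_eq (w := fun _ => 1) hφ.enorm measurable_const (fun θ r hr => ?_) ha]
  · simp
  · rw [radialExt_smul_coe φ hr, mul_one]

lemma abs_inv_norm_pow_sub_le {x h : E} (d : ℕ) (hx : 1 < ‖x‖) (hh : ‖h‖ ≤ 1 / 4) :
    |(‖x + h‖ ^ d)⁻¹ - (‖x‖ ^ d)⁻¹| ≤ d * 2 ^ d * ‖h‖ := by
  have h1 : 3 / 4 ≤ ‖x + h‖ := by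
    have := norm_sub_le_norm_add x h
    linarith
  have h2 : ‖x + h‖⁻¹ ≤ 2 := (inv_le_comm₀ (by linarith) two_pos).2 (by linarith)
  have h3 : ‖x‖⁻¹ ≤ 2 := (inv_le_comm₀ (by linarith) two_pos).2 (by linarith)
  have h4 : |‖x + h‖⁻¹ - ‖x‖⁻¹| ≤ 2 * ‖h‖ := by
    have hpos : 0 < ‖x + h‖ * ‖x‖ := by nlinarith
    rw [inv_sub_inv (by linarith) (by linarith), abs_div, abs_of_pos hpos, div_le_iff₀ hpos]
    have h5 : |‖x‖ - ‖x + h‖| ≤ ‖h‖ := by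
      simpa using abs_norm_sub_norm_le x (x + h)
    have h6 : 1 / 2 ≤ ‖x + h‖ * ‖x‖ := by nlinarith
    nlinarith [norm_nonneg h]
  rcases d with _ | k
  · simp
  rw [← inv_pow, ← inv_pow]
  refine (abs_pow_sub_pow_le _ _ _).trans ?_
  rw [abs_of_nonneg (by positivity : 0 ≤ ‖x + h‖⁻¹), abs_of_nonneg (by positivity : 0 ≤ ‖x‖⁻¹),
    Nat.add_sub_cancel]
  calc _ ≤ 2 * ‖h‖ * ((k + 1 : ℕ) : ℝ) * 2 ^ k := by
        gcongr
        exact max_le h2 h3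
    _ = _ := by rw [pow_succ]; ring

lemma translationModulus_sphericalKernel_le {φ : Metric.sphere (0 : E) 1 → ℝ}
    (hφ : Measurable φ) {t : ℝ} (ht : t ≤ 1 / 4) {D : ℝ≥0∞}
    (hD : ∀ h : E, ‖h‖ ≤ t → ∫⁻ x in shell 1 2, ‖radialExt φ (x + h) - radialExt φ x‖ₑ ≤ D) :
    translationModulus (sphericalKernel φ) t ≤ 2 ^ finrank ℝ E * D +
      ENNReal.ofReal (finrank ℝ E * 2 ^ finrank ℝ E * t) *
        ∫⁻ x in (shell 1 2 : Set E), ‖radialExt φ x‖ₑ := by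
  have hm := measurable_radialExt hφ
  refine iSup₂_le fun h hh => ?_
  refine le_trans ?_ (add_le_add_left (mul_le_mul_right (hD h hh) _) _)
  rw [← lintegral_const_mul _ (by fun_prop), ← lintegral_const_mul _ (by fun_prop),
    ← lintegral_add_left (by fun_prop)]
  refine setLIntegral_mono' (measurableSet_shell _ _) fun x hx => ?_
  have h1 : 3 / 4 ≤ ‖x + h‖ := by
    have := norm_sub_le_norm_add x h
    linarith [hx.1]
  have h2 : ‖x + h‖⁻¹ ≤ 2 := (inv_le_comm₀ (by linarith) two_pos).2 (by linarith)
  have heq : sphericalKernel φ (x + h) - sphericalKernel φ x =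
      (‖x + h‖ ^ finrank ℝ E)⁻¹ * (radialExt φ (x + h) - radialExt φ x) +
      ((‖x + h‖ ^ finrank ℝ E)⁻¹ - (‖x‖ ^ finrank ℝ E)⁻¹) * radialExt φ x := by
    simp only [sphericalKernel]
    ring
  rw [heq]
  refine (enorm_add_le _ _).trans ?_
  rw [enorm_mul, enorm_mul]
  gcongr
  · rw [← inv_pow, Real.enorm_of_nonneg (by positivity), ENNReal.ofReal_pow (by positivity)]
    gcongr
    simpa using ENNReal.ofReal_le_ofReal h2
  · rw [Real.enorm_eq_ofReal_abs]
    refine ENNReal.ofReal_le_ofReal ((abs_inv_norm_pow_sub_le _ hx.1 (hh.trans ht)).trans ?_)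
    gcongr

lemma lintegral_shell_translate_le {F : E → ℝ≥0∞} {h : E} (hh : ‖h‖ ≤ 1 / 4) :
    ∫⁻ x in shell 1 2, F (x + h) ≤ ∫⁻ x in shell (1 / 2) 3, F x := by
  rw [← lintegral_indicator (measurableSet_shell _ _),
    ← lintegral_indicator (measurableSet_shell _ _),
    ← lintegral_add_right_eq_self ((shell (1 / 2) 3).indicator F) h]
  refine lintegral_mono fun x => ?_
  by_cases hx : x ∈ (shell 1 2 : Set E)
  · have h1 := norm_sub_le_norm_add x h
    have h2 := norm_add_le x h
    have hx' : x + h ∈ (shell (1 / 2) 3 : Set E) := ⟨by linarith [hx.1], by linarith [hx.2]⟩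
    simp only [indicator_of_mem hx, indicator_of_mem hx']
    exact le_rfl
  · rw [indicator_of_notMem hx]
    exact bot_le

lemma lintegral_shell_translate_sub_le {Ω : E → ℝ} (hm : Measurable Ω) {h : E} (hh : ‖h‖ ≤ 1 / 4) :
    ∫⁻ x in shell 1 2, ‖Ω (x + h) - Ω x‖ₑ ≤ 2 * ∫⁻ x in shell (1 / 2) 3, ‖Ω x‖ₑ := by
  calc ∫⁻ x in shell 1 2, ‖Ω (x + h) - Ω x‖ₑ
      ≤ ∫⁻ x in shell 1 2, (‖Ω (x + h)‖ₑ + ‖Ω x‖ₑ) := lintegral_mono fun x => enorm_sub_le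
    _ = (∫⁻ x in shell 1 2, ‖Ω (x + h)‖ₑ) + ∫⁻ x in shell 1 2, ‖Ω (x + 0)‖ₑ := by
        rw [lintegral_add_left (by fun_prop)]
        simp
    _ ≤ (∫⁻ x in shell (1 / 2) 3, ‖Ω x‖ₑ) + ∫⁻ x in shell (1 / 2) 3, ‖Ω x‖ₑ :=
        add_le_add (lintegral_shell_translate_le (F := fun x => ‖Ω x‖ₑ) hh)
          (lintegral_shell_translate_le (F := fun x => ‖Ω x‖ₑ) (by simp))
    _ = _ := (two_mul _).symm

/-- A rotational Dini condition on an angular function makes the associated singular kernel a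
Dini kernel. -/
theorem isDiniKernel_sphericalKernel [Nontrivial E] {φ : Metric.sphere (0 : E) 1 → ℝ}
    (hφ : Measurable φ) (hφi : Integrable φ (volume : Measure E).toSphere)
    (hφ0 : ∫ θ, φ θ ∂(volume : Measure E).toSphere = 0) {M : ℝ → ℝ≥0∞}
    (hM : ∀ t : ℝ, ∀ ρ : E ≃ₗᵢ[ℝ] E, LinearMap.det (ρ.toLinearEquiv : E →ₗ[ℝ] E) = 1 →
      (∀ x, ‖ρ x - x‖ ≤ t * ‖x‖) →
      ∫⁻ x in shell (1 / 2) 3, ‖radialExt φ (ρ x) - radialExt φ x‖ₑ ≤ M t)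
    (hsum : ∑' j : ℕ, M (160 * finrank ℝ E * (4⁻¹ * 2⁻¹ ^ j)) ≠ ⊤) :
    IsDiniKernel (sphericalKernel φ) (∫ θ, ‖φ θ‖ ∂(volume : Measure E).toSphere) where
  measurable := (measurable_radialExt hφ).mul (by fun_prop)
  homogeneous t ht x := sphericalKernel_smul φ ht x
  nonneg := integral_nonneg fun _ => norm_nonneg _
  lintegral_shell_le a b ha hab := by
    rw [lintegral_shell_enorm_sphericalKernel hφ ha hab,
      ENNReal.ofReal_mul (integral_nonneg fun _ => norm_nonneg _),
      ofReal_integral_norm_eq_lintegral_enorm hφi]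
  integral_shell a b _ := integral_shell_eq_zero
    (fun θ r hr => sphericalKernel_smul_coe φ hr θ) hφ0 a b
  dini := by
    have hm := measurable_radialExt hφ
    have hfin : ∀ a b : ℝ, 0 < a → ∫⁻ x in (shell a b : Set E), ‖radialExt φ x‖ₑ ≠ ⊤ := by
      intro a b ha
      rw [lintegral_shell_radialExt hφ ha]
      refine ENNReal.mul_ne_top hφi.2.ne ?_
      have hc : IntegrableOn (fun r : ℝ => r ^ (finrank ℝ E - 1)) (Ioc a b) :=
        ((continuous_pow _).integrableOn_Icc).mono_set Ioc_subset_Icc_self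
      exact (hc.lintegral_lt_top).ne
    have h14 : ∀ j : ℕ, (4⁻¹ * 2⁻¹ ^ j : ℝ) ≤ 1 / 4 := fun j => by
      have : (2⁻¹ : ℝ) ^ j ≤ 1 := pow_le_one₀ (by norm_num) (by norm_num)
      linarith
    obtain ⟨N, hN⟩ : ∃ N : ℕ, (2⁻¹ : ℝ) ^ N < (10 * (finrank ℝ E : ℝ))⁻¹ :=
      exists_pow_lt_of_lt_one
        (by have := finrank_pos (R := ℝ) (M := E); positivity) (by norm_num)
    refine ENNReal.tsum_ne_top_of_tail (fun j => ?_) N ?_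
    · refine ne_top_of_le_ne_top ?_ (translationModulus_sphericalKernel_le hφ (h14 j)
        fun h hh => lintegral_shell_translate_sub_le hm (hh.trans (h14 j)))
      have h1 := hfin (1 / 2) 3 (by norm_num)
      have h2 := hfin 1 2 one_pos
      finiteness
    · set c : ℝ≥0∞ := 2 * (finrank ℝ E * 27 ^ finrank ℝ E *
        ENNReal.ofReal (20 * finrank ℝ E) ^ finrank ℝ E)
      have hle : ∀ j, translationModulus (sphericalKernel φ) (4⁻¹ * 2⁻¹ ^ (j + N)) ≤
          2 ^ finrank ℝ E * (c * M (160 * finrank ℝ E * (4⁻¹ * 2⁻¹ ^ (j + N)))) +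
          ENNReal.ofReal (finrank ℝ E * 2 ^ finrank ℝ E * (4⁻¹ * 2⁻¹ ^ (j + N))) *
            ∫⁻ x in (shell 1 2 : Set E), ‖radialExt φ x‖ₑ := fun j =>
        translationModulus_sphericalKernel_le hφ (h14 _) fun h hh =>
          lintegral_translate_le hm (fun t ht x => radialExt_smul φ ht x) (by positivity) (by
            have h1 : (2⁻¹ : ℝ) ^ (j + N) ≤ 2⁻¹ ^ N :=
              pow_le_pow_of_le_one (by norm_num) (by norm_num) (Nat.le_add_left _ _)
            have h2 : (0 : ℝ) < finrank ℝ E := by exact_mod_cast finrank_pos (R := ℝ) (M := E)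
            have h3 : 10 * (finrank ℝ E : ℝ) * 2⁻¹ ^ (j + N) ≤
                10 * (finrank ℝ E : ℝ) * (10 * (finrank ℝ E : ℝ))⁻¹ := by
              gcongr
              exact h1.trans hN.le
            rw [mul_inv_cancel₀ (by positivity)] at h3
            linarith) (hM _) hh
      refine ne_top_of_le_ne_top ?_ (ENNReal.tsum_le_tsum hle)
      rw [ENNReal.tsum_add, ENNReal.tsum_mul_left, ENNReal.tsum_mul_left, ENNReal.tsum_mul_right]
      have h1 : ∑' j, M (160 * finrank ℝ E * (4⁻¹ * 2⁻¹ ^ (j + N))) ≠ ⊤ :=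
        ne_top_of_le_ne_top hsum (ENNReal.tsum_comp_le_tsum_of_injective
          (add_left_injective N) fun j => M (160 * finrank ℝ E * (4⁻¹ * 2⁻¹ ^ j)))
      have h2 : ∑' j, ENNReal.ofReal (finrank ℝ E * 2 ^ finrank ℝ E * (4⁻¹ * 2⁻¹ ^ (j + N))) ≠ ⊤ := by
        refine Summable.tsum_ofReal_ne_top ?_
        have h3 : Summable fun j : ℕ => (2⁻¹ : ℝ) ^ (j + N) :=
          (summable_nat_add_iff N).2 (summable_geometric_of_lt_one (by norm_num) (by norm_num))
        exact (h3.mul_left 4⁻¹).mul_left _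
      have h3 := hfin 1 2 one_pos
      have h4 : c ≠ ⊤ := by finiteness
      finiteness

end SphericalKernel

section Rotation

open scoped ENNReal Topology
open Module

variable {n : ℕ} {Ω : EuclideanSpace ℝ (Fin n) → ℝ} {φ : unitSphere n → ℝ}

lemma lintegral_shell_isometry_le (ρ : EuclideanSpace ℝ (Fin n) ≃ₗᵢ[ℝ] EuclideanSpace ℝ (Fin n))
    {F : EuclideanSpace ℝ (Fin n) → ℝ} (hF : Measurable F) (a b : ℝ) :
    ∫⁻ x in shell a b, ‖F (ρ x) - F x‖ₑ ≤ 2 * ∫⁻ x in shell a b, ‖F x‖ₑ := by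
  have hρ : ∫⁻ x in shell a b, ‖F (ρ x)‖ₑ = ∫⁻ x in shell a b, ‖F x‖ₑ := by
    rw [← ρ.measurePreserving.setLIntegral_comp_preimage (measurableSet_shell a b) hF.enorm]
    congr 2
    ext x
    simp [shell]
  have hm : Measurable fun x => F (ρ x) := hF.comp ρ.continuous.measurable
  calc ∫⁻ x in shell a b, ‖F (ρ x) - F x‖ₑ
      ≤ ∫⁻ x in shell a b, (‖F (ρ x)‖ₑ + ‖F x‖ₑ) := lintegral_mono fun x => enorm_sub_le
    _ = _ := by rw [lintegral_add_left hm.enorm, hρ, two_mul]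

lemma lintegral_pow_Ioc_ne_zero (k : ℕ) :
    ∫⁻ r in Ioc (1 / 2 : ℝ) 3, ENNReal.ofReal (r ^ k) ≠ 0 := by
  refine (setLIntegral_pos_iff (by fun_prop)).2 ?_ |>.ne'
  refine lt_of_lt_of_le ?_ (measure_mono (s := Ioc (1 / 2 : ℝ) 3) fun r hr => ⟨?_, hr⟩)
  · rw [Real.volume_Ioc]
    norm_num
  · have hr0 : 0 < r := by linarith [hr.1]
    simpa using pow_pos hr0 k

lemma lintegral_pow_Ioc_ne_top (k : ℕ) (a b : ℝ) :
    ∫⁻ r in Ioc a b, ENNReal.ofReal (r ^ k) ≠ ⊤ := by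
  have hc : IntegrableOn (fun r : ℝ => r ^ k) (Ioc a b) :=
    ((continuous_pow _).integrableOn_Icc).mono_set Ioc_subset_Icc_self
  exact hc.lintegral_lt_top.ne

lemma lintegral_shell_rotation [Nontrivial (EuclideanSpace ℝ (Fin n))] (hφ : Measurable φ)
    (ρ : EuclideanSpace ℝ (Fin n) ≃ₗᵢ[ℝ] EuclideanSpace ℝ (Fin n)) {a b : ℝ} (ha : 0 < a) :
    ∫⁻ x in shell a b, ‖radialExt φ (ρ x) - radialExt φ x‖ₑ =
      (∫⁻ θ : unitSphere n, ‖radialExt φ (ρ θ) - radialExt φ θ‖ₑ ∂sphereMeasure n) *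
      ∫⁻ r in Ioc a b, ENNReal.ofReal (r ^ (finrank ℝ (EuclideanSpace ℝ (Fin n)) - 1)) := by
  have hm := measurable_radialExt hφ
  have hm' : Measurable fun x => radialExt φ (ρ x) := hm.comp ρ.continuous.measurable
  rw [setLIntegral_shell_eq (w := fun _ => 1)
    (G := fun θ : unitSphere n => ‖radialExt φ (ρ θ) - radialExt φ θ‖ₑ)
    ((hm'.sub hm).enorm.comp measurable_subtype_coe) measurable_const (fun θ r hr => ?_) ha]
  · simp [sphereMeasure]
  · rw [map_smul, radialExt_smul φ hr, radialExt_smul φ hr, mul_one]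

lemma lintegral_sphere_rotation_le [Nontrivial (EuclideanSpace ℝ (Fin n))] (hφ : Measurable φ)
    (ρ : EuclideanSpace ℝ (Fin n) ≃ₗᵢ[ℝ] EuclideanSpace ℝ (Fin n)) :
    ∫⁻ θ : unitSphere n, ‖radialExt φ (ρ θ) - radialExt φ θ‖ₑ ∂sphereMeasure n ≤
      2 * ∫⁻ θ, ‖φ θ‖ₑ ∂sphereMeasure n := by
  have h := lintegral_shell_isometry_le ρ (measurable_radialExt hφ) (1 / 2) 3
  rw [lintegral_shell_rotation hφ ρ (by norm_num), lintegral_shell_radialExt hφ (by norm_num),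
    ← mul_assoc] at h
  exact (ENNReal.mul_le_mul_iff_left (lintegral_pow_Ioc_ne_zero _)
    (lintegral_pow_Ioc_ne_top _ _ _)).1 h

/-- A function homogeneous of degree zero and integrable on the sphere agrees almost everywhere
with the radial extension of any function equal to it almost everywhere on the sphere. -/
lemma ae_eq_radialExt [Nontrivial (EuclideanSpace ℝ (Fin n))] (hhom : HomogeneousZero Ω)
    (h : ∀ᵐ θ : unitSphere n ∂sphereMeasure n, Ω θ = φ θ) : ∀ᵐ x, Ω x = radialExt φ x := by
  refine (ae_iff_ae_toSphere fun t ht x hx => ?_).2 ?_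
  · rw [hhom t ht x hx, radialExt_smul φ ht]
  · filter_upwards [h] with θ hθ
    rw [hθ, radialExt_coe]

lemma ofReal_integral_rotation [Nontrivial (EuclideanSpace ℝ (Fin n))] (hhom : HomogeneousZero Ω)
    (hφ : Measurable φ) (hφi : Integrable φ (sphereMeasure n))
    (h : ∀ᵐ θ : unitSphere n ∂sphereMeasure n, Ω θ = φ θ)
    (ρ : EuclideanSpace ℝ (Fin n) ≃ₗᵢ[ℝ] EuclideanSpace ℝ (Fin n)) :
    ENNReal.ofReal (∫ θ : unitSphere n, |Ω (ρ θ) - Ω θ| ∂sphereMeasure n) =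
      ∫⁻ θ : unitSphere n, ‖radialExt φ (ρ θ) - radialExt φ θ‖ₑ ∂sphereMeasure n := by
  have hae := ae_eq_radialExt hhom h
  have hρ : ∀ᵐ x, Ω (ρ x) = radialExt φ (ρ x) := ρ.measurePreserving.quasiMeasurePreserving.ae hae
  have hρ' : ∀ᵐ θ : unitSphere n ∂sphereMeasure n, Ω (ρ θ) = radialExt φ (ρ θ) := by
    refine (ae_iff_ae_toSphere (P := fun x => Ω (ρ x) = radialExt φ (ρ x))
      fun t ht x hx => ?_).1 hρ
    rw [map_smul, hhom t ht _ (by simpa using hx), radialExt_smul φ ht]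
  have hm := measurable_radialExt hφ
  have hm' : Measurable fun x => radialExt φ (ρ x) := hm.comp ρ.continuous.measurable
  have hinteg : Integrable (fun θ : unitSphere n => radialExt φ (ρ θ) - radialExt φ θ)
      (sphereMeasure n) :=
    ⟨((hm'.sub hm).comp measurable_subtype_coe).aestronglyMeasurable,
      (lintegral_sphere_rotation_le hφ ρ).trans_lt (ENNReal.mul_lt_top (by simp) hφi.2)⟩
  rw [← ofReal_integral_norm_eq_lintegral_enorm hinteg]
  congr 1
  refine integral_congr_ae ?_
  filter_upwards [h, hρ'] with θ h1 h2
  rw [h1, h2, radialExt_coe, Real.norm_eq_abs]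

lemma bddAbove_omegaRot [Nontrivial (EuclideanSpace ℝ (Fin n))] (hhom : HomogeneousZero Ω)
    (hφ : Measurable φ) (hφi : Integrable φ (sphereMeasure n))
    (h : ∀ᵐ θ : unitSphere n ∂sphereMeasure n, Ω θ = φ θ) (δ : ℝ) :
    BddAbove {I : ℝ | ∃ ρ : EuclideanSpace ℝ (Fin n) ≃ₗᵢ[ℝ] EuclideanSpace ℝ (Fin n),
      LinearMap.det (ρ.toLinearEquiv :
        EuclideanSpace ℝ (Fin n) →ₗ[ℝ] EuclideanSpace ℝ (Fin n)) = 1 ∧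
      (∀ x : EuclideanSpace ℝ (Fin n), ‖x‖ = 1 → ‖ρ x - x‖ ≤ δ) ∧
      I = ∫ θ : unitSphere n, |Ω (ρ θ) - Ω θ| ∂sphereMeasure n} := by
  refine ⟨(2 * ∫⁻ θ, ‖φ θ‖ₑ ∂sphereMeasure n).toReal, ?_⟩
  rintro _ ⟨ρ, -, -, rfl⟩
  refine (ENNReal.ofReal_le_iff_le_toReal (ENNReal.mul_ne_top (by simp) hφi.2.ne)).1 ?_
  rw [ofReal_integral_rotation hhom hφ hφi h]
  exact lintegral_sphere_rotation_le hφ ρ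

lemma omegaRot_mono [Nontrivial (EuclideanSpace ℝ (Fin n))] (hhom : HomogeneousZero Ω)
    (hφ : Measurable φ) (hφi : Integrable φ (sphereMeasure n))
    (h : ∀ᵐ θ : unitSphere n ∂sphereMeasure n, Ω θ = φ θ) {s t : ℝ} (hs : 0 ≤ s) (hst : s ≤ t) :
    omegaRot n Ω s ≤ omegaRot n Ω t := by
  refine csSup_le_csSup (bddAbove_omegaRot hhom hφ hφi h t) ?_ ?_
  · exact ⟨_, LinearIsometryEquiv.refl ℝ _, LinearMap.det_id, fun x _ => by simpa using hs, rfl⟩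
  · rintro _ ⟨ρ, h1, h2, rfl⟩
    exact ⟨ρ, h1, fun x hx => (h2 x hx).trans hst, rfl⟩

lemma omegaRot_nonneg (δ : ℝ) : 0 ≤ omegaRot n Ω δ := by
  refine Real.sSup_nonneg ?_
  rintro _ ⟨ρ, -, -, rfl⟩
  exact integral_nonneg fun _ => abs_nonneg _

lemma lintegral_shell_rotation_le_omegaRot [Nontrivial (EuclideanSpace ℝ (Fin n))]
    (hhom : HomogeneousZero Ω) (hφ : Measurable φ) (hφi : Integrable φ (sphereMeasure n))
    (h : ∀ᵐ θ : unitSphere n ∂sphereMeasure n, Ω θ = φ θ) {t : ℝ}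
    (ρ : EuclideanSpace ℝ (Fin n) ≃ₗᵢ[ℝ] EuclideanSpace ℝ (Fin n))
    (hdet : LinearMap.det (ρ.toLinearEquiv :
      EuclideanSpace ℝ (Fin n) →ₗ[ℝ] EuclideanSpace ℝ (Fin n)) = 1)
    (hρ : ∀ x, ‖ρ x - x‖ ≤ t * ‖x‖) :
    ∫⁻ x in shell (1 / 2) 3, ‖radialExt φ (ρ x) - radialExt φ x‖ₑ ≤
      ENNReal.ofReal (omegaRot n Ω t) * ∫⁻ r in Ioc (1 / 2 : ℝ) 3,
        ENNReal.ofReal (r ^ (finrank ℝ (EuclideanSpace ℝ (Fin n)) - 1)) := by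
  rw [lintegral_shell_rotation hφ ρ (by norm_num), ← ofReal_integral_rotation hhom hφ hφi h]
  gcongr
  exact le_csSup (bddAbove_omegaRot hhom hφ hφi h t)
    ⟨ρ, hdet, fun x hx => by simpa [hx] using hρ x, rfl⟩

/-- An `L¹`-Dini function homogeneous of degree zero with mean zero gives rise to a Dini kernel. -/
theorem L1Dini.exists_isDiniKernel [Nontrivial (EuclideanSpace ℝ (Fin n))]
    (hdini : L1Dini n Ω) (hhom : HomogeneousZero Ω)
    (hmean : ∫ θ : unitSphere n, Ω θ ∂sphereMeasure n = 0) :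
    ∃ (K : EuclideanSpace ℝ (Fin n) → ℝ) (B : ℝ), IsDiniKernel K B ∧
      ∀ᵐ x, Ω x / ‖x‖ ^ n = K x := by
  obtain ⟨hi, hd⟩ := hdini
  set φ : unitSphere n → ℝ := hi.1.mk _
  have hφ : Measurable φ := hi.1.measurable_mk
  have h : ∀ᵐ θ : unitSphere n ∂sphereMeasure n, Ω θ = φ θ := hi.1.ae_eq_mk
  have hφi : Integrable φ (sphereMeasure n) := hi.congr h
  have hφ0 : ∫ θ, φ θ ∂sphereMeasure n = 0 := by rw [← hmean, integral_congr_ae h]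
  have hn : (0 : ℝ) < finrank ℝ (EuclideanSpace ℝ (Fin n)) := by
    exact_mod_cast finrank_pos (R := ℝ) (M := EuclideanSpace ℝ (Fin n))
  refine ⟨sphericalKernel φ, _, isDiniKernel_sphericalKernel hφ hφi hφ0 (fun t ρ h1 h2 =>
    lintegral_shell_rotation_le_omegaRot hhom hφ hφi h ρ h1 h2) ?_, ?_⟩
  · rw [ENNReal.tsum_mul_right]
    refine ENNReal.mul_ne_top ?_ (lintegral_pow_Ioc_ne_top _ _ _)
    simp_rw [← mul_assoc]
    exact tsum_ofReal_geometric_ne_top (fun s t hs hst => omegaRot_mono hhom hφ hφi h hs hst) hd.ne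
      (fun t _ => omegaRot_nonneg t) (by positivity)
  · filter_upwards [ae_eq_radialExt hhom h] with x hx
    rw [sphericalKernel, hx, finrank_euclideanSpace_fin, div_eq_mul_inv]

end Rotation

section SignedMeasure

open scoped ENNReal Topology
open Module

variable {n : ℕ} {Ω : EuclideanSpace ℝ (Fin n) → ℝ}

lemma setIntegral_eq_truncInt {K : EuclideanSpace ℝ (Fin n) → ℝ}
    (hK : ∀ᵐ x, Ω x / ‖x‖ ^ n = K x) {p : Measure (EuclideanSpace ℝ (Fin n))} [IsFiniteMeasure p]
    (hp : p ≪ volume) (x : EuclideanSpace ℝ (Fin n)) (ε : ℝ) :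
    ∫ y in {y | ε < ‖x - y‖}, Ω (x - y) / ‖x - y‖ ^ n ∂p =
      truncInt K (fun y => (p.rnDeriv volume y).toReal) x ε := by
  have hs : MeasurableSet {y : EuclideanSpace ℝ (Fin n) | ε < ‖x - y‖} :=
    measurableSet_lt measurable_const (measurable_const.sub measurable_id).norm
  rw [← setIntegral_rnDeriv_smul hp hs, truncInt]
  have hK' : ∀ᵐ y, Ω (x - y) / ‖x - y‖ ^ n = K (x - y) :=
    (Measure.measurePreserving_sub_left volume x).quasiMeasurePreserving.ae hK
  refine integral_congr_ae (ae_restrict_of_ae ?_)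
  filter_upwards [hK'] with y hy
  rw [hy, smul_eq_mul, mul_comm]

lemma lintegral_enorm_toReal_rnDeriv {p : Measure (EuclideanSpace ℝ (Fin n))} [IsFiniteMeasure p]
    (hp : p ≪ volume) : ∫⁻ y, ‖(p.rnDeriv volume y).toReal‖ₑ = p univ := by
  rw [← Measure.lintegral_rnDeriv hp]
  refine lintegral_congr_ae ?_
  filter_upwards [p.rnDeriv_lt_top volume] with y hy
  rw [Real.enorm_of_nonneg ENNReal.toReal_nonneg, ENNReal.ofReal_toReal hy.ne]

end SignedMeasure

/-- If `Ω` is homogeneous of degree zero with mean value zero on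
`S^{n-1}` and satisfies the `L¹`-Dini condition, and `μ` is a finite absolutely continuous
signed measure on `ℝⁿ`, then a weak type `(1,1)` bound holds:
`λ · m({x : |T_Ω μ(x)| > λ}) ≤ C |μ|(ℝⁿ)` for every `λ > 0`, with `C` depending only on
`Ω` and the dimension. -/
theorem weak_type_one_one_signed_measure
    {n : ℕ} (hn : 0 < n) (Ω : EuclideanSpace ℝ (Fin n) → ℝ)
    (hhom : HomogeneousZero Ω)
    (hmean : ∫ θ : unitSphere n, Ω (θ : EuclideanSpace ℝ (Fin n)) ∂(sphereMeasure n) = 0)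
    (hdini : L1Dini n Ω) :
    ∃ C : ℝ, 0 < C ∧
      ∀ μ : SignedMeasure (EuclideanSpace ℝ (Fin n)),
        μ ≪ᵥ (volume : Measure (EuclideanSpace ℝ (Fin n))).toENNRealVectorMeasure →
        μ.totalVariation Set.univ < ⊤ →
        ∀ lam : ℝ, 0 < lam →
          ENNReal.ofReal lam *
              volume {x : EuclideanSpace ℝ (Fin n) | lam < |TOmega n Ω μ x|} ≤
            ENNReal.ofReal C * μ.totalVariation Set.univ := by
  have : Nonempty (Fin n) := ⟨⟨0, hn⟩⟩
  have : Nontrivial (EuclideanSpace ℝ (Fin n)) := by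
    rw [← Module.finrank_pos_iff (R := ℝ), finrank_euclideanSpace_fin]
    exact hn
  obtain ⟨K, B, hK, hΩK⟩ := hdini.exists_isDiniKernel hhom hmean
  obtain ⟨C, hC, hweak⟩ := hK.exists_weak_type
  refine ⟨(2 * C).toReal + 1, by positivity, fun μ hμ _ lam hlam => ?_⟩
  have hμ' : μ.totalVariation ≪ volume := by
    simpa using SignedMeasure.absolutelyContinuous_ennreal_iff _ _ |>.1 hμ
  obtain ⟨hpos, hneg⟩ := (SignedMeasure.totalVariation_absolutelyContinuous_iff μ _).1 hμ'
  set p := μ.toJordanDecomposition.posPart with hp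
  set q := μ.toJordanDecomposition.negPart with hq
  have hweak' : ∀ r : Measure (EuclideanSpace ℝ (Fin n)), IsFiniteMeasure r → r ≪ volume →
      ∃ S : Set (EuclideanSpace ℝ (Fin n)), ENNReal.ofReal (lam / 2) * volume S ≤ C * r univ ∧
        ∀ᵐ x, x ∉ S → ∃ L, Tendsto (truncInt K (fun y => (r.rnDeriv volume y).toReal) x)
          (nhdsWithin 0 (Ioi 0)) (nhds L) ∧ |L| ≤ lam / 2 := fun r _ hr => by
    rw [← lintegral_enorm_toReal_rnDeriv hr]
    exact hweak _ (r.measurable_rnDeriv _).ennreal_toReal Measure.integrable_toReal_rnDeriv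
      (fun _ => ENNReal.toReal_nonneg) _ (half_pos hlam)
  obtain ⟨S, hS, hSL⟩ := hweak' p inferInstance hpos
  obtain ⟨S', hS', hSL'⟩ := hweak' q inferInstance hneg
  have hsub : volume {x : EuclideanSpace ℝ (Fin n) | lam < |TOmega n Ω μ x|} ≤
      volume S + volume S' := by
    refine (measure_mono_ae ?_).trans (measure_union_le S S')
    filter_upwards [hSL, hSL'] with x hx hx' hlt
    by_contra hnot
    obtain ⟨L, hL, hL1⟩ := hx fun h => hnot (Or.inl h)
    obtain ⟨L', hL', hL1'⟩ := hx' fun h => hnot (Or.inr h)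
    have htrunc : truncT n Ω μ x = fun ε =>
        truncInt K (fun y => (p.rnDeriv volume y).toReal) x ε -
        truncInt K (fun y => (q.rnDeriv volume y).toReal) x ε := by
      funext ε
      rw [truncT, setIntegral_eq_truncInt hΩK hpos, setIntegral_eq_truncInt hΩK hneg]
    have hlim : TOmega n Ω μ x = L - L' := by
      rw [TOmega, htrunc]
      exact (hL.sub hL').limUnder_eq
    have hlt' : lam < |TOmega n Ω μ x| := hlt
    rw [hlim] at hlt'
    linarith [abs_sub L L']
  have htwo : ENNReal.ofReal lam = 2 * ENNReal.ofReal (lam / 2) := by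
    rw [← ENNReal.ofReal_ofNat 2, ← ENNReal.ofReal_mul (by norm_num)]
    congr 1
    ring
  have htv : μ.totalVariation univ = p univ + q univ := rfl
  calc _ ≤ 2 * ENNReal.ofReal (lam / 2) * (volume S + volume S') := by
        rw [htwo]
        gcongr
    _ = 2 * (ENNReal.ofReal (lam / 2) * volume S + ENNReal.ofReal (lam / 2) * volume S') := by ring
    _ ≤ 2 * (C * p univ + C * q univ) := by gcongr
    _ = 2 * C * μ.totalVariation univ := by rw [htv]; ring
    _ ≤ _ := by
        gcongr
        exact (ENNReal.le_ofReal_iff_toReal_le (by finiteness) (by positivity)).2 (by linarith)
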